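/- arXiv:1510.07661 — 5 statements merged into one kernel-verified Lean document; each statement's English description precedes it below -/
import Mathlib

section
/- Let q = p^e be a power of an odd prime with q ≡ 1 (mod 4), set t = (q−1)/4, let T be a generator of the group of multiplicative characters of F_q^×, and let ε denote the trivial character. Then for every λ ∈ F_q with λ ≠ 0, the number of F_q-points of the Dwork K3 surface satisfies #X_λ⁴(F_q) = (q³−1)/(q−1) + 12q·T^t(−1)·T^{2t}(1−λ⁴) + q²·₃F₂(T^t, T^{2t}, T^{3t}; ε, ε | 1/λ⁴)_q + 3q²·binom(T^{3t}, T^t)·₂F₁(T^{3t}, T^t; T^{2t} | 1/λ⁴)_q. -/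
/-- The number of points of the Dwork K3 surface
`x₁⁴ + x₂⁴ + x₃⁴ + x₄⁴ = 4λx₁x₂x₃x₄` in `ℙ³(F)`. -/
noncomputable def dworkK3Count (F : Type*) [Field F] [Fintype F] (lam : F) : ℕ :=
  Nat.card {P : Projectivization F (Fin 4 → F) //
    P.rep 0 ^ 4 + P.rep 1 ^ 4 + P.rep 2 ^ 4 + P.rep 3 ^ 4 =
      4 * lam * (P.rep 0 * P.rep 1 * P.rep 2 * P.rep 3)}

/-- Greene's normalized Jacobi sum `binom(A,B) = B(-1)/q · ∑ₓ A(x) B̄(1-x)`. -/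
noncomputable def jacB {F : Type*} [Field F] [Fintype F] (A B : MulChar F ℂ) : ℂ :=
  B (-1) / (Fintype.card F : ℂ) * ∑ x : F, A x * B⁻¹ (1 - x)

/-- Greene's finite field hypergeometric function `₂F₁(A, B; C | x)`. -/
noncomputable def greene2F1 {F : Type*} [Field F] [Fintype F]
    (A B C : MulChar F ℂ) (x : F) : ℂ :=
  (Fintype.card F : ℂ) / ((Fintype.card F : ℂ) - 1) *
    ∑ᶠ χ : MulChar F ℂ, jacB (A * χ) χ * jacB (B * χ) (C * χ) * χ x

/-- Greene's finite field hypergeometric function `₃F₂(A₀, A₁, A₂; B₁, B₂ | x)`. -/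
noncomputable def greene3F2 {F : Type*} [Field F] [Fintype F]
    (A₀ A₁ A₂ B₁ B₂ : MulChar F ℂ) (x : F) : ℂ :=
  (Fintype.card F : ℂ) / ((Fintype.card F : ℂ) - 1) *
    ∑ᶠ χ : MulChar F ℂ,
      jacB (A₀ * χ) χ * jacB (A₁ * χ) (B₁ * χ) * jacB (A₂ * χ) (B₂ * χ) * χ x

namespace DworkK3

open Finset

noncomputable section

variable {F : Type*} [Field F] [Fintype F]

local instance mulCharFintype : Fintype (MulChar F ℂ) := Fintype.ofFinite _

local instance fieldDecidableEq : DecidableEq F := Classical.decEq F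

local instance mulCharDecidableEq : DecidableEq (MulChar F ℂ) := Classical.decEq _

/-! ### Orthogonality of multiplicative characters -/

lemma card_sub_one_ne_zero : (Fintype.card F : ℂ) - 1 ≠ 0 := by
  rw [sub_ne_zero, Nat.cast_ne_one]
  exact Fintype.one_lt_card.ne'

lemma card_units_cast : (Fintype.card Fˣ : ℂ) = (Fintype.card F : ℂ) - 1 := by
  rw [Fintype.card_units, Nat.cast_sub Fintype.card_pos, Nat.cast_one]

lemma sum_eq_zero_add_sum_units (f : F → ℂ) : ∑ x, f x = f 0 + ∑ u : Fˣ, f u := by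
  rw [← Finset.add_sum_erase _ _ (mem_univ (0 : F))]
  congr 1
  refine (Finset.sum_bij (fun (u : Fˣ) _ => (u : F)) ?_ ?_ ?_ ?_).symm
  · simp
  · intro a _ b _ h
    exact Units.ext h
  · intro b hb
    exact ⟨Units.mk0 b (by simpa using hb), by simp⟩
  · simp

lemma sum_units_eq (f : F → ℂ) (h : f 0 = 0) : ∑ u : Fˣ, f u = ∑ x, f x := by
  rw [sum_eq_zero_add_sum_units f, h, zero_add]

lemma sum_units_mulChar (χ : MulChar F ℂ) :
    ∑ u : Fˣ, χ u = if χ = 1 then (Fintype.card F : ℂ) - 1 else 0 := by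
  split_ifs with h
  · subst h
    simp [MulChar.one_apply_coe, ← card_units_cast]
  · rw [sum_units_eq _ χ.map_zero, MulChar.sum_eq_zero_of_ne_one h]

lemma sum_mulChar_apply (u : Fˣ) :
    ∑ χ : MulChar F ℂ, χ u = if u = 1 then (Fintype.card F : ℂ) - 1 else 0 := by
  split_ifs with h
  · subst h
    simp only [Units.val_one, MulChar.map_one, sum_const, nsmul_eq_mul, mul_one, card_univ]
    rw [← card_units_cast, Fintype.card_eq_nat_card, Fintype.card_eq_nat_card,
      MulChar.card_eq_card_units_of_hasEnoughRootsOfUnity]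
  · obtain ⟨ψ, hψ⟩ := MulChar.exists_apply_ne_one_of_hasEnoughRootsOfUnity F ℂ
      (a := (u : F)) (by simpa using h)
    have key : ψ u * ∑ χ : MulChar F ℂ, χ u = ∑ χ : MulChar F ℂ, χ u := by
      rw [mul_sum]
      exact Fintype.sum_equiv (Equiv.mulLeft ψ) _ _ fun χ => by simp
    have : (ψ u - 1) * ∑ χ : MulChar F ℂ, χ u = 0 := by rw [sub_mul, key, one_mul, sub_self]
    exact (mul_eq_zero.mp this).resolve_left (sub_ne_zero.mpr hψ)

lemma sum_mulChar_mul_inv (u v : Fˣ) :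
    ∑ χ : MulChar F ℂ, χ u * χ⁻¹ v = if u = v then (Fintype.card F : ℂ) - 1 else 0 := by
  have := sum_mulChar_apply (u * v⁻¹)
  simp only [mul_inv_eq_one] at this
  rw [← this]
  exact sum_congr rfl fun χ _ => by rw [MulChar.inv_apply', Units.val_mul, map_mul]; simp

instance : IsCyclic (MulChar F ℂ) :=
  have e := (MulChar.mulEquiv_units F ℂ).some
  isCyclic_of_surjective e.symm e.symm.surjective

lemma filter_pow_eq_one {ψ : MulChar F ℂ} {n : ℕ} (hn : 0 < n) (hψ : orderOf ψ = n) :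
    (univ.filter fun η : MulChar F ℂ => η ^ n = 1) = (range n).image (ψ ^ ·) := by
  symm
  apply Finset.eq_of_subset_of_card_le
  · intro η hη
    obtain ⟨j, -, rfl⟩ := mem_image.mp hη
    rw [mem_filter_univ, ← pow_mul, mul_comm, pow_mul, ← hψ, pow_orderOf_eq_one, one_pow]
  · rw [card_image_of_injOn, card_range]
    · exact IsCyclic.card_pow_eq_one_le hn
    · subst hψ
      exact fun a ha b hb h => pow_injOn_Iio_orderOf (by simpa using ha) (by simpa using hb) h

lemma sum_filter_pow_eq_one {ψ : MulChar F ℂ} {n : ℕ} (hn : 0 < n) (hψ : orderOf ψ = n)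
    (f : MulChar F ℂ → ℂ) :
    ∑ η : MulChar F ℂ, (if η ^ n = 1 then f η else 0) = ∑ j ∈ range n, f (ψ ^ j) := by
  rw [← sum_filter, filter_pow_eq_one hn hψ, sum_image]
  subst hψ
  exact fun a ha b hb h => pow_injOn_Iio_orderOf (by simpa using ha) (by simpa using hb) h

lemma card_pow_eq {ψ : MulChar F ℂ} {n : ℕ} (hn : 0 < n) (hψ : orderOf ψ = n) (u : Fˣ) :
    ∑ x : Fˣ, (if x ^ n = u then (1 : ℂ) else 0) = ∑ j ∈ range n, (ψ ^ j) u := by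
  apply mul_left_cancel₀ (card_sub_one_ne_zero (F := F))
  rw [← sum_filter_pow_eq_one hn hψ (fun η => η u), mul_sum, mul_sum]
  calc _ = ∑ x : Fˣ, ∑ η : MulChar F ℂ, η u * η⁻¹ (x ^ n : Fˣ) := by
        refine sum_congr rfl fun x _ => ?_
        rw [sum_mulChar_mul_inv]
        simp [eq_comm]
    _ = ∑ η : MulChar F ℂ, η u * ∑ x : Fˣ, ((η ^ n)⁻¹ : MulChar F ℂ) x := by
        rw [sum_comm]
        refine sum_congr rfl fun η _ => ?_
        rw [mul_sum]
        refine sum_congr rfl fun x _ => ?_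
        rw [Units.val_pow_eq_pow_val, map_pow, ← MulChar.pow_apply_coe, inv_pow]
    _ = _ := by
        refine sum_congr rfl fun η _ => ?_
        rw [sum_units_mulChar]
        simp only [inv_eq_one]
        split_ifs <;> ring

lemma sum_pow_eq {ψ : MulChar F ℂ} {n : ℕ} (hn : 0 < n) (hψ : orderOf ψ = n) (f : Fˣ → ℂ) :
    ∑ x : Fˣ, f (x ^ n) = ∑ u : Fˣ, f u * ∑ j ∈ range n, (ψ ^ j) u := by
  simp_rw [← card_pow_eq hn hψ, mul_sum]
  rw [sum_comm]
  exact sum_congr rfl fun x _ => by simp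

lemma card_rootsOfUnity_eq {ψ : MulChar F ℂ} {n : ℕ} (hn : 0 < n) (hψ : orderOf ψ = n) :
    ∑ x : Fˣ, (if x ^ n = 1 then (1 : ℂ) else 0) = n := by
  rw [card_pow_eq hn hψ]
  simp

/-! ### Gauss sums -/

lemma sum_units_mul_addChar (χ : MulChar F ℂ) (θ : AddChar F ℂ) (c : Fˣ) :
    ∑ u : Fˣ, χ u * θ (c * u) = χ⁻¹ c * gaussSum χ θ := by
  rw [← gaussSum_mulShift_eq]
  exact sum_units_eq (fun x => χ x * θ (c * x)) (by simp [χ.map_zero])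

lemma gaussSum_one {θ : AddChar F ℂ} (hθ : θ.IsPrimitive) :
    gaussSum (1 : MulChar F ℂ) θ = -1 :=
  gaussSum_one_left (by simpa using hθ one_ne_zero)

lemma gaussSum_ne_zero {θ : AddChar F ℂ} (hθ : θ.IsPrimitive) (χ : MulChar F ℂ) :
    gaussSum χ θ ≠ 0 := by
  by_cases h : χ = 1
  · rw [h, gaussSum_one hθ]
    norm_num
  · exact gaussSum_ne_zero_of_nontrivial (by simp) h hθ

lemma gaussSum_mul_inv {θ : AddChar F ℂ} (hθ : θ.IsPrimitive) (χ : MulChar F ℂ) :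
    gaussSum χ θ * gaussSum χ⁻¹ θ = if χ = 1 then 1 else χ (-1) * Fintype.card F := by
  split_ifs with h
  · rw [h, inv_one, gaussSum_one hθ]
    norm_num
  · rw [← mul_gaussSum_inv_eq_gaussSum χ⁻¹, mul_left_comm, gaussSum_mul_gaussSum_eq_card h hθ,
      MulChar.inv_apply', inv_neg_one]

omit [Fintype F] in
lemma apply_neg_one_mul_self (χ : MulChar F ℂ) : χ (-1) * χ (-1) = 1 := by
  rw [← map_mul, neg_one_mul, neg_neg, MulChar.map_one]

omit [Fintype F] in
lemma apply_mul_inv_apply (χ : MulChar F ℂ) {x : F} (hx : x ≠ 0) : χ x * χ⁻¹ x = 1 := by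
  rw [← MulChar.mul_apply, mul_inv_cancel, MulChar.one_apply hx.isUnit]

lemma jacobiSum_self {φ : MulChar F ℂ} (hφ : orderOf φ = 2) (h2 : (2 : F) ≠ 0)
    {η : MulChar F ℂ} (hη : η ≠ 1) :
    jacobiSum η η = η⁻¹ 4 * jacobiSum η φ := by
  have hu := sum_pow_eq Nat.two_pos hφ (fun u : Fˣ => η (1 - u))
  have h4 : (4 : F) ≠ 0 := by
    rw [show (4 : F) = 2 * 2 by norm_num]
    exact mul_ne_zero h2 h2
  have hsub : ∑ x : F, η (1 - x) = 0 := by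
    rw [← MulChar.sum_eq_zero_of_ne_one hη]
    exact Fintype.sum_equiv (Equiv.subLeft 1) _ _ fun x => rfl
  rw [sum_eq_zero_add_sum_units (fun x => η (1 - x))] at hsub
  have hsq : ∑ y : F, η (1 - y ^ 2) = jacobiSum φ η := by
    rw [sum_eq_zero_add_sum_units (fun y => η (1 - y ^ 2)), jacobiSum,
      ← sum_units_eq (fun x => φ x * η (1 - x)) (by simp [φ.map_zero])]
    simp only [Units.val_pow_eq_pow_val, sum_range_succ, sum_range_zero, pow_zero, pow_one,
      zero_add, MulChar.one_apply_coe, mul_add, mul_one, sum_add_distrib] at hu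
    rw [hu, ← add_assoc]
    simp only [sub_zero, MulChar.map_one] at hsub
    simp [hsub, mul_comm]
  rw [jacobiSum_comm η φ, ← hsq, jacobiSum, mul_sum]
  refine Fintype.sum_equiv ((Equiv.mulLeft₀ 2 h2).trans (Equiv.subRight 1)) _ _ fun x => ?_
  rw [← map_mul, MulChar.inv_apply', ← map_mul]
  congr 1
  simp only [Equiv.trans_apply, Equiv.subRight_apply, Equiv.mulLeft₀_apply]
  field_simp
  ring

/-- The Hasse–Davenport product relation for the quadratic character. -/
lemma hasseDavenport_two {θ : AddChar F ℂ} (hθ : θ.IsPrimitive) {φ : MulChar F ℂ}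
    (hφ : orderOf φ = 2) (h2 : (2 : F) ≠ 0) (η : MulChar F ℂ) :
    gaussSum η θ * gaussSum (η * φ) θ = η⁻¹ 4 * gaussSum (η ^ 2) θ * gaussSum φ θ := by
  have h4 : (4 : F) = 2 ^ 2 := by norm_num
  have hφ2 : φ ^ 2 = 1 := hφ ▸ pow_orderOf_eq_one φ
  by_cases h1 : η = 1
  · subst h1
    rw [inv_one, MulChar.one_apply (h4 ▸ (pow_ne_zero 2 h2).isUnit), one_pow, one_mul, one_mul]
  have hη2 : (η ^ 2) (4 : F) = (η 4) ^ 2 := MulChar.pow_apply' _ two_ne_zero _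
  by_cases h : η ^ 2 = 1
  · have hη : η = φ := by
      have := (filter_pow_eq_one Nat.two_pos hφ).le (mem_filter_univ η |>.mpr h)
      obtain ⟨j, hj, rfl⟩ := mem_image.mp this
      rw [mem_range] at hj
      interval_cases j
      · simp at h1
      · simp
    subst hη
    rw [← pow_two, hφ2, MulChar.inv_apply', h4, ← inv_pow, map_pow, ← MulChar.pow_apply' _ two_ne_zero,
      hφ2, MulChar.one_apply (inv_ne_zero h2).isUnit]
    ring
  · have hηφ : η * φ ≠ 1 := by
      intro h'
      apply h
      rw [eq_inv_of_mul_eq_one_left h', inv_pow, hφ2, inv_one]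
    have e1 := jacobiSum_mul_nontrivial (χ := η) (φ := η) (by rwa [← pow_two]) θ
    have e2 := jacobiSum_mul_nontrivial hηφ θ
    rw [jacobiSum_self hφ h2 h1, ← pow_two] at e1
    apply mul_left_cancel₀ (gaussSum_ne_zero hθ η)
    linear_combination (-gaussSum (η * φ) θ) * e1 + η⁻¹ 4 * gaussSum (η ^ 2) θ * e2

section OrderFour

variable {χ : MulChar F ℂ} {θ : AddChar F ℂ}

lemma orderOf_sq (hχ : orderOf χ = 4) : orderOf (χ ^ 2) = 2 := by
  rw [orderOf_pow, hχ]
  norm_num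

omit [Fintype F] in
lemma pow_ne_one (hχ : orderOf χ = 4) {n : ℕ} (hn : n ≠ 0) (h : n < 4) : χ ^ n ≠ 1 :=
  pow_ne_one_of_lt_orderOf hn (hχ ▸ h)

omit [Fintype F] in
lemma pow_four_eq_one (hχ : orderOf χ = 4) : χ ^ 4 = 1 := hχ ▸ pow_orderOf_eq_one χ

omit [Fintype F] in
lemma sq_inv (hχ : orderOf χ = 4) : (χ ^ 2)⁻¹ = χ ^ 2 := by
  rw [inv_eq_iff_mul_eq_one, ← pow_add, pow_four_eq_one hχ]

omit [Fintype F] in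
lemma cube_eq_inv (hχ : orderOf χ = 4) : χ ^ 3 = χ⁻¹ := by
  rw [eq_inv_iff_mul_eq_one, ← pow_succ, pow_four_eq_one hχ]

lemma gaussSum_sq_mul_self (hθ : θ.IsPrimitive) (hχ : orderOf χ = 4) :
    gaussSum (χ ^ 2) θ * gaussSum (χ ^ 2) θ = Fintype.card F := by
  have := gaussSum_mul_inv hθ (χ ^ 2)
  rwa [sq_inv hχ, if_neg (pow_ne_one hχ two_ne_zero (by norm_num)),
    MulChar.pow_apply' _ two_ne_zero, pow_two (χ (-1)), apply_neg_one_mul_self, one_mul] at this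

lemma gaussSum_mul_gaussSum_cube (hθ : θ.IsPrimitive) (hχ : orderOf χ = 4) :
    gaussSum χ θ * gaussSum (χ ^ 3) θ = χ (-1) * Fintype.card F := by
  have h := pow_ne_one hχ one_ne_zero (by norm_num)
  rw [cube_eq_inv hχ, gaussSum_mul_inv hθ, if_neg (by simpa using h)]

omit [Fintype F] in
lemma four_ne_zero_of_two (h2 : (2 : F) ≠ 0) : (4 : F) ≠ 0 := by
  rw [show (4 : F) = 2 * 2 by norm_num]
  exact mul_ne_zero h2 h2

lemma hasseDavenport_four_aux (hθ : θ.IsPrimitive) (hχ : orderOf χ = 4) (h2 : (2 : F) ≠ 0)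
    (η : MulChar F ℂ) :
    gaussSum η θ * gaussSum (η * χ) θ * gaussSum (η * χ ^ 2) θ * gaussSum (η * χ ^ 3) θ *
      (η ^ 4) 4 = χ⁻¹ 4 * Fintype.card F * gaussSum (η ^ 4) θ * gaussSum (χ ^ 2) θ := by
  have hφ := orderOf_sq hχ
  have e1 := hasseDavenport_two hθ hφ h2 η
  have e2 := hasseDavenport_two hθ hφ h2 (η * χ)
  have e3 := hasseDavenport_two hθ hφ h2 (η ^ 2)
  rw [mul_assoc, ← pow_succ', mul_pow] at e2
  rw [← pow_mul] at e3
  have e4 := gaussSum_sq_mul_self hθ hχ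
  have h4 := four_ne_zero_of_two h2
  have e5 := apply_mul_inv_apply η h4
  rw [← inv_pow, MulChar.pow_apply' _ two_ne_zero] at e3
  rw [mul_inv, MulChar.mul_apply] at e2
  rw [MulChar.pow_apply' _ four_ne_zero]
  calc _ = (gaussSum η θ * gaussSum (η * χ ^ 2) θ) * (gaussSum (η * χ) θ * gaussSum (η * χ ^ 3) θ)
        * η 4 ^ 4 := by ring
    _ = (η 4 * η⁻¹ 4) ^ 4 * χ⁻¹ 4 * (gaussSum (χ ^ 2) θ * gaussSum (χ ^ 2) θ) *
        gaussSum (η ^ 4) θ * gaussSum (χ ^ 2) θ := by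
      rw [e1, e2]
      linear_combination (η⁻¹ 4) ^ 2 * χ⁻¹ 4 * (gaussSum (χ ^ 2) θ) ^ 2 * η 4 ^ 4 * e3
    _ = _ := by rw [e5, e4]; ring

lemma inv_apply_four (hθ : θ.IsPrimitive) (hχ : orderOf χ = 4) (h2 : (2 : F) ≠ 0) :
    χ⁻¹ 4 = χ (-1) := by
  have := hasseDavenport_four_aux hθ hχ h2 1
  have h4 := four_ne_zero_of_two h2
  rw [one_pow, one_mul, one_mul, one_mul, MulChar.one_apply h4.isUnit, gaussSum_one hθ] at this
  have e := gaussSum_mul_gaussSum_cube hθ hχ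
  have hq : (Fintype.card F : ℂ) ≠ 0 := by simp
  apply mul_right_cancel₀ (mul_ne_zero hq (gaussSum_ne_zero hθ (χ ^ 2)))
  linear_combination this + gaussSum (χ ^ 2) θ * e

/-- The Hasse–Davenport product relation for a character of order four. -/
lemma hasseDavenport_four (hθ : θ.IsPrimitive) (hχ : orderOf χ = 4) (h2 : (2 : F) ≠ 0)
    (η : MulChar F ℂ) :
    gaussSum η θ * gaussSum (η * χ) θ * gaussSum (η * χ ^ 2) θ * gaussSum (η * χ ^ 3) θ *
      (η ^ 4) 4 = χ (-1) * Fintype.card F * gaussSum (η ^ 4) θ * gaussSum (χ ^ 2) θ := by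
  rw [hasseDavenport_four_aux hθ hχ h2, inv_apply_four hθ hχ h2]

omit [Fintype F] in
lemma apply_pow_four (hχ : orderOf χ = 4) {lam : F} (hlam : lam ≠ 0) : χ (lam ^ 4) = 1 := by
  rw [map_pow, ← MulChar.pow_apply' _ four_ne_zero, pow_four_eq_one hχ,
    MulChar.one_apply hlam.isUnit]

omit [Fintype F] in
lemma sq_apply_neg_one : (χ ^ 2) (-1) = 1 := by
  rw [MulChar.pow_apply' _ two_ne_zero, pow_two, apply_neg_one_mul_self]

omit [Fintype F] in
lemma cube_apply_neg_one : (χ ^ 3) (-1) = χ (-1) := by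
  rw [MulChar.pow_apply' _ three_ne_zero, pow_succ, pow_two, apply_neg_one_mul_self, one_mul]

lemma gaussSum_mul_gaussSum_inv_twist (hθ : θ.IsPrimitive) (hχ : orderOf χ = 4) {j k : ℕ}
    (hjk : j + k = 4) (η : MulChar F ℂ) :
    gaussSum (η * χ ^ j) θ * gaussSum (η⁻¹ * χ ^ k) θ =
      if η = χ ^ k then 1 else η (-1) * (χ ^ j) (-1) * Fintype.card F := by
  have h : χ ^ j * χ ^ k = 1 := by rw [← pow_add, hjk, pow_four_eq_one hχ]
  have hk : χ ^ k = (χ ^ j)⁻¹ := eq_inv_of_mul_eq_one_right h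
  rw [hk, ← mul_inv, gaussSum_mul_inv hθ, MulChar.mul_apply]
  simp only [mul_eq_one_iff_eq_inv]

/-- The contribution of the characters `η⁴` to the part of the point count attached to `₃F₂`. -/
lemma sum_invariant_type (hθ : θ.IsPrimitive) (hχ : orderOf χ = 4) {lam : F} (hlam : lam ≠ 0) :
    ∑ η : MulChar F ℂ, gaussSum η⁻¹ θ * gaussSum (η⁻¹ * χ) θ * gaussSum (η⁻¹ * χ ^ 2) θ *
        gaussSum (η⁻¹ * χ ^ 3) θ * η (lam ^ 4) * gaussSum η θ ^ 4 =
      (Fintype.card F : ℂ) * ∑ η : MulChar F ℂ, η (-1) * gaussSum (η⁻¹ * χ) θ *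
        gaussSum (η⁻¹ * χ ^ 2) θ * gaussSum (η⁻¹ * χ ^ 3) θ * gaussSum η θ ^ 3 * η (lam ^ 4) +
      ((Fintype.card F : ℂ) - 1) * (χ (-1) * Fintype.card F * gaussSum (χ ^ 2) θ) := by
  have key (η : MulChar F ℂ) : gaussSum η⁻¹ θ * gaussSum (η⁻¹ * χ) θ *
        gaussSum (η⁻¹ * χ ^ 2) θ *
        gaussSum (η⁻¹ * χ ^ 3) θ * η (lam ^ 4) * gaussSum η θ ^ 4 =
      (Fintype.card F : ℂ) * (η (-1) * gaussSum (η⁻¹ * χ) θ *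
        gaussSum (η⁻¹ * χ ^ 2) θ * gaussSum (η⁻¹ * χ ^ 3) θ * gaussSum η θ ^ 3 * η (lam ^ 4)) +
      if η = 1 then ((Fintype.card F : ℂ) - 1) *
        (χ (-1) * Fintype.card F * gaussSum (χ ^ 2) θ) else 0 := by
    have h0 := gaussSum_mul_inv hθ η
    split_ifs at h0 ⊢ with h
    · subst h
      have e := gaussSum_mul_gaussSum_cube hθ hχ
      have hl : (1 : MulChar F ℂ) (lam ^ 4) = 1 := MulChar.one_apply (pow_ne_zero 4 hlam).isUnit
      have hn : (1 : MulChar F ℂ) (-1) = 1 := MulChar.one_apply (by simp)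
      simp only [inv_one, one_mul, gaussSum_one hθ, hl, hn]
      linear_combination ((Fintype.card F : ℂ) - 1) * gaussSum (χ ^ 2) θ * e
    · linear_combination gaussSum (η⁻¹ * χ) θ * gaussSum (η⁻¹ * χ ^ 2) θ *
        gaussSum (η⁻¹ * χ ^ 3) θ * η (lam ^ 4) * gaussSum η θ ^ 3 * h0
  simp_rw [key, sum_add_distrib, ← mul_sum]
  simp

/-- The contribution of the characters `η⁴` to the part of the point count attached to `₂F₁`. -/
lemma sum_quadratic_type (hθ : θ.IsPrimitive) (hχ : orderOf χ = 4) {lam : F} (hlam : lam ≠ 0) :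
    ∑ η : MulChar F ℂ, gaussSum η⁻¹ θ * gaussSum (η⁻¹ * χ) θ * gaussSum (η⁻¹ * χ ^ 2) θ *
        gaussSum (η⁻¹ * χ ^ 3) θ * η (lam ^ 4) *
        (gaussSum η θ ^ 2 * gaussSum (η * χ ^ 2) θ ^ 2) =
      (Fintype.card F : ℂ) ^ 2 * ∑ η : MulChar F ℂ, gaussSum (η⁻¹ * χ) θ *
        gaussSum (η⁻¹ * χ ^ 3) θ * gaussSum η θ * gaussSum (η * χ ^ 2) θ * η (lam ^ 4) +
      2 * (((Fintype.card F : ℂ) - 1) * (χ (-1) * Fintype.card F ^ 2 * gaussSum (χ ^ 2) θ)) := by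
  have key (η : MulChar F ℂ) : gaussSum η⁻¹ θ * gaussSum (η⁻¹ * χ) θ *
        gaussSum (η⁻¹ * χ ^ 2) θ *
        gaussSum (η⁻¹ * χ ^ 3) θ * η (lam ^ 4) *
        (gaussSum η θ ^ 2 * gaussSum (η * χ ^ 2) θ ^ 2) =
      (Fintype.card F : ℂ) ^ 2 * (gaussSum (η⁻¹ * χ) θ *
        gaussSum (η⁻¹ * χ ^ 3) θ * gaussSum η θ * gaussSum (η * χ ^ 2) θ * η (lam ^ 4)) +
      ((if η = 1 then ((Fintype.card F : ℂ) - 1) *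
        (χ (-1) * Fintype.card F ^ 2 * gaussSum (χ ^ 2) θ) else 0) +
      if η = χ ^ 2 then ((Fintype.card F : ℂ) - 1) *
        (χ (-1) * Fintype.card F ^ 2 * gaussSum (χ ^ 2) θ) else 0) := by
    have h0 := gaussSum_mul_inv hθ η
    have h2 := gaussSum_mul_gaussSum_inv_twist hθ hχ (j := 2) (k := 2) rfl η
    rw [sq_apply_neg_one, mul_one] at h2
    have hne : χ ^ 2 ≠ 1 := pow_ne_one hχ two_ne_zero (by norm_num)
    have e := gaussSum_mul_gaussSum_cube hθ hχ
    have e2 := gaussSum_sq_mul_self hθ hχ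
    have hn := apply_neg_one_mul_self η
    have hx : gaussSum η⁻¹ θ * gaussSum (η⁻¹ * χ) θ *
        gaussSum (η⁻¹ * χ ^ 2) θ *
        gaussSum (η⁻¹ * χ ^ 3) θ * η (lam ^ 4) *
        (gaussSum η θ ^ 2 * gaussSum (η * χ ^ 2) θ ^ 2) =
        (gaussSum η θ * gaussSum η⁻¹ θ) *
        (gaussSum (η * χ ^ 2) θ * gaussSum (η⁻¹ * χ ^ 2) θ) * (gaussSum (η⁻¹ * χ) θ *
        gaussSum (η⁻¹ * χ ^ 3) θ * gaussSum η θ * gaussSum (η * χ ^ 2) θ * η (lam ^ 4)) := by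
      ring
    rw [hx, h0, h2]
    by_cases h1 : η = 1
    · subst h1
      have hl : (1 : MulChar F ℂ) (lam ^ 4) = 1 := MulChar.one_apply (pow_ne_zero 4 hlam).isUnit
      have hn : (1 : MulChar F ℂ) (-1) = 1 := MulChar.one_apply (by simp)
      simp only [inv_one, one_mul, gaussSum_one hθ, hl, hn, if_true, if_neg hne.symm]
      linear_combination (((Fintype.card F : ℂ) ^ 2 - Fintype.card F) * gaussSum (χ ^ 2) θ) * e
    · by_cases hq : η = χ ^ 2
      · subst hq
        have hl : (χ ^ 2) (lam ^ 4) = 1 := by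
          rw [MulChar.pow_apply' _ two_ne_zero, apply_pow_four hχ hlam, one_pow]
        have h3 : χ ^ 2 * χ = χ ^ 3 := (pow_succ χ 2).symm
        have h5 : χ ^ 2 * χ ^ 3 = χ := by rw [← pow_add, pow_succ, pow_four_eq_one hχ, one_mul]
        have h4 : χ ^ 2 * χ ^ 2 = 1 := by rw [← pow_add, pow_four_eq_one hχ]
        simp only [sq_inv hχ, h3, h4, h5, gaussSum_one hθ, hl, sq_apply_neg_one, if_true,
          if_neg hne, zero_add]
        linear_combination (((Fintype.card F : ℂ) ^ 2 - Fintype.card F) * gaussSum (χ ^ 2) θ) * e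
      · simp only [if_neg h1, if_neg hq]
        linear_combination (Fintype.card F : ℂ) ^ 2 * (gaussSum (η⁻¹ * χ) θ *
          gaussSum (η⁻¹ * χ ^ 3) θ * gaussSum η θ * gaussSum (η * χ ^ 2) θ * η (lam ^ 4)) * hn
  simp_rw [key, sum_add_distrib, ← mul_sum]
  simp only [sum_ite_eq', mem_univ, if_true]
  ring

lemma sum_gaussSum_mul_gaussSum_inv {φ : MulChar F ℂ} (hφ : φ ≠ 1) (θ : AddChar F ℂ) (y : Fˣ) :
    ∑ η : MulChar F ℂ, η y * gaussSum η θ * gaussSum (η⁻¹ * φ) θ =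
      ((Fintype.card F : ℂ) - 1) * (φ y * φ⁻¹ (1 + y)) * gaussSum φ θ := by
  have hg (η : MulChar F ℂ) : gaussSum η θ = ∑ u : Fˣ, η u * θ u := by
    simpa using (sum_units_mul_addChar η θ 1).symm
  calc _ = ∑ a : Fˣ, ∑ b : Fˣ, (∑ η : MulChar F ℂ, η (y * a : Fˣ) * η⁻¹ b) *
        (θ a * (φ b * θ b)) := by
        simp_rw [hg, mul_sum, sum_mul]
        rw [sum_comm]
        conv_lhs => enter [2, a]; rw [sum_comm]
        rw [sum_comm]
        refine sum_congr rfl fun a _ => sum_congr rfl fun b _ => sum_congr rfl fun η _ => ?_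
        rw [Units.val_mul, map_mul, MulChar.mul_apply]
        ring
    _ = ∑ a : Fˣ, ((Fintype.card F : ℂ) - 1) * (θ a * (φ (y * a : Fˣ) * θ (y * a : Fˣ))) := by
        simp_rw [sum_mulChar_mul_inv, ite_mul, zero_mul]
        simp
    _ = ((Fintype.card F : ℂ) - 1) * φ y * ∑ a : Fˣ, φ a * θ ((1 + y) * a) := by
        rw [mul_sum]
        refine sum_congr rfl fun a _ => ?_
        rw [Units.val_mul, map_mul, add_mul, one_mul, AddChar.map_add_eq_mul]
        ring
    _ = _ := by
        by_cases h : (1 + y : F) = 0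
        · simp [h, MulChar.map_zero, sum_units_mulChar, hφ]
        · have := sum_units_mul_addChar φ θ (Units.mk0 _ h)
          rw [Units.val_mk0] at this
          rw [this]
          ring

/-- The contribution of the characters `η⁴` to the elementary part of the point count. -/
lemma sum_mixed_type (hθ : θ.IsPrimitive) (hχ : orderOf χ = 4) {lam : F} (hlam : lam ≠ 0) :
    ∑ η : MulChar F ℂ, gaussSum η⁻¹ θ * gaussSum (η⁻¹ * χ) θ * gaussSum (η⁻¹ * χ ^ 2) θ *
        gaussSum (η⁻¹ * χ ^ 3) θ * η (lam ^ 4) *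
        (gaussSum η θ ^ 2 * gaussSum (η * χ) θ * gaussSum (η * χ ^ 3) θ) =
      (Fintype.card F : ℂ) ^ 3 * (((Fintype.card F : ℂ) - 1) * (χ ^ 2) (1 - lam ^ 4) *
        gaussSum (χ ^ 2) θ) +
      (Fintype.card F : ℂ) ^ 2 * ((Fintype.card F : ℂ) - 1) * (gaussSum (χ ^ 2) θ -
        χ (-1) * (gaussSum χ θ ^ 2 + gaussSum (χ ^ 3) θ ^ 2)) := by
  have key (η : MulChar F ℂ) : gaussSum η⁻¹ θ * gaussSum (η⁻¹ * χ) θ *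
        gaussSum (η⁻¹ * χ ^ 2) θ *
        gaussSum (η⁻¹ * χ ^ 3) θ * η (lam ^ 4) *
        (gaussSum η θ ^ 2 * gaussSum (η * χ) θ * gaussSum (η * χ ^ 3) θ) =
      (Fintype.card F : ℂ) ^ 3 *
        (η (-lam ^ 4) * gaussSum η θ * gaussSum (η⁻¹ * χ ^ 2) θ) +
      ((if η = 1 then (Fintype.card F : ℂ) ^ 2 * ((Fintype.card F : ℂ) - 1) *
        gaussSum (χ ^ 2) θ else 0) +
      (if η = χ ^ 3 then -((Fintype.card F : ℂ) ^ 2 * ((Fintype.card F : ℂ) - 1) *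
        (χ (-1) * gaussSum (χ ^ 3) θ ^ 2)) else 0) +
      if η = χ then -((Fintype.card F : ℂ) ^ 2 * ((Fintype.card F : ℂ) - 1) *
        (χ (-1) * gaussSum χ θ ^ 2)) else 0) := by
    have h0 := gaussSum_mul_inv hθ η
    have h1 := gaussSum_mul_gaussSum_inv_twist hθ hχ (j := 1) (k := 3) rfl η
    have h3 := gaussSum_mul_gaussSum_inv_twist hθ hχ (j := 3) (k := 1) rfl η
    rw [pow_one] at h1 h3
    rw [cube_apply_neg_one] at h3
    have hw := apply_neg_one_mul_self η
    have hr := apply_neg_one_mul_self χ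
    have hx : gaussSum η⁻¹ θ * gaussSum (η⁻¹ * χ) θ *
        gaussSum (η⁻¹ * χ ^ 2) θ *
        gaussSum (η⁻¹ * χ ^ 3) θ * η (lam ^ 4) *
        (gaussSum η θ ^ 2 * gaussSum (η * χ) θ * gaussSum (η * χ ^ 3) θ) =
        (gaussSum η θ * gaussSum η⁻¹ θ) *
        (gaussSum (η * χ) θ * gaussSum (η⁻¹ * χ ^ 3) θ) *
        (gaussSum (η * χ ^ 3) θ * gaussSum (η⁻¹ * χ) θ) *
        (η (lam ^ 4) * gaussSum η θ * gaussSum (η⁻¹ * χ ^ 2) θ) := by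
      ring
    have hl : η (-lam ^ 4) = η (-1) * η (lam ^ 4) := by rw [← map_mul, neg_one_mul]
    have n1 : χ ≠ 1 := by simpa using pow_ne_one hχ one_ne_zero (by norm_num)
    have n3 : χ ^ 3 ≠ 1 := pow_ne_one hχ three_ne_zero (by norm_num)
    have n31 : χ ^ 3 ≠ χ := by
      intro h
      apply pow_ne_one hχ two_ne_zero (by norm_num)
      rwa [pow_succ, mul_eq_right] at h
    rw [hx, h0, h1, h3, hl]
    by_cases e1 : η = 1
    · subst e1
      have hl : (1 : MulChar F ℂ) (lam ^ 4) = 1 := MulChar.one_apply (pow_ne_zero 4 hlam).isUnit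
      have hn : (1 : MulChar F ℂ) (-1) = 1 := MulChar.one_apply (by simp)
      simp only [inv_one, one_mul, gaussSum_one hθ, hl, hn, if_true, if_neg n1.symm, if_neg n3.symm]
      linear_combination (-(Fintype.card F : ℂ) ^ 2 * gaussSum (χ ^ 2) θ) * hr
    by_cases e2 : η = χ
    · subst e2
      have h5 : η⁻¹ * η ^ 2 = η := by rw [pow_two, inv_mul_cancel_left]
      simp only [if_true, if_neg n1, if_neg n31.symm, h5, apply_pow_four hχ hlam]
      linear_combination ((Fintype.card F : ℂ) ^ 2 * gaussSum η θ ^ 2) * η (-1) * hr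
    by_cases e3 : η = χ ^ 3
    · subst e3
      have h5 : (χ ^ 3)⁻¹ * χ ^ 2 = χ ^ 3 := by
        rw [cube_eq_inv hχ, inv_inv, ← pow_succ', cube_eq_inv hχ]
      have hl : (χ ^ 3) (lam ^ 4) = 1 := by
        rw [MulChar.pow_apply' _ three_ne_zero, apply_pow_four hχ hlam, one_pow]
      simp only [if_true, if_neg n3, if_neg n31, h5, hl, cube_apply_neg_one]
      linear_combination ((Fintype.card F : ℂ) ^ 2 * gaussSum (χ ^ 3) θ ^ 2) * χ (-1) * hr
    · simp only [if_neg e1, if_neg e2, if_neg e3]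
      linear_combination (Fintype.card F : ℂ) ^ 3 * (η (lam ^ 4) * gaussSum η θ *
        gaussSum (η⁻¹ * χ ^ 2) θ) * η (-1) * (χ (-1) ^ 2 * hw + hr)
  have hy : -lam ^ 4 ≠ 0 := neg_ne_zero.mpr (pow_ne_zero 4 hlam)
  have hs := sum_gaussSum_mul_gaussSum_inv (pow_ne_one hχ two_ne_zero (by norm_num)) θ
    (Units.mk0 _ hy)
  have hl : (χ ^ 2) (-lam ^ 4) = 1 := by
    rw [← neg_one_mul, map_mul, sq_apply_neg_one, MulChar.pow_apply' _ two_ne_zero,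
      apply_pow_four hχ hlam, one_pow, one_mul]
  rw [Units.val_mk0, hl, sq_inv hχ, ← sub_eq_add_neg] at hs
  simp_rw [key, sum_add_distrib, ← mul_sum, hs]
  simp only [sum_ite_eq', mem_univ, if_true]
  ring

/-! ### Greene's functions in terms of Gauss sums -/

lemma jacB_eq (hθ : θ.IsPrimitive) {A B : MulChar F ℂ} (h : A ≠ 1 ∨ B ≠ 1) :
    jacB A B = A (-1) / (Fintype.card F : ℂ) ^ 2 *
      (gaussSum A θ * gaussSum B⁻¹ θ * gaussSum (A⁻¹ * B) θ) := by
  have hJ : jacB A B = B (-1) / Fintype.card F * jacobiSum A B⁻¹ := rfl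
  have hq : (Fintype.card F : ℂ) ≠ 0 := by simp
  have hA := apply_neg_one_mul_self A
  have hB := apply_neg_one_mul_self B
  rw [hJ]
  by_cases hAB : A * B⁻¹ = 1
  · obtain rfl : A = B := mul_inv_eq_one.mp hAB
    have h1 : A ≠ 1 := by simpa using h
    have e := gaussSum_mul_inv hθ A
    rw [if_neg h1] at e
    rw [jacobiSum_nontrivial_inv h1, e, inv_mul_cancel, gaussSum_one hθ]
    field_simp
  · have e := gaussSum_mul_inv hθ (A * B⁻¹)
    rw [if_neg hAB, mul_inv, inv_inv, MulChar.mul_apply, MulChar.inv_apply', inv_neg_one] at e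
    have e2 := jacobiSum_mul_nontrivial hAB θ
    rw [← e2]
    field_simp
    linear_combination -A (-1) * jacobiSum A B⁻¹ * e -
      B (-1) * Fintype.card F * jacobiSum A B⁻¹ * hA

omit [Fintype F] in
lemma inv_apply_inv (η : MulChar F ℂ) (x : F) : η⁻¹ x⁻¹ = η x := by
  rw [MulChar.inv_apply', inv_inv]

omit [Fintype F] in
lemma inv_apply_neg_one (η : MulChar F ℂ) : η⁻¹ (-1) = η (-1) := by
  rw [MulChar.inv_apply', inv_neg_one]

lemma greene3F2_eq (hθ : θ.IsPrimitive) (hχ : orderOf χ = 4) (x : F) :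
    (Fintype.card F : ℂ) ^ 2 * greene3F2 χ (χ ^ 2) (χ ^ 3) 1 1 x⁻¹ =
      χ (-1) * gaussSum (χ ^ 2) θ / ((Fintype.card F : ℂ) ^ 2 * ((Fintype.card F : ℂ) - 1)) *
      ∑ η : MulChar F ℂ, η (-1) * gaussSum (η⁻¹ * χ) θ *
        gaussSum (η⁻¹ * χ ^ 2) θ * gaussSum (η⁻¹ * χ ^ 3) θ * gaussSum η θ ^ 3 * η x := by
  have hq : (Fintype.card F : ℂ) ≠ 0 := by simp
  have hq1 := card_sub_one_ne_zero (F := F)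
  have n1 : χ ≠ 1 := by simpa using pow_ne_one hχ one_ne_zero (by norm_num)
  have key (η : MulChar F ℂ) : jacB (χ * η⁻¹) η⁻¹ * jacB (χ ^ 2 * η⁻¹) (1 * η⁻¹) *
      jacB (χ ^ 3 * η⁻¹) (1 * η⁻¹) * η⁻¹ x⁻¹ =
      χ (-1) * gaussSum (χ ^ 2) θ / (Fintype.card F : ℂ) ^ 5 *
      (η (-1) * gaussSum (η⁻¹ * χ) θ *
        gaussSum (η⁻¹ * χ ^ 2) θ * gaussSum (η⁻¹ * χ ^ 3) θ * gaussSum η θ ^ 3 * η x) := by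
    have aux {A : MulChar F ℂ} (hA : A ≠ 1) : A * η⁻¹ ≠ 1 ∨ η⁻¹ ≠ 1 := by
      by_contra! h
      exact hA (by simpa [h.2] using h.1)
    have inv1 (A : MulChar F ℂ) : (A * η⁻¹)⁻¹ * η⁻¹ = A⁻¹ := by
      rw [mul_inv, mul_assoc, inv_inv, mul_inv_cancel, mul_one]
    have h3 : (χ ^ 3)⁻¹ = χ := by rw [cube_eq_inv hχ, inv_inv]
    rw [one_mul, jacB_eq hθ (aux n1), jacB_eq hθ (aux (pow_ne_one hχ two_ne_zero (by norm_num))),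
      jacB_eq hθ (aux (pow_ne_one hχ three_ne_zero (by norm_num))), inv1, inv1, inv1, sq_inv hχ,
      h3, ← cube_eq_inv hχ, inv_inv, inv_apply_inv]
    simp only [MulChar.mul_apply, sq_apply_neg_one, cube_apply_neg_one, inv_apply_neg_one, one_mul]
    rw [mul_comm χ η⁻¹, mul_comm (χ ^ 2) η⁻¹, mul_comm (χ ^ 3) η⁻¹]
    have e := gaussSum_mul_gaussSum_cube hθ hχ
    have hw := apply_neg_one_mul_self η
    have hr := apply_neg_one_mul_self χ
    field_simp
    linear_combination η (-1) * gaussSum (η⁻¹ * χ) θ * gaussSum (η⁻¹ * χ ^ 2) θ *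
      gaussSum (η⁻¹ * χ ^ 3) θ * gaussSum η θ ^ 3 * η x * gaussSum (χ ^ 2) θ *
      (χ (-1) ^ 2 * η (-1) ^ 2 * e + Fintype.card F * χ (-1) * (χ (-1) ^ 2 * hw + hr))
  rw [greene3F2, finsum_eq_sum_of_fintype, ← Fintype.sum_equiv (Equiv.inv (MulChar F ℂ)) _ _
    fun η => (key η).symm, ← mul_sum]
  field_simp

lemma greene2F1_eq (hθ : θ.IsPrimitive) (hχ : orderOf χ = 4) (x : F) :
    3 * (Fintype.card F : ℂ) ^ 2 * jacB (χ ^ 3) χ * greene2F1 (χ ^ 3) χ (χ ^ 2) x⁻¹ =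
      3 * χ (-1) * gaussSum (χ ^ 2) θ / ((Fintype.card F : ℂ) * ((Fintype.card F : ℂ) - 1)) *
      ∑ η : MulChar F ℂ, gaussSum (η⁻¹ * χ) θ *
        gaussSum (η⁻¹ * χ ^ 3) θ * gaussSum η θ * gaussSum (η * χ ^ 2) θ * η x := by
  have hq : (Fintype.card F : ℂ) ≠ 0 := by simp
  have hq1 := card_sub_one_ne_zero (F := F)
  have n1 : χ ≠ 1 := by simpa using pow_ne_one hχ one_ne_zero (by norm_num)
  have n3 := pow_ne_one hχ three_ne_zero (by norm_num)
  have h3 : (χ ^ 3)⁻¹ = χ := by rw [cube_eq_inv hχ, inv_inv]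
  have e := gaussSum_mul_gaussSum_cube hθ hχ
  have hr := apply_neg_one_mul_self χ
  have hB : jacB (χ ^ 3) χ = χ (-1) / (Fintype.card F : ℂ) ^ 2 *
      (gaussSum (χ ^ 3) θ * gaussSum (χ ^ 3) θ * gaussSum (χ ^ 2) θ) := by
    rw [jacB_eq hθ (Or.inl n3), h3, ← cube_eq_inv hχ, cube_apply_neg_one, ← pow_two χ]
  have key (η : MulChar F ℂ) : jacB (χ ^ 3 * η⁻¹) η⁻¹ * jacB (χ * η⁻¹) (χ ^ 2 * η⁻¹) * η⁻¹ x⁻¹ =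
      gaussSum χ θ ^ 2 / (Fintype.card F : ℂ) ^ 4 *
      (gaussSum (η⁻¹ * χ) θ *
        gaussSum (η⁻¹ * χ ^ 3) θ * gaussSum η θ * gaussSum (η * χ ^ 2) θ * η x) := by
    have aux1 : χ ^ 3 * η⁻¹ ≠ 1 ∨ η⁻¹ ≠ 1 := by
      by_contra! h
      exact n3 (by simpa [h.2] using h.1)
    have aux2 : χ * η⁻¹ ≠ 1 ∨ χ ^ 2 * η⁻¹ ≠ 1 := by
      by_contra! h
      have := h.1.trans h.2.symm
      rw [mul_left_inj, pow_two, left_eq_mul] at this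
      exact n1 this
    have inv1 : (χ ^ 3 * η⁻¹)⁻¹ * η⁻¹ = χ := by
      rw [mul_inv, mul_assoc, inv_inv, mul_inv_cancel, mul_one, h3]
    have inv2 : (χ * η⁻¹)⁻¹ * (χ ^ 2 * η⁻¹) = χ := by
      rw [pow_two, mul_assoc χ χ, mul_left_comm, inv_mul_cancel, mul_one]
    rw [jacB_eq hθ aux1, jacB_eq hθ aux2, inv1, inv2, mul_inv, sq_inv hχ, inv_inv, inv_apply_inv]
    simp only [MulChar.mul_apply, cube_apply_neg_one, inv_apply_neg_one]
    rw [mul_comm χ η⁻¹, mul_comm (χ ^ 2) η, mul_comm (χ ^ 3) η⁻¹]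
    have hw := apply_neg_one_mul_self η
    field_simp
    linear_combination gaussSum (η⁻¹ * χ) θ * gaussSum (η⁻¹ * χ ^ 3) θ * gaussSum η θ *
      gaussSum (η * χ ^ 2) θ * η x * gaussSum χ θ ^ 2 * (χ (-1) ^ 2 * hw + hr)
  set S := ∑ η : MulChar F ℂ, gaussSum (η⁻¹ * χ) θ *
    gaussSum (η⁻¹ * χ ^ 3) θ * gaussSum η θ * gaussSum (η * χ ^ 2) θ * η x with hS
  rw [hB, greene2F1, finsum_eq_sum_of_fintype,
    ← Fintype.sum_equiv (Equiv.inv (MulChar F ℂ)) _ _ fun η => (key η).symm, ← mul_sum, ← hS]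
  field_simp
  linear_combination χ (-1) * gaussSum (χ ^ 2) θ * S *
    ((gaussSum χ θ * gaussSum (χ ^ 3) θ + χ (-1) * Fintype.card F) * e +
    (Fintype.card F : ℂ) ^ 2 * hr)

/-! ### Summing over the torus -/

lemma sum_pow_four_mul (hχ : orderOf χ = 4) (f : Fˣ → Fˣ → ℂ) (m : Fˣ) :
    4 * ∑ x : Fˣ, f (x ^ 4) (x * m) =
      ∑ x : Fˣ, ∑ c : Fˣ, if (x * m) ^ 4 = c ^ 4 then f (x ^ 4) c else 0 := by
  have hsub (x : Fˣ) : ∑ c : Fˣ, (if (x * m) ^ 4 = c ^ 4 then f (x ^ 4) c else 0) =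
      ∑ ζ : Fˣ, if ζ ^ 4 = 1 then f (x ^ 4) (x * m * ζ) else 0 := by
    refine (Fintype.sum_equiv (Equiv.mulLeft (x * m)) _ _ fun ζ => ?_).symm
    simp only [Equiv.coe_mulLeft, mul_pow (x * m) ζ, left_eq_mul]
  simp_rw [hsub]
  rw [sum_comm]
  have h4 := card_rootsOfUnity_eq (by norm_num : 0 < 4) hχ
  push_cast at h4
  rw [← h4, sum_mul]
  refine sum_congr rfl fun ζ _ => ?_
  split_ifs with h
  · rw [one_mul]
    refine (Fintype.sum_equiv (Equiv.mulRight ζ) _ _ fun x => ?_).symm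
    rw [Equiv.coe_mulRight, mul_pow, h, mul_one, mul_right_comm]
  · simp

lemma sum_pow_four_twist (hχ : orderOf χ = 4) (η : MulChar F ℂ) (θ : AddChar F ℂ) (z : Fˣ) :
    ∑ x : Fˣ, η (x ^ 4 : Fˣ) * θ (z * (x ^ 4 : Fˣ)) =
      η⁻¹ z * (gaussSum η θ + gaussSum (η * χ) θ * χ⁻¹ z + gaussSum (η * χ ^ 2) θ * χ⁻¹ z ^ 2 +
        gaussSum (η * χ ^ 3) θ * χ⁻¹ z ^ 3) := by
  rw [sum_pow_eq (by norm_num : 0 < 4) hχ fun u : Fˣ => η u * θ (z * u)]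
  have key (j : ℕ) : ∑ u : Fˣ, η u * θ (z * u) * (χ ^ j) u =
      η⁻¹ z * (gaussSum (η * χ ^ j) θ * χ⁻¹ z ^ j) := by
    have := sum_units_mul_addChar (η * χ ^ j) θ z
    rw [mul_inv, ← inv_pow, MulChar.mul_apply, MulChar.pow_apply_coe] at this
    rw [mul_comm (gaussSum _ _), ← mul_assoc (η⁻¹ _), ← this]
    exact sum_congr rfl fun u _ => by rw [MulChar.mul_apply]; ring
  simp only [sum_range_succ, sum_range_zero, zero_add, mul_add, sum_add_distrib, key]
  simp

omit [Field F] [Fintype F] in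
lemma sum_mul_quintuple {ι : Type*} [Fintype ι] (a b : ι → ℂ) :
    ∑ y, ∑ v, ∑ w, ∑ x, ∑ c, a x * a y * a v * a w * b c = (∑ x, a x) ^ 4 * ∑ c, b c := by
  simp_rw [← mul_sum, ← sum_mul, ← mul_sum, ← sum_mul, ← mul_sum, ← sum_mul, ← mul_sum]
  ring

omit [Field F] [Fintype F] in
lemma sum_rotate {ι : Type*} [Fintype ι] (f : ι → ι → ι → ι → ℂ) :
    ∑ x, ∑ y, ∑ v, ∑ w, f x y v w = ∑ y, ∑ v, ∑ w, ∑ x, f x y v w := by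
  rw [sum_comm]
  refine sum_congr rfl fun y _ => ?_
  rw [sum_comm]
  refine sum_congr rfl fun v _ => ?_
  rw [sum_comm]

lemma sum_torus (hχ : orderOf χ = 4) (θ : AddChar F ℂ) (l z : Fˣ) :
    4 * ((Fintype.card F : ℂ) - 1) * ∑ x : Fˣ, ∑ y : Fˣ, ∑ v : Fˣ, ∑ w : Fˣ,
        θ (z * ((x ^ 4 + y ^ 4 + v ^ 4 + w ^ 4 : F) - l * (x * y * v * w))) =
      ∑ η : MulChar F ℂ, (η ^ 4) l * gaussSum (η ^ 4)⁻¹ θ *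
        (gaussSum η θ + gaussSum (η * χ) θ * χ⁻¹ z + gaussSum (η * χ ^ 2) θ * χ⁻¹ z ^ 2 +
          gaussSum (η * χ ^ 3) θ * χ⁻¹ z ^ 3) ^ 4 := by
  have hη (η : MulChar F ℂ) : (η ^ 4) l * gaussSum (η ^ 4)⁻¹ θ *
        (gaussSum η θ + gaussSum (η * χ) θ * χ⁻¹ z + gaussSum (η * χ ^ 2) θ * χ⁻¹ z ^ 2 +
          gaussSum (η * χ ^ 3) θ * χ⁻¹ z ^ 3) ^ 4 =
      (∑ x : Fˣ, η (x ^ 4 : Fˣ) * θ (z * (x ^ 4 : Fˣ))) ^ 4 *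
        ∑ c : Fˣ, η⁻¹ (c ^ 4 : Fˣ) * θ (-(z * l) * c) := by
    have e1 := sum_units_mul_addChar (η ^ 4)⁻¹ θ (-(z * l))
    have e2 : ∑ c : Fˣ, η⁻¹ (c ^ 4 : Fˣ) * θ (-(z * l) * c) =
        (η ^ 4) z * (η ^ 4) l * gaussSum (η ^ 4)⁻¹ θ := by
      have hn : (η ^ 4) (-(z * l) : F) = (η ^ 4) z * (η ^ 4) l := by
        rw [← neg_one_mul, map_mul, map_mul, MulChar.pow_apply' _ four_ne_zero (-1)]
        linear_combination (η ^ 4) z * (η ^ 4) l * (η (-1) ^ 2 + 1) * apply_neg_one_mul_self η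
      rw [inv_inv, Units.val_neg, Units.val_mul, hn] at e1
      rw [← e1]
      refine sum_congr rfl fun c _ => ?_
      rw [Units.val_pow_eq_pow_val, map_pow, ← MulChar.pow_apply_coe, inv_pow]
    rw [sum_pow_four_twist hχ, e2, MulChar.pow_apply_coe η 4 z]
    have e3 := apply_mul_inv_apply η z.ne_zero
    have e4 : (η z * η⁻¹ z) ^ 4 = 1 := by rw [e3, one_pow]
    rw [mul_pow] at e4
    linear_combination (-((η ^ 4) l * gaussSum (η ^ 4)⁻¹ θ *
        (gaussSum η θ + gaussSum (η * χ) θ * χ⁻¹ z + gaussSum (η * χ ^ 2) θ * χ⁻¹ z ^ 2 +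
          gaussSum (η * χ ^ 3) θ * χ⁻¹ z ^ 3) ^ 4)) * e4
  simp_rw [hη]
  have havg (y v w : Fˣ) :
      4 * ((Fintype.card F : ℂ) - 1) * ∑ x : Fˣ,
        θ (z * ((x ^ 4 + y ^ 4 + v ^ 4 + w ^ 4 : F) - l * (x * y * v * w))) =
      ∑ x : Fˣ, ∑ c : Fˣ, ∑ η : MulChar F ℂ, (η (x ^ 4 : Fˣ) * θ (z * (x ^ 4 : Fˣ))) *
        (η (y ^ 4 : Fˣ) * θ (z * (y ^ 4 : Fˣ))) * (η (v ^ 4 : Fˣ) * θ (z * (v ^ 4 : Fˣ))) *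
        (η (w ^ 4 : Fˣ) * θ (z * (w ^ 4 : Fˣ))) * (η⁻¹ (c ^ 4 : Fˣ) * θ (-(z * l) * c)) := by
    have h := sum_pow_four_mul hχ
      (fun u c : Fˣ => θ (z * ((u + y ^ 4 + v ^ 4 + w ^ 4 : F) - l * c))) (y * v * w)
    have h' : ∑ x : Fˣ, θ (z * ((x ^ 4 + y ^ 4 + v ^ 4 + w ^ 4 : F) - l * (x * y * v * w))) =
        ∑ x : Fˣ, θ (z * (((x ^ 4 : Fˣ) + y ^ 4 + v ^ 4 + w ^ 4 : F) -
          l * (x * (y * v * w) : Fˣ))) := by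
      refine sum_congr rfl fun x _ => ?_
      push_cast
      ring_nf
    rw [h', mul_right_comm, h, sum_mul]
    refine sum_congr rfl fun x _ => ?_
    rw [sum_mul]
    refine sum_congr rfl fun c _ => ?_
    have ho := sum_mulChar_mul_inv ((x * (y * v * w)) ^ 4) (c ^ 4)
    have hθ' : θ (z * (((x ^ 4 : Fˣ) + y ^ 4 + v ^ 4 + w ^ 4 : F) - l * c)) =
        θ (z * (x ^ 4 : Fˣ)) * θ (z * (y ^ 4 : Fˣ)) * θ (z * (v ^ 4 : Fˣ)) *
        θ (z * (w ^ 4 : Fˣ)) * θ (-(z * l) * c) := by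
      simp only [← AddChar.map_add_eq_mul]
      push_cast
      ring_nf
    have hif : (if (x * (y * v * w)) ^ 4 = c ^ 4 then
        θ (z * (((x ^ 4 : Fˣ) + y ^ 4 + v ^ 4 + w ^ 4 : F) - l * c)) else 0) *
          ((Fintype.card F : ℂ) - 1) =
        (if (x * (y * v * w)) ^ 4 = c ^ 4 then (Fintype.card F : ℂ) - 1 else 0) *
        θ (z * (((x ^ 4 : Fˣ) + y ^ 4 + v ^ 4 + w ^ 4 : F) - l * c)) := by
      split_ifs <;> ring
    rw [hif, ← ho, hθ', sum_mul]
    refine sum_congr rfl fun η _ => ?_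
    simp only [mul_pow, Units.val_mul, map_mul]
    ring
  rw [sum_rotate, mul_sum]
  simp_rw [← sum_mul_quintuple]
  symm
  rw [sum_comm]
  refine sum_congr rfl fun y _ => ?_
  rw [sum_comm, mul_sum]
  refine sum_congr rfl fun v _ => ?_
  rw [sum_comm, mul_sum]
  refine sum_congr rfl fun w _ => ?_
  rw [havg, sum_comm]
  refine sum_congr rfl fun x _ => ?_
  rw [sum_comm]

lemma sum_inv_apply_pow (hχ : orderOf χ = 4) {k : ℕ} (hk : k ≠ 0) (h4 : k < 4) :
    ∑ z : Fˣ, χ⁻¹ z ^ k = 0 := by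
  have h : (χ⁻¹) ^ k ≠ 1 := by simpa using pow_ne_one hχ hk h4
  have := sum_units_mulChar (χ⁻¹ ^ k)
  rw [if_neg h] at this
  simpa only [MulChar.pow_apply_coe] using this

omit [Fintype F] in
lemma inv_apply_pow_four (hχ : orderOf χ = 4) (z : Fˣ) : χ⁻¹ z ^ 4 = 1 := by
  rw [← MulChar.pow_apply_coe, inv_pow, pow_four_eq_one hχ, inv_one, MulChar.one_apply_coe]

lemma sum_cubic (hχ : orderOf χ = 4) (a b c d : ℂ) :
    ∑ z : Fˣ, (a + b * χ⁻¹ z + c * χ⁻¹ z ^ 2 + d * χ⁻¹ z ^ 3) =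
      ((Fintype.card F : ℂ) - 1) * a := by
  have h1 := sum_inv_apply_pow hχ one_ne_zero (by norm_num)
  have h2 := sum_inv_apply_pow hχ two_ne_zero (by norm_num)
  have h3 := sum_inv_apply_pow hχ three_ne_zero (by norm_num)
  simp only [pow_one] at h1
  simp only [sum_add_distrib, ← mul_sum, h1, h2, h3, sum_const, card_univ, nsmul_eq_mul,
    card_units_cast]
  ring

lemma cubic_mul_cubic {w : ℂ} (hw : w ^ 4 = 1) (a b c d a' b' c' d' : ℂ) :
    (a + b * w + c * w ^ 2 + d * w ^ 3) * (a' + b' * w + c' * w ^ 2 + d' * w ^ 3) =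
      (a * a' + b * d' + c * c' + d * b') + (a * b' + b * a' + c * d' + d * c') * w +
        (a * c' + b * b' + c * a' + d * d') * w ^ 2 +
        (a * d' + b * c' + c * b' + d * a') * w ^ 3 := by
  linear_combination ((b * d' + c * c' + d * b') + (c * d' + d * c') * w + d * d' * w ^ 2) * hw

lemma sum_cubic_sq (hχ : orderOf χ = 4) (a b c d : ℂ) :
    ∑ z : Fˣ, (a + b * χ⁻¹ z + c * χ⁻¹ z ^ 2 + d * χ⁻¹ z ^ 3) ^ 2 =
      ((Fintype.card F : ℂ) - 1) * (a ^ 2 + c ^ 2 + 2 * b * d) := by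
  simp_rw [pow_two (_ + _), cubic_mul_cubic (inv_apply_pow_four hχ _), sum_cubic hχ]
  ring

lemma sum_cubic_cube (hχ : orderOf χ = 4) (a b c d : ℂ) :
    ∑ z : Fˣ, (a + b * χ⁻¹ z + c * χ⁻¹ z ^ 2 + d * χ⁻¹ z ^ 3) ^ 3 =
      ((Fintype.card F : ℂ) - 1) *
        (a ^ 3 + 3 * a * c ^ 2 + 6 * a * b * d + 3 * c * (b ^ 2 + d ^ 2)) := by
  simp_rw [pow_three (_ + _), cubic_mul_cubic (inv_apply_pow_four hχ _), sum_cubic hχ]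
  ring

lemma sum_cubic_pow_four (hχ : orderOf χ = 4) (a b c d : ℂ) :
    ∑ z : Fˣ, (a + b * χ⁻¹ z + c * χ⁻¹ z ^ 2 + d * χ⁻¹ z ^ 3) ^ 4 =
      ((Fintype.card F : ℂ) - 1) *
        ((a ^ 4 + 3 * (a ^ 2 * c ^ 2) + 12 * (a ^ 2 * b * d)) +
        (b ^ 4 + 3 * (b ^ 2 * d ^ 2) + 12 * (b ^ 2 * c * a)) +
        (c ^ 4 + 3 * (c ^ 2 * a ^ 2) + 12 * (c ^ 2 * d * b)) +
        (d ^ 4 + 3 * (d ^ 2 * b ^ 2) + 12 * (d ^ 2 * a * c))) := by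
  simp_rw [pow_succ (_ + _) 3, pow_three (_ + _), cubic_mul_cubic (inv_apply_pow_four hχ _),
    sum_cubic hχ]
  ring

lemma sum_twist_invariant {c : MulChar F ℂ → ℂ} (hc : ∀ η, c (η * χ) = c η)
    (f : MulChar F ℂ → ℂ) : ∑ η, c η * f (η * χ) = ∑ η, c η * f η :=
  Fintype.sum_equiv (Equiv.mulRight χ) _ _ fun η => by rw [Equiv.coe_mulRight, hc]

lemma sum_sum_torus (hθ : θ.IsPrimitive) (hχ : orderOf χ = 4) (h2 : (2 : F) ≠ 0) {lam : F}
    (hlam : lam ≠ 0) :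
    ∑ z : Fˣ, ∑ x : Fˣ, ∑ y : Fˣ, ∑ v : Fˣ, ∑ w : Fˣ,
        θ (z * ((x ^ 4 + y ^ 4 + v ^ 4 + w ^ 4 : F) - 4 * lam * (x * y * v * w))) =
      χ (-1) * gaussSum (χ ^ 2) θ / (Fintype.card F : ℂ) ^ 2 *
        ∑ η : MulChar F ℂ, gaussSum η⁻¹ θ * gaussSum (η⁻¹ * χ) θ * gaussSum (η⁻¹ * χ ^ 2) θ *
          gaussSum (η⁻¹ * χ ^ 3) θ * η (lam ^ 4) *
          (gaussSum η θ ^ 4 + 3 * (gaussSum η θ ^ 2 * gaussSum (η * χ ^ 2) θ ^ 2) +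
            12 * (gaussSum η θ ^ 2 * gaussSum (η * χ) θ * gaussSum (η * χ ^ 3) θ)) := by
  have hq : (Fintype.card F : ℂ) ≠ 0 := by simp
  have hl : 4 * lam ≠ 0 := mul_ne_zero (four_ne_zero_of_two h2) hlam
  set H : MulChar F ℂ → ℂ := fun η => gaussSum η θ ^ 4 +
    3 * (gaussSum η θ ^ 2 * gaussSum (η * χ ^ 2) θ ^ 2) +
    12 * (gaussSum η θ ^ 2 * gaussSum (η * χ) θ * gaussSum (η * χ ^ 3) θ) with hH
  set c : MulChar F ℂ → ℂ := fun η => (η ^ 4) (4 * lam) * gaussSum (η ^ 4)⁻¹ θ with hcdef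
  have hc (η : MulChar F ℂ) : c (η * χ) = c η := by
    simp only [hcdef, mul_pow, pow_four_eq_one hχ, mul_one]
  have hc' (η : MulChar F ℂ) : c η = χ (-1) * gaussSum (χ ^ 2) θ / (Fintype.card F : ℂ) ^ 2 *
      (gaussSum η⁻¹ θ * gaussSum (η⁻¹ * χ) θ * gaussSum (η⁻¹ * χ ^ 2) θ *
        gaussSum (η⁻¹ * χ ^ 3) θ * η (lam ^ 4)) := by
    have e := hasseDavenport_four hθ hχ h2 η⁻¹
    have e2 := gaussSum_sq_mul_self hθ hχ
    have hr := apply_neg_one_mul_self χ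
    have e3 := apply_mul_inv_apply (η ^ 4) (four_ne_zero_of_two h2)
    rw [inv_pow] at e
    simp only [hcdef, map_mul, map_pow η, ← MulChar.pow_apply' η four_ne_zero]
    field_simp
    linear_combination (η ^ 4) lam * ((η ^ 4) 4 * (χ (-1) * gaussSum (χ ^ 2) θ * (-e)
      - gaussSum (η ^ 4)⁻¹ θ * Fintype.card F * (e2 * χ (-1) ^ 2 + Fintype.card F * hr)) +
      χ (-1) * gaussSum (χ ^ 2) θ * gaussSum η⁻¹ θ * gaussSum (η⁻¹ * χ) θ *
        gaussSum (η⁻¹ * χ ^ 2) θ * gaussSum (η⁻¹ * χ ^ 3) θ * e3)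
  have key : 4 * ((Fintype.card F : ℂ) - 1) * ∑ z : Fˣ, ∑ x : Fˣ, ∑ y : Fˣ, ∑ v : Fˣ, ∑ w : Fˣ,
        θ (z * ((x ^ 4 + y ^ 4 + v ^ 4 + w ^ 4 : F) - 4 * lam * (x * y * v * w))) =
      4 * ((Fintype.card F : ℂ) - 1) * ∑ η, c η * H η := by
    rw [mul_sum]
    have ht := fun z => sum_torus hχ θ (Units.mk0 _ hl) z
    simp only [Units.val_mk0] at ht
    simp_rw [ht]
    rw [sum_comm]
    simp_rw [← mul_sum, sum_cubic_pow_four hχ]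
    have hE (η : MulChar F ℂ) : (η ^ 4) (4 * lam) * gaussSum (η ^ 4)⁻¹ θ *
        (((Fintype.card F : ℂ) - 1) *
        ((gaussSum η θ ^ 4 + 3 * (gaussSum η θ ^ 2 * gaussSum (η * χ ^ 2) θ ^ 2) +
          12 * (gaussSum η θ ^ 2 * gaussSum (η * χ) θ * gaussSum (η * χ ^ 3) θ)) +
        (gaussSum (η * χ) θ ^ 4 + 3 * (gaussSum (η * χ) θ ^ 2 * gaussSum (η * χ ^ 3) θ ^ 2) +
          12 * (gaussSum (η * χ) θ ^ 2 * gaussSum (η * χ ^ 2) θ * gaussSum η θ)) +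
        (gaussSum (η * χ ^ 2) θ ^ 4 + 3 * (gaussSum (η * χ ^ 2) θ ^ 2 * gaussSum η θ ^ 2) +
          12 * (gaussSum (η * χ ^ 2) θ ^ 2 * gaussSum (η * χ ^ 3) θ * gaussSum (η * χ) θ)) +
        (gaussSum (η * χ ^ 3) θ ^ 4 +
          3 * (gaussSum (η * χ ^ 3) θ ^ 2 * gaussSum (η * χ) θ ^ 2) +
          12 * (gaussSum (η * χ ^ 3) θ ^ 2 * gaussSum η θ * gaussSum (η * χ ^ 2) θ)))) =
        ((Fintype.card F : ℂ) - 1) * (c η * H η + c η * H (η * χ) + c η * H (η * χ * χ) +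
          c η * H (η * χ * χ * χ)) := by
      have m2 : η * χ * χ = η * χ ^ 2 := by rw [pow_two, mul_assoc]
      have m3 : η * χ ^ 2 * χ = η * χ ^ 3 := by rw [mul_assoc, ← pow_succ]
      have m4 : η * χ ^ 3 * χ = η := by rw [mul_assoc, ← pow_succ, pow_four_eq_one hχ, mul_one]
      simp only [hH, hcdef, pow_three χ, pow_two χ, ← mul_assoc]
      simp only [m2, m3, m4]
      ring
    simp_rw [hE]
    rw [← mul_sum]
    simp only [sum_add_distrib]
    have s1 := sum_twist_invariant hc H
    have s2 := sum_twist_invariant hc fun η => H (η * χ)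
    have s3 := sum_twist_invariant hc fun η => H (η * χ * χ)
    rw [s3, s2, s1]
    ring
  have hne : 4 * ((Fintype.card F : ℂ) - 1) ≠ 0 :=
    mul_ne_zero (by norm_num) card_sub_one_ne_zero
  rw [mul_left_cancel₀ hne key, mul_sum]
  exact sum_congr rfl fun η _ => by rw [hc', mul_assoc]

/-! ### The affine point count -/

omit [Fintype F] in
lemma sum_pi_four {ι : Type*} [Fintype ι] (f : ι → ι → ι → ι → ℂ) :
    ∑ v : Fin 4 → ι, f (v 0) (v 1) (v 2) (v 3) = ∑ x, ∑ y, ∑ v, ∑ w, f x y v w := by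
  let e : (Fin 4 → ι) ≃ ι × ι × ι × ι :=
    { toFun v := (v 0, v 1, v 2, v 3)
      invFun p := ![p.1, p.2.1, p.2.2.1, p.2.2.2]
      left_inv v := by ext i; fin_cases i <;> rfl
      right_inv p := rfl }
  refine (Fintype.sum_equiv e (fun v => f (v 0) (v 1) (v 2) (v 3))
    (fun p => f p.1 p.2.1 p.2.2.1 p.2.2.2) fun v => rfl).trans ?_
  simp only [Fintype.sum_prod_type]

lemma sum_eq_sum_units_of_zero {f : F → F → F → F → ℂ} (h1 : ∀ y v w, f 0 y v w = 0)
    (h2 : ∀ x v w, f x 0 v w = 0) (h3 : ∀ x y w, f x y 0 w = 0) (h4 : ∀ x y v, f x y v 0 = 0) :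
    ∑ x, ∑ y, ∑ v, ∑ w, f x y v w =
      ∑ x : Fˣ, ∑ y : Fˣ, ∑ v : Fˣ, ∑ w : Fˣ, f x y v w := by
  rw [← sum_units_eq (fun x => ∑ y, ∑ v, ∑ w, f x y v w) (by simp [h1])]
  refine sum_congr rfl fun x _ => ?_
  rw [← sum_units_eq (fun y => ∑ v, ∑ w, f x y v w) (by simp [h2])]
  refine sum_congr rfl fun y _ => ?_
  rw [← sum_units_eq (fun v => ∑ w, f x y v w) (by simp [h3])]
  refine sum_congr rfl fun v _ => ?_
  rw [← sum_units_eq (fun w => f x y v w) (h4 _ _ _)]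

omit [Field F] [Fintype F] in
lemma sum_mul_quadruple {ι : Type*} [Fintype ι] (a : ι → ℂ) :
    ∑ x, ∑ y, ∑ v, ∑ w, a x * a y * a v * a w = (∑ x, a x) ^ 4 := by
  simp_rw [← mul_sum, ← sum_mul, ← mul_sum, ← sum_mul, ← mul_sum, ← sum_mul]
  ring

lemma sum_affine_eq (θ : AddChar F ℂ) (l z : F) :
    ∑ x, ∑ y, ∑ v, ∑ w, θ (z * ((x ^ 4 + y ^ 4 + v ^ 4 + w ^ 4) - l * (x * y * v * w))) =
      (1 + ∑ x : Fˣ, θ (z * x ^ 4)) ^ 4 - (∑ x : Fˣ, θ (z * x ^ 4)) ^ 4 +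
      ∑ x : Fˣ, ∑ y : Fˣ, ∑ v : Fˣ, ∑ w : Fˣ,
        θ (z * ((x ^ 4 + y ^ 4 + v ^ 4 + w ^ 4 : F) - l * (x * y * v * w))) := by
  have hθ (x y v w : F) : θ (z * (x ^ 4 + y ^ 4 + v ^ 4 + w ^ 4)) =
      θ (z * x ^ 4) * θ (z * y ^ 4) * θ (z * v ^ 4) * θ (z * w ^ 4) := by
    simp only [mul_add, AddChar.map_add_eq_mul]
  have h := sum_eq_sum_units_of_zero (f := fun x y v w : F =>
    θ (z * ((x ^ 4 + y ^ 4 + v ^ 4 + w ^ 4) - l * (x * y * v * w))) -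
      θ (z * (x ^ 4 + y ^ 4 + v ^ 4 + w ^ 4)))
    (by simp) (by simp) (by simp) (by simp)
  simp only [sum_sub_distrib, hθ] at h
  rw [sum_mul_quadruple fun x : F => θ (z * x ^ 4),
    sum_mul_quadruple fun x : Fˣ => θ (z * (x : F) ^ 4),
    sum_eq_zero_add_sum_units fun x : F => θ (z * x ^ 4)] at h
  simp only [ne_eq, OfNat.ofNat_ne_zero, not_false_eq_true, zero_pow, mul_zero,
    AddChar.map_zero_eq_one] at h
  linear_combination h

lemma sum_addChar_pow_four (hθ : θ.IsPrimitive) (hχ : orderOf χ = 4) (z : Fˣ) :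
    ∑ x : Fˣ, θ (z * (x : F) ^ 4) = -1 + gaussSum χ θ * χ⁻¹ z + gaussSum (χ ^ 2) θ * χ⁻¹ z ^ 2 +
        gaussSum (χ ^ 3) θ * χ⁻¹ z ^ 3 := by
  have := sum_pow_four_twist hχ 1 θ z
  simp only [MulChar.one_apply_coe, one_mul, inv_one, gaussSum_one hθ] at this
  simpa only [Units.val_pow_eq_pow_val] using this

/-- The number of affine solutions of the Dwork equation, before evaluating the torus sum. -/
lemma card_mul_card_affine (hθ : θ.IsPrimitive) (hχ : orderOf χ = 4) (l : F) :
    (Fintype.card F : ℂ) * ∑ v : Fin 4 → F,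
        (if (v 0 ^ 4 + v 1 ^ 4 + v 2 ^ 4 + v 3 ^ 4) - l * (v 0 * v 1 * v 2 * v 3) = 0
          then (1 : ℂ) else 0) =
      (Fintype.card F : ℂ) ^ 4 + ((Fintype.card F : ℂ) - 1) * (-1 - 6 * Fintype.card F -
        12 * (χ (-1) * Fintype.card F) +
        12 * gaussSum (χ ^ 2) θ * (gaussSum χ θ ^ 2 + gaussSum (χ ^ 3) θ ^ 2)) +
      ∑ z : Fˣ, ∑ x : Fˣ, ∑ y : Fˣ, ∑ v : Fˣ, ∑ w : Fˣ,
        θ (z * ((x ^ 4 + y ^ 4 + v ^ 4 + w ^ 4 : F) - l * (x * y * v * w))) := by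
  have h0 : (Fintype.card F : ℂ) * ∑ v : Fin 4 → F,
        (if (v 0 ^ 4 + v 1 ^ 4 + v 2 ^ 4 + v 3 ^ 4) - l * (v 0 * v 1 * v 2 * v 3) = 0
          then (1 : ℂ) else 0) = ∑ z : F, ∑ v : Fin 4 → F,
        θ (z * ((v 0 ^ 4 + v 1 ^ 4 + v 2 ^ 4 + v 3 ^ 4) - l * (v 0 * v 1 * v 2 * v 3))) := by
    rw [sum_comm, mul_sum]
    refine sum_congr rfl fun v _ => ?_
    rw [AddChar.sum_mulShift _ hθ, mul_ite, mul_one, mul_zero]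
    push_cast
    rfl
  have hs := fun z : F => sum_pi_four fun x y v w : F =>
    θ (z * ((x ^ 4 + y ^ 4 + v ^ 4 + w ^ 4) - l * (x * y * v * w)))
  rw [h0, sum_eq_zero_add_sum_units fun z : F => ∑ v : Fin 4 → F,
        θ (z * ((v 0 ^ 4 + v 1 ^ 4 + v 2 ^ 4 + v 3 ^ 4) - l * (v 0 * v 1 * v 2 * v 3)))]
  have hz : ∑ v : Fin 4 → F,
      θ (0 * ((v 0 ^ 4 + v 1 ^ 4 + v 2 ^ 4 + v 3 ^ 4) - l * (v 0 * v 1 * v 2 * v 3))) =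
      (Fintype.card F : ℂ) ^ 4 := by
    simp
  have hp (s : ℂ) : (1 + s) ^ 4 - s ^ 4 = 1 + 4 * s + 6 * s ^ 2 + 4 * s ^ 3 := by ring
  simp_rw [hz, hs, sum_affine_eq, hp, sum_addChar_pow_four hθ hχ]
  have e := gaussSum_mul_gaussSum_cube hθ hχ
  have e2 := gaussSum_sq_mul_self hθ hχ
  simp only [sum_add_distrib, ← mul_sum, sum_cubic_sq hχ, sum_cubic_cube hχ]
  have hlin := sum_cubic hχ (-1) (gaussSum χ θ) (gaussSum (χ ^ 2) θ) (gaussSum (χ ^ 3) θ)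
  simp only [sum_add_distrib, ← mul_sum, sum_const, card_univ, nsmul_eq_mul, mul_one,
    card_units_cast] at hlin ⊢
  linear_combination 4 * hlin + ((Fintype.card F : ℂ) - 1) * (-6 * e2 - 12 * e)

/-! ### From affine to projective points -/

/-- The quartic form defining the Dwork K3 surface. -/
def dworkForm (lam : F) (v : Fin 4 → F) : F :=
  (v 0 ^ 4 + v 1 ^ 4 + v 2 ^ 4 + v 3 ^ 4) - 4 * lam * (v 0 * v 1 * v 2 * v 3)

omit [Fintype F] in
lemma dworkForm_smul (lam c : F) (v : Fin 4 → F) :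
    dworkForm lam (c • v) = c ^ 4 * dworkForm lam v := by
  simp only [dworkForm, Pi.smul_apply, smul_eq_mul]
  ring

omit [Fintype F] in
lemma dworkForm_units_smul_eq_zero (lam : F) (c : Fˣ) (v : Fin 4 → F) :
    dworkForm lam (c • v) = 0 ↔ dworkForm lam v = 0 := by
  rw [Units.smul_def, dworkForm_smul, mul_eq_zero_iff_left (pow_ne_zero 4 c.ne_zero)]

lemma dworkK3Count_eq (lam : F) :
    dworkK3Count F lam =
      Nat.card {P : Projectivization F (Fin 4 → F) // dworkForm lam P.rep = 0} := by
  simp only [dworkK3Count, dworkForm, sub_eq_zero]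

lemma card_units_mul_dworkK3Count (lam : F) :
    Fintype.card Fˣ * dworkK3Count F lam =
      Nat.card {v : Fin 4 → F // v ≠ 0 ∧ dworkForm lam v = 0} := by
  rw [dworkK3Count_eq, ← Nat.card_eq_fintype_card, ← Nat.card_prod]
  refine Nat.card_congr (Equiv.ofBijective (fun p => ⟨p.1 • p.2.1.rep, ?_, ?_⟩) ⟨?_, ?_⟩)
  · rw [Units.smul_def]
    exact smul_ne_zero p.1.ne_zero p.2.1.rep_nonzero
  · exact (dworkForm_units_smul_eq_zero lam p.1 _).mpr p.2.2
  · rintro ⟨c, P, hP⟩ ⟨d, Q, hQ⟩ h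
    have h : c • P.rep = d • Q.rep := congrArg Subtype.val h
    have hPQ : P = Q := by
      rw [← P.mk_rep, ← Q.mk_rep, Projectivization.mk_eq_mk_iff]
      exact ⟨c⁻¹ * d, by rw [mul_smul, ← h, inv_smul_smul]⟩
    subst hPQ
    have hcd : c = d := by
      rw [Units.smul_def, Units.smul_def] at h
      exact Units.ext (smul_left_injective F P.rep_nonzero h)
    rw [hcd]
  · rintro ⟨v, hv, hf⟩
    obtain ⟨a, ha⟩ := Projectivization.exists_smul_eq_mk_rep F v hv
    refine ⟨(a⁻¹, ⟨Projectivization.mk F v hv, ?_⟩), Subtype.ext ?_⟩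
    · rwa [← ha, dworkForm_units_smul_eq_zero]
    · simp only [← ha, inv_smul_smul]

lemma card_sub_one_mul_dworkK3Count (lam : F) :
    ((Fintype.card F : ℂ) - 1) * dworkK3Count F lam =
      (∑ v : Fin 4 → F, if dworkForm lam v = 0 then (1 : ℂ) else 0) - 1 := by
  have h := card_units_mul_dworkK3Count lam
  rw [Nat.subtype_card (univ.filter fun v : Fin 4 → F => v ≠ 0 ∧ dworkForm lam v = 0)
    (by simp)] at h
  rw [← card_units_cast, ← Nat.cast_mul, h, ← Finset.sum_filter, sum_const, nsmul_eq_mul, mul_one]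
  have h0 : (0 : Fin 4 → F) ∈ univ.filter fun v : Fin 4 → F => dworkForm lam v = 0 := by
    rw [mem_filter_univ]
    simp [dworkForm]
  rw [← card_erase_add_one h0]
  push_cast
  rw [add_sub_cancel_right]
  congr 2
  ext v
  simp

/-- The point count for the Dwork K3 surface, in terms of a character of order four. -/
lemma dworkK3Count_eq_of_orderOf_eq_four (hχ : orderOf χ = 4) (h2 : (2 : F) ≠ 0) {lam : F}
    (hlam : lam ≠ 0) :
    (dworkK3Count F lam : ℂ) =
      ((Fintype.card F : ℂ) ^ 3 - 1) / ((Fintype.card F : ℂ) - 1) +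
        12 * (Fintype.card F : ℂ) * χ (-1) * (χ ^ 2) (1 - lam ^ 4) +
        (Fintype.card F : ℂ) ^ 2 * greene3F2 χ (χ ^ 2) (χ ^ 3) 1 1 (lam ^ 4)⁻¹ +
        3 * (Fintype.card F : ℂ) ^ 2 * jacB (χ ^ 3) χ *
          greene2F1 (χ ^ 3) χ (χ ^ 2) (lam ^ 4)⁻¹ := by
  have hθ := AddChar.FiniteField.primitiveChar_to_Complex_isPrimitive F
  set θ := AddChar.FiniteField.primitiveChar_to_Complex F
  have hq : (Fintype.card F : ℂ) ≠ 0 := by simp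
  have hq1 := card_sub_one_ne_zero (F := F)
  have hN := card_sub_one_mul_dworkK3Count lam
  have hA := card_mul_card_affine hθ hχ (4 * lam)
  have hform : (∑ v : Fin 4 → F, if dworkForm lam v = 0 then (1 : ℂ) else 0) =
      ∑ v : Fin 4 → F, if v 0 ^ 4 + v 1 ^ 4 + v 2 ^ 4 + v 3 ^ 4 -
        4 * lam * (v 0 * v 1 * v 2 * v 3) = 0 then (1 : ℂ) else 0 := rfl
  rw [← hform, sum_sum_torus hθ hχ h2 hlam] at hA
  generalize (∑ v : Fin 4 → F, if dworkForm lam v = 0 then (1 : ℂ) else 0) = A at hN hA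
  clear hform
  simp only [mul_add, sum_add_distrib, mul_left_comm _ (3 : ℂ), mul_left_comm _ (12 : ℂ),
    ← mul_sum] at hA
  rw [sum_invariant_type hθ hχ hlam, sum_quadratic_type hθ hχ hlam,
    sum_mixed_type hθ hχ hlam] at hA
  rw [greene3F2_eq hθ hχ, greene2F1_eq hθ hχ]
  have e := gaussSum_sq_mul_self hθ hχ
  have hr := apply_neg_one_mul_self χ
  generalize (∑ η : MulChar F ℂ, η (-1) * _ * _ * _ * _ * _ : ℂ) = S₃ at hA ⊢
  generalize (∑ η : MulChar F ℂ, gaussSum (η⁻¹ * χ) θ * _ * _ * _ * _ : ℂ) = S₂ at hA ⊢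
  generalize (Fintype.card F : ℂ) = q at *
  generalize gaussSum (χ ^ 2) θ = g at *
  generalize χ (-1) = r at *
  generalize (χ ^ 2) (1 - lam ^ 4) = k at *
  apply mul_left_cancel₀ hq1
  rw [hN]
  field_simp at hA ⊢
  linear_combination hA + (q - 1) * ((1 + 6 * q) * r ^ 2 + 12 * q ^ 2 * r * k + 12 * q * r) * e +
    (q - 1) * q * (1 + 6 * q - 12 * g * (gaussSum χ θ ^ 2 + gaussSum (χ ^ 3) θ ^ 2)) * hr

end OrderFour

end

end DworkK3

/-- Theorem 1.1 (general case): for `q ≡ 1 (mod 4)`, `t = (q-1)/4`, `T` a generator of the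
character group of `F_q^×`, and `λ ≠ 0`,
`#X_λ⁴(F_q) = (q³-1)/(q-1) + 12q·T^t(-1)·T^{2t}(1-λ⁴)
  + q²·₃F₂(T^t, T^{2t}, T^{3t}; ε, ε | 1/λ⁴) + 3q²·binom(T^{3t},T^t)·₂F₁(T^{3t},T^t;T^{2t}|1/λ⁴)`. -/
theorem dworkK3_point_count
    (F : Type*) [Field F] [Fintype F] (p e q t : ℕ) (hp : p.Prime) (hodd : p ≠ 2)
    (he : 0 < e) (hq : q = p ^ e) (hcard : q = Fintype.card F)
    (hq4 : q % 4 = 1) (ht : t = (q - 1) / 4)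
    (T : MulChar F ℂ) (hT : ∀ χ : MulChar F ℂ, χ ∈ Subgroup.zpowers T)
    (lam : F) (hlam : lam ≠ 0) :
    (dworkK3Count F lam : ℂ) =
      ((q : ℂ) ^ 3 - 1) / ((q : ℂ) - 1) +
        12 * (q : ℂ) * (T ^ t) (-1 : F) * (T ^ (2 * t)) (1 - lam ^ 4) +
        (q : ℂ) ^ 2 * greene3F2 (T ^ t) (T ^ (2 * t)) (T ^ (3 * t)) 1 1 (lam ^ 4)⁻¹ +
        3 * (q : ℂ) ^ 2 * jacB (T ^ (3 * t)) (T ^ t) *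
          greene2F1 (T ^ (3 * t)) (T ^ t) (T ^ (2 * t)) (lam ^ 4)⁻¹ := by
  subst hcard
  have hT' : orderOf T = Fintype.card F - 1 := by
    rw [orderOf_eq_card_of_forall_mem_zpowers hT,
      MulChar.card_eq_card_units_of_hasEnoughRootsOfUnity, Nat.card_units,
      Nat.card_eq_fintype_card]
  have hcard : 1 < Fintype.card F := Fintype.one_lt_card
  have hχ : orderOf (T ^ t) = 4 := by
    have h4 : Fintype.card F - 1 = 4 * t := by omega
    rw [orderOf_pow, hT', h4, Nat.gcd_mul_left_left, Nat.mul_div_cancel _ (by omega)]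
  have h2 : (2 : F) ≠ 0 := by
    refine Ring.two_ne_zero fun h => ?_
    have := FiniteField.even_card_of_char_two h
    omega
  rw [mul_comm 2 t, mul_comm 3 t, pow_mul, pow_mul]
  exact DworkK3.dworkK3Count_eq_of_orderOf_eq_four hχ h2 hlam
end

section
/- Let q = p^e be a power of an odd prime with q ≡ 1 (mod 4), set t = (q−1)/4, let T be a generator of the group of multiplicative characters of F_q^×, and let ε denote the trivial character. If λ ∈ F_q satisfies λ⁴ = 1, then #X_λ⁴(F_q) = (q³−1)/(q−1) + 3q·T^t(−1) + q²·₃F₂(T^t, T^{2t}, T^{3t}; ε, ε | 1)_q. -/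
section FiniteSums

open Finset

/-- Summation along the fibres of a map. -/
theorem sum_comp_eq_sum_card_mul {R : Type*} [CommRing R] {α β : Type*} [Fintype β]
    [DecidableEq β] (s : Finset α) (g : α → β) (f : β → R) :
    ∑ x ∈ s, f (g x) = ∑ t, (#{x ∈ s | g x = t} : R) * f t := by
  rw [← sum_fiberwise s g]
  refine sum_congr rfl fun t _ => ?_
  rw [← nsmul_eq_mul, ← sum_const]
  exact sum_congr rfl fun x hx => by rw [(mem_filter.1 hx).2]

variable {F : Type*} [Field F] [Fintype F]

theorem sum_comp_mul_left {M : Type*} [AddCommMonoid M] {c : F} (hc : c ≠ 0) (f : F → M) :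
    ∑ x, f (c * x) = ∑ x, f x :=
  _root_.Equiv.sum_comp (Equiv.mulLeft₀ c hc) f

theorem sum_comp_add_right {M : Type*} [AddCommMonoid M] (c : F) (f : F → M) :
    ∑ x, f (x + c) = ∑ x, f x :=
  _root_.Equiv.sum_comp (Equiv.addRight c) f

theorem sum_comp_neg {M : Type*} [AddCommMonoid M] (f : F → M) :
    ∑ x, f (-x) = ∑ x, f x :=
  _root_.Equiv.sum_comp (Equiv.neg F) f

theorem sum_comp_inv {M : Type*} [AddCommMonoid M] (f : F → M) :
    ∑ x, f x⁻¹ = ∑ x, f x :=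
  _root_.Equiv.sum_comp (Function.Involutive.toPerm _ (inv_involutive (G := F))) f

end FiniteSums

section QuadraticCharacterSums

open Finset

variable {F : Type*} [Field F] [Fintype F] [DecidableEq F]

local notation "φ" => quadraticChar F
local notation "𝐪" => (Fintype.card F : ℤ)

theorem quadraticChar_sq_mul {c : F} (hc : c ≠ 0) (a : F) : φ (c ^ 2 * a) = φ a := by
  rw [map_mul, quadraticChar_sq_one' hc, one_mul]

theorem quadraticChar_mul_self_of_ne_zero {a : F} (ha : a ≠ 0) : φ a * φ a = 1 := by
  rw [← sq, quadraticChar_sq_one ha]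

theorem quadraticChar_inv (a : F) : φ a⁻¹ = φ a := by
  by_cases ha : a = 0
  · simp [ha]
  · rw [← quadraticChar_sq_mul ha a⁻¹]
    congr 1
    field_simp

theorem card_filter_sq_eq (hF : ringChar F ≠ 2) (a : F) : (#{x : F | x ^ 2 = a} : ℤ) = 1 + φ a := by
  rw [add_comm, ← quadraticChar_card_sqrts hF a]
  congr 2
  ext x
  simp

theorem card_filter_quadratic (hF : ringChar F ≠ 2) {A : F} (hA : A ≠ 0) (B C : F) :
    (#{x : F | A * x ^ 2 + B * x + C = 0} : ℤ) = 1 + φ (B ^ 2 - 4 * A * C) := by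
  have h2 : (2 : F) ≠ 0 := Ring.two_ne_zero hF
  rw [← card_filter_sq_eq hF]
  norm_cast
  refine card_bij' (fun x _ => 2 * A * x + B) (fun y _ => (y - B) / (2 * A)) ?_ ?_ ?_ ?_
  · intro x hx
    simp only [mem_filter, mem_univ, true_and] at hx ⊢
    linear_combination 4 * A * hx
  · intro y hy
    simp only [mem_filter, mem_univ, true_and] at hy ⊢
    field_simp
    linear_combination hy
  · intro x _
    field_simp
    ring
  · intro y _
    field_simp
    ring

theorem sum_comp_sq (hF : ringChar F ≠ 2) {R : Type*} [CommRing R] (f : F → R) :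
    ∑ x, f (x ^ 2) = ∑ a, (1 + (φ a : R)) * f a := by
  rw [sum_comp_eq_sum_card_mul univ (fun x => x ^ 2) f]
  refine sum_congr rfl fun t _ => ?_
  have := congrArg (Int.cast : ℤ → R) (card_filter_sq_eq hF t)
  push_cast at this
  rw [this]

theorem sum_quadraticChar_linear (hF : ringChar F ≠ 2) {A : F} (hA : A ≠ 0) (B : F) :
    ∑ x, φ (A * x + B) = 0 := by
  rw [sum_comp_mul_left hA fun x => φ (x + B), sum_comp_add_right B fun x => φ x,
    quadraticChar_sum_zero hF]

theorem sum_quadraticChar_mul_add (hF : ringChar F ≠ 2) (a b : F) :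
    ∑ x, φ ((x + a) * (x + b)) = -1 + if a = b then 𝐪 else 0 := by
  rw [← sum_comp_add_right (-a)]
  have h1 : ∀ x : F, (x + -a + a) * (x + -a + b) = x * (x + (b - a)) := fun x => by ring
  simp only [h1]
  split_ifs with h
  · subst h
    have : ∀ x : F, φ (x * (x + (a - a))) = 1 - if x = 0 then 1 else 0 := fun x => by
      split_ifs with hx
      · simp [hx]
      · rw [sub_self, add_zero, map_mul, quadraticChar_mul_self_of_ne_zero hx, sub_zero]
    simp only [this, sum_sub_distrib, sum_ite_eq', mem_univ, if_true, sum_const, card_univ]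
    simp
    ring
  · have hba : b - a ≠ 0 := fun h0 => h (sub_eq_zero.1 h0).symm
    rw [← sum_comp_inv]
    have : ∀ x : F, φ (x⁻¹ * (x⁻¹ + (b - a))) =
        φ ((b - a) * x + 1) - if x = 0 then 1 else 0 := fun x => by
      split_ifs with hx
      · simp [hx]
      · rw [← quadraticChar_sq_mul hx, sub_zero]
        congr 1
        field_simp
        ring
    simp only [this, sum_sub_distrib, sum_quadraticChar_linear hF hba]
    simp

theorem sum_quadraticChar_mul_add_self (hF : ringChar F ≠ 2) (a : F) :
    ∑ x, φ (a * x) = 0 := by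
  by_cases ha : a = 0
  · simp [ha]
  · simpa using sum_quadraticChar_linear hF ha 0

/-- Summation over `F × F` in terms of the elementary symmetric functions. -/
theorem sum_sum_comp_add_mul (hF : ringChar F ≠ 2) (f : F → F → ℤ) :
    ∑ x, ∑ y, f (x + y) (x * y) = ∑ s, ∑ p, (1 + φ (s ^ 2 - 4 * p)) * f s p := by
  have h1 : ∑ x, ∑ y, f (x + y) (x * y) = ∑ s, ∑ x, f s (x * (s - x)) := by
    rw [sum_comm (s := univ) (t := univ) (f := fun s x => f s (x * (s - x)))]
    refine sum_congr rfl fun x _ => ?_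
    rw [← sum_comp_add_right x fun s => f s (x * (s - x))]
    exact sum_congr rfl fun y _ => by rw [add_sub_cancel_right, add_comm]
  rw [h1]
  refine sum_congr rfl fun s _ => ?_
  rw [sum_comp_eq_sum_card_mul univ (fun x => x * (s - x)) fun p => f s p]
  refine sum_congr rfl fun p _ => ?_
  congr 1
  have := card_filter_quadratic hF one_ne_zero (-s) p
  rw [show s ^ 2 - 4 * p = (-s) ^ 2 - 4 * 1 * p by ring, ← this]
  norm_cast
  congr 1
  ext x
  simp only [mem_filter, mem_univ, true_and]
  constructor <;> intro h <;> linear_combination -h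

/-- Summation over `Fˣ` along the map `a ↦ a + a⁻¹`. -/
theorem sum_comp_add_inv (hF : ringChar F ≠ 2) (f : F → ℤ) :
    ∑ a, (if a = 0 then 0 else f (a + a⁻¹)) = ∑ s, (1 + φ (s ^ 2 - 4)) * f s := by
  have h1 : ∑ a, (if a = 0 then 0 else f (a + a⁻¹)) = ∑ a ∈ {a : F | a ≠ 0}, f (a + a⁻¹) := by
    rw [sum_filter]
    exact sum_congr rfl fun a _ => by by_cases h : a = 0 <;> simp [h]
  rw [h1, sum_comp_eq_sum_card_mul _ (fun a => a + a⁻¹) f]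
  refine sum_congr rfl fun s _ => ?_
  congr 1
  have := card_filter_quadratic hF one_ne_zero (-s) 1
  rw [show s ^ 2 - 4 = (-s) ^ 2 - 4 * 1 * 1 by ring, ← this]
  norm_cast
  congr 1
  ext x
  simp only [mem_filter, mem_univ, true_and]
  constructor
  · rintro ⟨h0, h⟩
    rw [← h]
    field_simp
    ring
  · intro h
    have h0 : x ≠ 0 := by
      rintro rfl
      simp at h
    refine ⟨h0, ?_⟩
    field_simp
    linear_combination h

/-- The quadratic character sum to which both the point count and the hypergeometric value
reduce. -/
noncomputable def ellipticFamilySum (F : Type*) [Field F] [Fintype F] [DecidableEq F] : ℤ :=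
  ∑ r : F, quadraticChar F (r * (r - 1)) *
    ∑ m : F, quadraticChar F (1 + m) * quadraticChar F (m ^ 2 - r)

theorem quadraticChar_neg (hm : φ (-1) = 1) (a : F) : φ (-a) = φ a := by
  rw [neg_eq_neg_one_mul, map_mul, hm, one_mul]

theorem quadraticChar_four_mul (hF : ringChar F ≠ 2) (a : F) : φ (4 * a) = φ a := by
  rw [← quadraticChar_sq_mul (Ring.two_ne_zero hF) a]
  norm_num

theorem sum_quadraticChar_mul_comp_add_inv (hF : ringChar F ≠ 2) (hm : φ (-1) = 1)
    (f : F → ℤ) (hf : ∀ s, f (-s) = f s) :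
    ∑ y, φ y * f (y + y⁻¹) = 2 * ∑ s, φ (s + 2) * f s := by
  have h2 : (2 : F) ≠ 0 := Ring.two_ne_zero hF
  have h1 : ∀ y : F, φ y * f (y + y⁻¹) =
      (if y = 0 then 0 else (fun s => φ (s + 2) * f s) (y + y⁻¹)) +
        if y = -1 then f (-2) else 0 := fun y => by
    by_cases h0 : y = 0
    · simp [h0]
    by_cases hy : y = -1
    · have e : (-1 : F) + (-1)⁻¹ = -2 := by rw [inv_neg_one]; norm_num
      simp only [hy, e, hm]
      simp
    · have hy' : y + 1 ≠ 0 := fun h => hy (eq_neg_of_add_eq_zero_left h)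
      have e : φ (y + y⁻¹ + 2) = φ y := by
        rw [← quadraticChar_sq_mul hy' y, ← quadraticChar_sq_mul h0 (y + y⁻¹ + 2)]
        congr 1
        field_simp
        ring
      simp [h0, hy, e, -quadraticChar_apply]
  have h3 : ∀ s : F, (1 + φ (s ^ 2 - 4)) * (φ (s + 2) * f s) =
      φ (s + 2) * f s + φ (s - 2) * f s - if s = -2 then f (-2) else 0 := fun s => by
    by_cases hs : s = -2
    · have e : φ (-2 - 2 : F) = 1 := by
        rw [show (-2 - 2 : F) = 2 ^ 2 * -1 by norm_num, quadraticChar_sq_mul h2, hm]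
      simp only [hs, e]
      simp
    · have hs' : s + 2 ≠ 0 := fun h => hs (eq_neg_of_add_eq_zero_left h)
      have e : φ (s ^ 2 - 4) * φ (s + 2) = φ (s - 2) := by
        rw [← map_mul, ← quadraticChar_sq_mul hs' (s - 2)]
        congr 1
        ring
      rw [if_neg hs, sub_zero]
      linear_combination f s * e
  have h4 : ∑ s, φ (s - 2) * f s = ∑ s, φ (s + 2) * f s := by
    rw [← sum_comp_neg]
    refine sum_congr rfl fun s _ => ?_
    rw [hf, ← quadraticChar_neg hm]
    congr 2
    ring
  simp only [h1, sum_add_distrib]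
  rw [sum_comp_add_inv hF fun s => φ (s + 2) * f s]
  simp only [h3, sum_sub_distrib, sum_add_distrib, h4, sum_ite_eq', mem_univ, if_true]
  ring

theorem sum_quadraticChar_mul_quartic (hF : ringChar F ≠ 2) (hm : φ (-1) = 1) (r : F) :
    ∑ y, φ y * φ ((1 + y ^ 2) ^ 2 - 4 * (y ^ 2 * r)) =
      2 * φ 2 * ∑ m, φ (1 + m) * φ (m ^ 2 - r) := by
  have h2 : (2 : F) ≠ 0 := Ring.two_ne_zero hF
  have h := sum_quadraticChar_mul_comp_add_inv hF hm (fun s => φ (s ^ 2 - 4 * r))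
    fun s => by rw [neg_sq]
  rw [← sum_comp_mul_left h2 fun s => φ (s + 2) * φ (s ^ 2 - 4 * r)] at h
  convert h using 1
  · refine sum_congr rfl fun y _ => ?_
    by_cases hy : y = 0
    · simp [hy]
    rw [← quadraticChar_sq_mul hy ((y + y⁻¹) ^ 2 - 4 * r)]
    congr 2
    field_simp
    ring
  · rw [mul_assoc, mul_sum]
    congr 1
    refine sum_congr rfl fun m _ => ?_
    rw [← mul_assoc, ← map_mul, ← quadraticChar_sq_mul h2 (m ^ 2 - r)]
    congr 2 <;> ring

theorem sum_quadraticChar_legendre_fibre (hF : ringChar F ≠ 2) {y : F} (hy : y ≠ 0) :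
    ∑ z, (if z = 0 then 0 else φ ((1 - y ^ 2 * z) * (1 - z) * (1 - z - y ^ 2 * z))) =
      ∑ r, (1 + φ ((1 + y ^ 2) ^ 2 - 4 * (y ^ 2 * r))) * φ (r * (r - 1)) := by
  rw [← sum_comp_inv]
  have h1 : ∀ z : F, (if z⁻¹ = 0 then 0 else
      φ ((1 - y ^ 2 * z⁻¹) * (1 - z⁻¹) * (1 - z⁻¹ - y ^ 2 * z⁻¹))) =
      (fun T => φ (T * (T - y ^ 2))) (z * (1 + y ^ 2 - z)) := fun z => by
    by_cases hz : z = 0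
    · simp [hz]
    rw [if_neg (inv_ne_zero hz), ← quadraticChar_sq_mul (pow_ne_zero 2 hz)]
    congr 1
    field_simp
    ring
  simp only [h1]
  rw [sum_comp_eq_sum_card_mul univ (fun z => z * (1 + y ^ 2 - z)) fun T => φ (T * (T - y ^ 2)),
    ← sum_comp_mul_left (pow_ne_zero 2 hy)]
  refine sum_congr rfl fun r _ => ?_
  congr 1
  · have := card_filter_quadratic hF one_ne_zero (-(1 + y ^ 2)) (y ^ 2 * r)
    rw [show (1 + y ^ 2) ^ 2 - 4 * (y ^ 2 * r) =
      (-(1 + y ^ 2)) ^ 2 - 4 * 1 * (y ^ 2 * r) by ring, ← this]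
    norm_cast
    congr 1
    ext x
    simp only [mem_filter, mem_univ, true_and]
    constructor <;> intro h <;> linear_combination -h
  · rw [← quadraticChar_sq_mul (pow_ne_zero 2 hy) (r * (r - 1))]
    congr 1
    ring

theorem sum_quadraticChar_mul_legendre_fibre (hF : ringChar F ≠ 2) (hm : φ (-1) = 1) :
    ∑ y, φ y * ∑ z, (if z = 0 then 0 else
      φ ((1 - y ^ 2 * z) * (1 - z) * (1 - z - y ^ 2 * z))) =
      2 * (φ 2 * ellipticFamilySum F) := by
  have h1 : ∀ y : F, φ y * ∑ z, (if z = 0 then 0 else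
      φ ((1 - y ^ 2 * z) * (1 - z) * (1 - z - y ^ 2 * z))) =
      φ y * ∑ r, φ (r * (r - 1)) +
        ∑ r, φ (r * (r - 1)) * (φ y * φ ((1 + y ^ 2) ^ 2 - 4 * (y ^ 2 * r))) := fun y => by
    by_cases hy : y = 0
    · simp [hy]
    rw [sum_quadraticChar_legendre_fibre hF hy, mul_sum, mul_sum, ← sum_add_distrib]
    exact sum_congr rfl fun r _ => by ring
  simp only [h1, sum_add_distrib, ← sum_mul, quadraticChar_sum_zero hF, zero_mul, zero_add]
  rw [sum_comm]
  simp only [← mul_sum, sum_quadraticChar_mul_quartic hF hm]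
  rw [ellipticFamilySum, mul_sum, mul_sum]
  exact sum_congr rfl fun r _ => by ring

theorem sum_quadraticChar_mul_reciprocal_quadratic (hF : ringChar F ≠ 2) (k : F) :
    ∑ a, φ a * φ (4 * a * k ^ 2 - (1 + a) ^ 2) = ∑ r, φ (r * (r - 1)) * φ (k ^ 2 - r) := by
  have h2 : (2 : F) ≠ 0 := Ring.two_ne_zero hF
  have h4 : (4 : F) ≠ 0 := by
    rw [show (4 : F) = 2 * 2 by norm_num]
    exact mul_ne_zero h2 h2
  have h1 : ∀ a : F, φ a * φ (4 * a * k ^ 2 - (1 + a) ^ 2) =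
      if a = 0 then 0 else (fun s => φ (-1 * s + (4 * k ^ 2 - 2))) (a + a⁻¹) := fun a => by
    by_cases ha : a = 0
    · simp [ha]
    dsimp only
    rw [if_neg ha, ← map_mul, ← quadraticChar_sq_mul ha (-1 * (a + a⁻¹) + (4 * k ^ 2 - 2))]
    congr 1
    field_simp
    ring
  simp only [h1]
  rw [sum_comp_add_inv hF fun s => φ (-1 * s + (4 * k ^ 2 - 2))]
  simp only [add_mul, one_mul, sum_add_distrib]
  rw [sum_quadraticChar_linear hF (neg_ne_zero.2 one_ne_zero), zero_add,
    ← sum_comp_add_right (-2), ← sum_comp_mul_left h4]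
  refine sum_congr rfl fun r _ => ?_
  rw [← quadraticChar_four_mul hF (r * (r - 1)), ← quadraticChar_four_mul hF (4 * _),
    ← quadraticChar_four_mul hF (k ^ 2 - r)]
  congr 2 <;> ring

theorem sum_quadraticChar_sq_sub_mul_linear (hF : ringChar F ≠ 2) {i : F} (hi : i ^ 2 = -1)
    (a : F) :
    ∑ s, φ (s ^ 2 - 4 * a) * φ (a * (s * (1 + a) - 4 * a)) =
      ∑ k, φ (k - 1) * (φ a * φ (4 * a * k ^ 2 - (1 + a) ^ 2)) := by
  have h2 : (2 : F) ≠ 0 := Ring.two_ne_zero hF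
  have h4 : (4 : F) ≠ 0 := by
    rw [show (4 : F) = 2 * 2 by norm_num]
    exact mul_ne_zero h2 h2
  have hi0 : i ≠ 0 := by
    rintro rfl
    simp at hi
  have hm : φ (-1) = 1 := by rw [← hi, quadraticChar_sq_one' hi0]
  by_cases ha : a = 0
  · simp [ha]
  by_cases ha1 : a = -1
  · subst ha1
    have e1 : ∀ s : F, φ (s ^ 2 - 4 * -1) * φ (-1 * (s * (1 + -1) - 4 * -1)) =
        φ ((s + 2 * i) * (s + -(2 * i))) := fun s => by
      rw [show (-1 * (s * (1 + -1) - 4 * -1) : F) = 2 ^ 2 * -1 by ring, quadraticChar_sq_mul h2,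
        hm, mul_one]
      congr 1
      linear_combination 4 * hi
    have e2 : ∀ k : F, φ (k - 1) * (φ (-1) * φ (4 * -1 * k ^ 2 - (1 + -1) ^ 2)) =
        φ (1 * k + -1) - if k = 0 then 1 else 0 := fun k => by
      by_cases hk : k = 0
      · simp [hk, hm, quadraticChar_zero, -quadraticChar_apply]
      rw [hm, show (4 * -1 * k ^ 2 - (1 + -1) ^ 2 : F) = (2 * k) ^ 2 * -1 by ring,
        quadraticChar_sq_mul (mul_ne_zero h2 hk), hm, if_neg hk, one_mul, mul_one, one_mul,
        sub_zero, sub_eq_add_neg]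
    have e3 : 2 * i ≠ -(2 * i) := fun h => mul_ne_zero h4 hi0 (by linear_combination h)
    simp only [e1, e2, sum_quadraticChar_mul_add hF, sum_sub_distrib,
      sum_quadraticChar_linear hF one_ne_zero, if_neg e3]
    simp
  · have ha1' : 1 + a ≠ 0 := fun h => ha1 (by linear_combination h)
    rw [← sum_comp_mul_left (div_ne_zero (mul_ne_zero h4 ha) ha1')]
    refine sum_congr rfl fun k _ => ?_
    have e1 : φ ((4 * a / (1 + a) * k) ^ 2 - 4 * a) = φ (a * (4 * a * k ^ 2 - (1 + a) ^ 2)) := by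
      rw [← quadraticChar_sq_mul ha1', ← quadraticChar_sq_mul h2 (a * _)]
      congr 1
      field_simp
      ring
    have e2 : φ (a * (4 * a / (1 + a) * k * (1 + a) - 4 * a)) = φ (k - 1) := by
      rw [← quadraticChar_sq_mul (mul_ne_zero h2 ha) (k - 1)]
      congr 1
      field_simp
      ring
    rw [e1, e2, map_mul, mul_comm]

/-- The count of `x + x⁻¹ + y + y⁻¹ - 4` weighted by the quadratic character. -/
theorem sum_quadraticChar_dihedral (hF : ringChar F ≠ 2) {i : F} (hi : i ^ 2 = -1) :
    ∑ x, ∑ y, φ (x * y * ((x + y) * (1 + x * y) - 4 * (x * y))) =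
      𝐪 + ellipticFamilySum F := by
  have h2 : (2 : F) ≠ 0 := Ring.two_ne_zero hF
  have hi0 : i ≠ 0 := by
    rintro rfl
    simp at hi
  have hm : φ (-1) = 1 := by rw [← hi, quadraticChar_sq_one' hi0]
  have h1 : ∀ a : F, ∑ s, φ (a * (s * (1 + a) - 4 * a)) = if a = -1 then 𝐪 else 0 := fun a => by
    split_ifs with ha
    · subst ha
      have e : ∀ s : F, φ (-1 * (s * (1 + -1) - 4 * -1)) = 1 := fun s => by
        rw [show (-1 * (s * (1 + -1) - 4 * -1) : F) = 2 ^ 2 * -1 by ring,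
          quadraticChar_sq_mul h2, hm]
      simp only [e]
      simp
    · by_cases ha0 : a = 0
      · simp [ha0]
      have ha1 : 1 + a ≠ 0 := fun h => ha (by linear_combination h)
      rw [← sum_quadraticChar_linear hF (mul_ne_zero ha0 ha1) (-(4 * a ^ 2))]
      refine sum_congr rfl fun s _ => ?_
      congr 1
      ring
  rw [sum_sum_comp_add_mul hF fun s a => φ (a * (s * (1 + a) - 4 * a)), sum_comm]
  simp only [add_mul, one_mul, sum_add_distrib, h1, sum_ite_eq', mem_univ,
    if_true, sum_quadraticChar_sq_sub_mul_linear hF hi]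
  rw [sum_comm]
  simp only [← mul_sum, sum_quadraticChar_mul_reciprocal_quadratic hF]
  congr 1
  rw [ellipticFamilySum]
  simp only [mul_sum]
  rw [sum_comm]
  refine sum_congr rfl fun r _ => ?_
  rw [← sum_comp_neg]
  refine sum_congr rfl fun k _ => ?_
  rw [neg_sq, ← quadraticChar_neg hm (1 + k)]
  ring_nf

end QuadraticCharacterSums

section ConeSums

open Finset

variable {F : Type*} [Field F] [DecidableEq F]

/-- The indicator function of the cone `(α + β + γ + δ)² = 8 (α β + γ δ)`. -/
def coneIndicator (α β γ δ : F) : ℤ :=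
  if (α + β + γ + δ) ^ 2 = 8 * (α * β + γ * δ) then 1 else 0

theorem coneIndicator_swap_left (α β γ δ : F) :
    coneIndicator α β γ δ = coneIndicator β α γ δ := by
  simp only [coneIndicator, add_comm α β, mul_comm α β]

theorem coneIndicator_swap_right (α β γ δ : F) :
    coneIndicator α β γ δ = coneIndicator α β δ γ := by
  simp only [coneIndicator, add_assoc, add_comm γ δ, mul_comm γ δ]

theorem coneIndicator_swap_pairs (α β γ δ : F) :
    coneIndicator α β γ δ = coneIndicator γ δ α β := by
  have h1 : α + β + γ + δ = γ + δ + α + β := by ring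
  simp only [coneIndicator, h1, add_comm (α * β) (γ * δ)]

theorem coneIndicator_mul {c : F} (hc : c ≠ 0) (α β γ δ : F) :
    coneIndicator (c * α) (c * β) (c * γ) (c * δ) = coneIndicator α β γ δ := by
  have h : (c * α + c * β + c * γ + c * δ) ^ 2 = 8 * (c * α * (c * β) + c * γ * (c * δ)) ↔
      (α + β + γ + δ) ^ 2 = 8 * (α * β + γ * δ) := by
    rw [← mul_right_inj' (pow_ne_zero 2 hc) (b := (α + β + γ + δ) ^ 2)]
    constructor <;> intro h <;> linear_combination h
  simp only [coneIndicator, h]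

theorem coneIndicator_add (c α β γ δ : F) :
    coneIndicator (α + c) (β + c) (γ + c) (δ + c) = coneIndicator α β γ δ := by
  have h : (α + c + (β + c) + (γ + c) + (δ + c)) ^ 2 =
        8 * ((α + c) * (β + c) + (γ + c) * (δ + c)) ↔
      (α + β + γ + δ) ^ 2 = 8 * (α * β + γ * δ) := by
    constructor <;> intro h <;> linear_combination h
  simp only [coneIndicator, h]

theorem coneIndicator_one (x y g : F) : coneIndicator 1 x g (g * y) =
    if ((1 + y) ^ 2 - 8 * y) * g ^ 2 + 2 * ((1 + x) * (1 + y)) * g + ((1 + x) ^ 2 - 8 * x) = 0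
      then 1 else 0 := by
  have h : (1 + x + g + g * y) ^ 2 = 8 * (1 * x + g * (g * y)) ↔
      ((1 + y) ^ 2 - 8 * y) * g ^ 2 + 2 * ((1 + x) * (1 + y)) * g + ((1 + x) ^ 2 - 8 * x) = 0 := by
    constructor <;> intro h <;> linear_combination h
  simp only [coneIndicator, h]

variable [Fintype F]

local notation "φ" => quadraticChar F
local notation "𝐪" => (Fintype.card F : ℤ)

/-- The sum of a product of functions of the coordinates over the cone
`(α + β + γ + δ)² = 8 (α β + γ δ)`. -/
def coneSum (f₁ f₂ f₃ f₄ : F → ℤ) : ℤ :=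
  ∑ α, ∑ β, ∑ γ, ∑ δ, coneIndicator α β γ δ * (f₁ α * f₂ β * f₃ γ * f₄ δ)

theorem coneSum_swap_left (f₁ f₂ f₃ f₄ : F → ℤ) :
    coneSum f₁ f₂ f₃ f₄ = coneSum f₂ f₁ f₃ f₄ := by
  rw [coneSum, sum_comm]
  refine sum_congr rfl fun α _ => sum_congr rfl fun β _ => sum_congr rfl fun γ _ =>
    sum_congr rfl fun δ _ => ?_
  rw [coneIndicator_swap_left]
  ring

theorem coneSum_swap_right (f₁ f₂ f₃ f₄ : F → ℤ) :
    coneSum f₁ f₂ f₃ f₄ = coneSum f₁ f₂ f₄ f₃ := by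
  rw [coneSum]
  refine sum_congr rfl fun α _ => sum_congr rfl fun β _ => ?_
  rw [sum_comm]
  refine sum_congr rfl fun γ _ => sum_congr rfl fun δ _ => ?_
  rw [coneIndicator_swap_right]
  ring

theorem coneSum_swap_pairs (f₁ f₂ f₃ f₄ : F → ℤ) :
    coneSum f₁ f₂ f₃ f₄ = coneSum f₃ f₄ f₁ f₂ := by
  have h : ∀ g : F → F → F → F → ℤ,
      ∑ α, ∑ β, ∑ γ, ∑ δ, g α β γ δ = ∑ γ, ∑ δ, ∑ α, ∑ β, g α β γ δ := fun g => by
    simp only [← sum_product']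
    exact sum_bij' (fun x _ => (x.2.2.1, x.2.2.2, x.1, x.2.1))
      (fun x _ => (x.2.2.1, x.2.2.2, x.1, x.2.1)) (by simp) (by simp) (by simp) (by simp) (by simp)
  rw [coneSum, h]
  refine sum_congr rfl fun α _ => sum_congr rfl fun β _ => sum_congr rfl fun γ _ =>
    sum_congr rfl fun δ _ => ?_
  rw [coneIndicator_swap_pairs]
  ring

theorem coneSum_eq_zero_of_neg {c : F} (hc : c ≠ 0) {f₁ f₂ f₃ f₄ : F → ℤ}
    (h : ∀ α β γ δ, f₁ (c * α) * f₂ (c * β) * f₃ (c * γ) * f₄ (c * δ) =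
      -(f₁ α * f₂ β * f₃ γ * f₄ δ)) : coneSum f₁ f₂ f₃ f₄ = 0 := by
  have h1 : coneSum f₁ f₂ f₃ f₄ = -coneSum f₁ f₂ f₃ f₄ := by
    conv_lhs => rw [coneSum, ← sum_comp_mul_left hc]
    simp only [coneSum, ← sum_neg_distrib]
    refine sum_congr rfl fun α _ => ?_
    rw [← sum_comp_mul_left hc]
    refine sum_congr rfl fun β _ => ?_
    rw [← sum_comp_mul_left hc]
    refine sum_congr rfl fun γ _ => ?_
    rw [← sum_comp_mul_left hc]
    refine sum_congr rfl fun δ _ => ?_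
    rw [h, coneIndicator_mul hc]
    ring
  omega

theorem coneSum_eq_sum_translate (f₁ f₂ f₃ f₄ : F → ℤ) :
    coneSum f₁ f₂ f₃ f₄ = ∑ a, ∑ b, ∑ c, coneIndicator a b c 0 *
      ∑ d, f₁ (d + a) * f₂ (d + b) * f₃ (d + c) * f₄ d := by
  have h : ∀ g : F → F → F → F → ℤ,
      ∑ α, ∑ β, ∑ γ, ∑ δ, g α β γ δ = ∑ δ, ∑ α, ∑ β, ∑ γ, g α β γ δ := fun g => by
    simp only [← sum_product']
    exact sum_bij' (fun x _ => (x.2.2.2, x.1, x.2.1, x.2.2.1))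
      (fun x _ => (x.2.1, x.2.2.1, x.2.2.2, x.1)) (by simp) (by simp) (by simp) (by simp) (by simp)
  simp only [mul_sum]
  conv_lhs => rw [coneSum, h]
  conv_rhs => rw [h]
  refine sum_congr rfl fun d _ => ?_
  rw [← sum_comp_add_right d]
  refine sum_congr rfl fun a _ => ?_
  rw [← sum_comp_add_right d]
  refine sum_congr rfl fun b _ => ?_
  rw [← sum_comp_add_right d]
  refine sum_congr rfl fun c _ => ?_
  have := coneIndicator_add d a b c 0
  rw [zero_add] at this
  rw [this, add_comm a, add_comm b, add_comm c]

theorem sum_coneIndicator_zero (hF : ringChar F ≠ 2) (a b : F) :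
    ∑ c, coneIndicator a b c 0 = 1 + φ (2 * (a * b)) := by
  rw [← quadraticChar_four_mul hF, ← card_filter_sq_eq hF, ← sum_boole,
    ← sum_comp_add_right (a + b) fun c => if c ^ 2 = 4 * (2 * (a * b)) then (1 : ℤ) else 0]
  refine sum_congr rfl fun c _ => ?_
  simp only [coneIndicator]
  congr 1
  rw [show a + b + c + 0 = c + (a + b) by ring,
    show 8 * (a * b + c * 0) = 4 * (2 * (a * b)) by ring]

theorem sum_quadraticChar_mul_mul (hF : ringChar F ≠ 2) (c : F) :
    ∑ a, ∑ b, φ (c * (a * b)) = 0 := by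
  refine sum_eq_zero fun a _ => ?_
  simp only [← mul_assoc, sum_quadraticChar_mul_add_self hF]

theorem coneSum_of_left (hF : ringChar F ≠ 2) (f₁ f₂ f₄ : F → ℤ) :
    coneSum f₁ f₂ (fun _ => 1) f₄ = ∑ a, ∑ b, (1 + φ (2 * (a * b))) *
      ∑ d, f₁ (d + a) * f₂ (d + b) * f₄ d := by
  rw [coneSum_eq_sum_translate]
  simp only [mul_one, ← sum_mul, sum_coneIndicator_zero hF]

theorem coneSum_one (hF : ringChar F ≠ 2) :
    coneSum (fun _ : F => 1) (fun _ => 1) (fun _ => 1) (fun _ => 1) = 𝐪 ^ 3 := by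
  rw [coneSum_of_left hF]
  simp only [mul_one, sum_const, card_univ, ← sum_mul, sum_add_distrib,
    sum_quadraticChar_mul_mul hF, nsmul_eq_mul]
  ring

theorem sum_one_add_quadraticChar (hF : ringChar F ≠ 2) (c a : F) :
    ∑ b, (1 + φ (c * (a * b))) = 𝐪 := by
  simp only [sum_add_distrib, ← mul_assoc, sum_quadraticChar_mul_add_self hF, sum_const, card_univ,
    nsmul_eq_mul, mul_one, add_zero]

theorem sum_quadraticChar_mul_self : ∑ a : F, φ (a * a) = 𝐪 - 1 := by
  have h1 : ∀ a : F, φ (a * a) = 1 - if a = 0 then 1 else 0 := fun a => by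
    by_cases ha : a = 0
    · simp [ha]
    · rw [map_mul, quadraticChar_mul_self_of_ne_zero ha, if_neg ha, sub_zero]
  simp only [h1, sum_sub_distrib, sum_ite_eq', mem_univ, if_true, sum_const, card_univ,
    nsmul_eq_mul, mul_one]

theorem coneSum_left_pair (hF : ringChar F ≠ 2) :
    coneSum φ φ (fun _ => 1) (fun _ => 1) = 𝐪 * (𝐪 - 1) * φ 2 := by
  rw [coneSum_of_left hF]
  have h1 : ∀ a b : F, ∑ d, φ (d + a) * φ (d + b) * 1 = -1 + if a = b then 𝐪 else 0 :=
    fun a b => by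
      rw [← sum_quadraticChar_mul_add hF]
      exact sum_congr rfl fun d _ => by rw [mul_one, map_mul]
  have h2 : ∀ a : F, ∑ b, (1 + φ (2 * (a * b))) * (-1 + if a = b then 𝐪 else 0) =
      𝐪 * φ 2 * φ (a * a) := fun a => by
    have h3 : ∀ b : F, (1 + φ (2 * (a * b))) * (-1 + if a = b then 𝐪 else 0) =
        (1 + φ (2 * (a * b))) * -1 + if a = b then (1 + φ (2 * (a * b))) * 𝐪 else 0 := fun b => by
      split_ifs <;> ring
    simp only [h3]
    rw [sum_add_distrib, ← sum_mul, sum_one_add_quadraticChar hF, sum_ite_eq, if_pos (mem_univ a),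
      map_mul φ 2]
    ring
  simp only [h1, h2]
  rw [← mul_sum, sum_quadraticChar_mul_self]
  ring

theorem coneSum_outer_pair (hF : ringChar F ≠ 2) :
    coneSum φ (fun _ => 1) (fun _ => 1) φ = 0 := by
  rw [coneSum_of_left hF]
  have h1 : ∀ a : F, ∑ d, φ (d + a) * 1 * φ d = -1 + if a = 0 then 𝐪 else 0 := fun a => by
    rw [← sum_quadraticChar_mul_add hF]
    exact sum_congr rfl fun d _ => by rw [mul_one, map_mul, add_zero]
  simp only [h1, ← sum_mul, sum_one_add_quadraticChar hF]
  rw [← mul_sum, sum_add_distrib, sum_ite_eq', if_pos (mem_univ 0), sum_const, card_univ,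
    nsmul_eq_mul]
  ring

end ConeSums

section DworkCone

open Finset

variable {F : Type*} [Field F] [Fintype F] [DecidableEq F]

local notation "φ" => quadraticChar F
local notation "𝐪" => (Fintype.card F : ℤ)

theorem sum_ne_zero_quadratic (hF : ringChar F ≠ 2) {A B C : F} (h : ¬(A = 0 ∧ B = 0 ∧ C = 0)) :
    ∑ g : F, (if g = 0 then 0 else if A * g ^ 2 + 2 * B * g + C = 0 then (1 : ℤ) else 0) =
      1 + φ (B ^ 2 - A * C) - (if A = 0 then 1 else 0) - if C = 0 then 1 else 0 := by
  have h2 : (2 : F) ≠ 0 := Ring.two_ne_zero hF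
  have h1 : ∀ g : F, (if g = 0 then 0 else if A * g ^ 2 + 2 * B * g + C = 0 then (1 : ℤ) else 0) =
      (if A * g ^ 2 + 2 * B * g + C = 0 then (1 : ℤ) else 0) -
        if g = 0 then (if C = 0 then 1 else 0) else 0 := fun g => by
    by_cases hg : g = 0 <;> simp [hg]
  simp only [h1, sum_sub_distrib, sum_ite_eq', mem_univ, if_true]
  congr 1
  by_cases hA : A = 0
  · subst hA
    by_cases hB : B = 0
    · have hC : C ≠ 0 := fun hC => h ⟨rfl, hB, hC⟩
      simp [hB, hC]
    · have h3 : ∀ g : F, 0 * g ^ 2 + 2 * B * g + C = 0 ↔ g = -C / (2 * B) := fun g => by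
        rw [eq_div_iff (mul_ne_zero h2 hB)]
        constructor <;> intro h <;> linear_combination h
      simp only [h3, sum_ite_eq', mem_univ, if_true]
      simp [quadraticChar_sq_one' hB, -quadraticChar_apply, -map_pow]
  · rw [if_neg hA, sub_zero, sum_boole, card_filter_quadratic hF hA,
      ← quadraticChar_four_mul hF (B ^ 2 - A * C)]
    congr 2
    ring

theorem sum_coneIndicator_one (hF : ringChar F ≠ 2) (x y : F) :
    ∑ g, (if g = 0 then 0 else coneIndicator 1 x g (g * y)) =
      1 + φ 2 * φ ((x + y) * (1 + x * y) - 4 * (x * y)) -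
        (if (1 + y) ^ 2 - 8 * y = 0 then 1 else 0) - if (1 + x) ^ 2 - 8 * x = 0 then 1 else 0 := by
  have h8 : (8 : F) ≠ 0 := by
    rw [show (8 : F) = 2 ^ 3 by norm_num]
    exact pow_ne_zero 3 (Ring.two_ne_zero hF)
  simp only [coneIndicator_one]
  rw [sum_ne_zero_quadratic hF, ← map_mul, ← quadraticChar_four_mul hF (2 * _)]
  · congr 4
    ring
  · rintro ⟨hA, hB, hC⟩
    rcases mul_eq_zero.1 hB with h | h
    · refine h8 ?_
      linear_combination hC + (8 - (1 + x)) * h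
    · refine h8 ?_
      linear_combination hA + (8 - (1 + y)) * h

theorem coneSum_fibre {α : F} (hα : α ≠ 0) :
    ∑ β, ∑ γ, ∑ δ, coneIndicator α β γ δ * (φ α * φ β * φ γ * φ δ) =
      ∑ x, ∑ y, φ (x * y) * ∑ g, if g = 0 then 0 else coneIndicator 1 x g (g * y) := by
  rw [← sum_comp_mul_left hα]
  refine sum_congr rfl fun x _ => ?_
  simp only [mul_sum]
  rw [sum_comm (s := univ) (t := univ) (f := fun y g => φ (x * y) * _), ← sum_comp_mul_left hα]
  refine sum_congr rfl fun g _ => ?_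
  by_cases hg : g = 0
  · simp [hg]
  · rw [← sum_comp_mul_left (mul_ne_zero hα hg)]
    refine sum_congr rfl fun y _ => ?_
    have h := coneIndicator_mul hα 1 x g (g * y)
    rw [mul_one, ← mul_assoc] at h
    have e1 := quadraticChar_mul_self_of_ne_zero hα
    have e2 := quadraticChar_mul_self_of_ne_zero hg
    rw [h, if_neg hg]
    simp only [map_mul]
    linear_combination (φ x * φ y * coneIndicator 1 x g (g * y)) *
      (φ α * φ α * φ g * φ g * e1 + φ g * φ g * e1 + e2)

theorem coneSum_quadraticChar (hF : ringChar F ≠ 2) {i : F} (hi : i ^ 2 = -1) :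
    coneSum φ φ φ φ = (𝐪 - 1) * (φ 2 * (𝐪 + ellipticFamilySum F)) := by
  have h0 := quadraticChar_sum_zero hF
  have h1 : ∑ x, ∑ y, φ (x * y) * ∑ g, (if g = 0 then 0 else coneIndicator 1 x g (g * y)) =
      φ 2 * (𝐪 + ellipticFamilySum F) := by
    rw [← sum_quadraticChar_dihedral hF hi]
    have h2 : ∀ x y : F, φ (x * y) * ∑ g, (if g = 0 then 0 else coneIndicator 1 x g (g * y)) =
        φ x * φ y + φ 2 * φ (x * y * ((x + y) * (1 + x * y) - 4 * (x * y))) -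
          φ x * (φ y * if (1 + y) ^ 2 - 8 * y = 0 then 1 else 0) -
          (φ x * if (1 + x) ^ 2 - 8 * x = 0 then 1 else 0) * φ y := fun x y => by
      rw [sum_coneIndicator_one hF, map_mul φ (x * y), map_mul φ x y]
      ring
    simp only [h2, sum_sub_distrib, sum_add_distrib, ← mul_sum, ← sum_mul, h0]
    ring
  have h3 : ∀ α : F, ∑ β, ∑ γ, ∑ δ, coneIndicator α β γ δ * (φ α * φ β * φ γ * φ δ) =
      (1 - if α = 0 then 1 else 0) * (φ 2 * (𝐪 + ellipticFamilySum F)) := fun α => by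
    by_cases hα : α = 0
    · simp [hα]
    · rw [coneSum_fibre hα, h1, if_neg hα]
      ring
  rw [coneSum]
  simp only [h3]
  rw [← sum_mul, sum_sub_distrib, sum_ite_eq', if_pos (mem_univ 0), sum_const, card_univ,
    nsmul_eq_mul, mul_one]

theorem sum_coneIndicator_sq (hF : ringChar F ≠ 2) :
    ∑ a : F, ∑ b : F, ∑ c : F, ∑ d : F, coneIndicator (a ^ 2) (b ^ 2) (c ^ 2) (d ^ 2) =
      coneSum (fun a : F => 1 + φ a) (fun a => 1 + φ a) (fun a => 1 + φ a) fun a => 1 + φ a := by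
  rw [coneSum]
  rw [sum_comp_sq hF fun α : F => ∑ b : F, ∑ c : F, ∑ d : F,
    coneIndicator α (b ^ 2) (c ^ 2) (d ^ 2)]
  refine sum_congr rfl fun α _ => ?_
  rw [sum_comp_sq hF fun β : F => ∑ c : F, ∑ d : F, coneIndicator α β (c ^ 2) (d ^ 2), mul_sum]
  refine sum_congr rfl fun β _ => ?_
  rw [sum_comp_sq hF fun γ : F => ∑ d : F, coneIndicator α β γ (d ^ 2), mul_sum, mul_sum]
  refine sum_congr rfl fun γ _ => ?_
  rw [sum_comp_sq hF fun δ : F => coneIndicator α β γ δ, mul_sum, mul_sum, mul_sum]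
  refine sum_congr rfl fun δ _ => ?_
  push_cast
  ring

theorem coneSum_add_left (f g f₂ f₃ f₄ : F → ℤ) :
    coneSum (fun a => f a + g a) f₂ f₃ f₄ = coneSum f f₂ f₃ f₄ + coneSum g f₂ f₃ f₄ := by
  simp only [coneSum, ← sum_add_distrib]
  refine sum_congr rfl fun α _ => sum_congr rfl fun β _ => sum_congr rfl fun γ _ =>
    sum_congr rfl fun δ _ => ?_
  ring

theorem coneSum_one_add_quadraticChar (hF : ringChar F ≠ 2) {i : F} (hi : i ^ 2 = -1) :
    coneSum (fun a : F => 1 + φ a) (fun a => 1 + φ a) (fun a => 1 + φ a) (fun a => 1 + φ a) =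
      𝐪 ^ 3 + (𝐪 - 1) * (3 * 𝐪 * φ 2 + φ 2 * ellipticFamilySum F) := by
  obtain ⟨u, hu⟩ := quadraticChar_exists_neg_one hF
  have hu0 : u ≠ 0 := by
    rintro rfl
    simp at hu
  set o : F → ℤ := fun _ => 1 with ho
  have a1 := coneSum_add_left (F := F) o φ
  have a2 : ∀ f₁ f₃ f₄ : F → ℤ, coneSum f₁ (fun a => o a + φ a) f₃ f₄ =
      coneSum f₁ o f₃ f₄ + coneSum f₁ φ f₃ f₄ := fun f₁ f₃ f₄ => by
    rw [coneSum_swap_left, a1, coneSum_swap_left o, coneSum_swap_left φ]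
  have a3 : ∀ f₁ f₂ f₄ : F → ℤ, coneSum f₁ f₂ (fun a => o a + φ a) f₄ =
      coneSum f₁ f₂ o f₄ + coneSum f₁ f₂ φ f₄ := fun f₁ f₂ f₄ => by
    rw [coneSum_swap_pairs, a1, coneSum_swap_pairs o, coneSum_swap_pairs φ]
  have a4 : ∀ f₁ f₂ f₃ : F → ℤ, coneSum f₁ f₂ f₃ (fun a => o a + φ a) =
      coneSum f₁ f₂ f₃ o + coneSum f₁ f₂ f₃ φ := fun f₁ f₂ f₃ => by
    rw [coneSum_swap_right, a3, coneSum_swap_right _ _ o, coneSum_swap_right _ _ φ]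
  have odd : ∀ f₁ f₂ f₃ f₄ : F → ℤ,
      (∀ α β γ δ, f₁ (u * α) * f₂ (u * β) * f₃ (u * γ) * f₄ (u * δ) =
        -(f₁ α * f₂ β * f₃ γ * f₄ δ)) → coneSum f₁ f₂ f₃ f₄ = 0 :=
    fun _ _ _ _ => coneSum_eq_zero_of_neg hu0
  have o1 : coneSum φ o o o = 0 := odd _ _ _ _ fun α β γ δ => by
    simp only [map_mul, hu, ho]; ring
  have o2 : coneSum o φ o o = 0 := by rw [coneSum_swap_left, o1]
  have o3 : coneSum o o φ o = 0 := by rw [coneSum_swap_pairs, o1]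
  have o4 : coneSum o o o φ = 0 := by rw [coneSum_swap_right, o3]
  have o5 : coneSum o φ φ φ = 0 := odd _ _ _ _ fun α β γ δ => by
    simp only [map_mul, hu, ho]; ring
  have o6 : coneSum φ o φ φ = 0 := by rw [coneSum_swap_left, o5]
  have o7 : coneSum φ φ o φ = 0 := by rw [coneSum_swap_pairs, o5]
  have o8 : coneSum φ φ φ o = 0 := by rw [coneSum_swap_right, o7]
  have p1 := coneSum_outer_pair hF
  have p2 : coneSum φ o φ o = 0 := by rw [coneSum_swap_right, p1]
  have p3 : coneSum o φ o φ = 0 := by rw [coneSum_swap_left, p1]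
  have p4 : coneSum o φ φ o = 0 := by rw [coneSum_swap_left, p2]
  have l1 := coneSum_left_pair hF
  have l2 : coneSum o o φ φ = 𝐪 * (𝐪 - 1) * φ 2 := by rw [coneSum_swap_pairs, l1]
  have e0 := coneSum_one hF
  have e1 := coneSum_quadraticChar hF hi
  change coneSum (fun a => o a + φ a) (fun a => o a + φ a) (fun a => o a + φ a)
    (fun a => o a + φ a) = _
  simp only [a1, a2, a3, a4]
  linear_combination o1 + o2 + o3 + o4 + o5 + o6 + o7 + o8 + p1 + p2 + p3 + p4 + l1 + l2 + e0 + e1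

end DworkCone

section PointCount

open Finset

/-- A homogeneous condition on a vector space holds for `#Kˣ` times as many nonzero vectors as
points of the projectivization. -/
theorem card_nonzero_eq_card_projectivization_mul {K V : Type*} [Field K] [AddCommGroup V]
    [Module K V] (C : V → Prop) (hC : ∀ (a : Kˣ) (v : V), C (a • v) ↔ C v) :
    Nat.card {v : V // v ≠ 0 ∧ C v} =
      Nat.card {P : Projectivization K V // C P.rep} * Nat.card Kˣ := by
  rw [← Nat.card_prod]
  symm
  refine Nat.card_congr (Equiv.ofBijective (fun x => ⟨x.2 • x.1.1.rep,
    (smul_ne_zero_iff_ne x.2).2 x.1.1.rep_nonzero, (hC _ _).2 x.1.2⟩) ⟨?_, ?_⟩)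
  · rintro ⟨⟨P, hP⟩, a⟩ ⟨⟨Q, hQ⟩, b⟩ h
    have h1 : a • P.rep = b • Q.rep := congrArg Subtype.val h
    have h2 : P = Q := by
      rw [← P.mk_rep, ← Q.mk_rep, Projectivization.mk_eq_mk_iff]
      exact ⟨a⁻¹ * b, by rw [mul_smul, ← h1, inv_smul_smul]⟩
    subst h2
    have h3 : (a : K) = b := smul_left_injective K P.rep_nonzero h1
    rw [Units.ext h3]
  · rintro ⟨v, hv, hCv⟩
    obtain ⟨a, ha⟩ := Projectivization.exists_smul_eq_mk_rep K v hv
    refine ⟨⟨⟨Projectivization.mk K v hv, ?_⟩, a⁻¹⟩, Subtype.ext ?_⟩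
    · rw [← ha]
      exact (hC a v).2 hCv
    · simp only [← ha, inv_smul_smul]

theorem sum_pow_four_eq_iff {F : Type*} [Field F] (hF : ringChar F ≠ 2) {i : F} (hi : i ^ 2 = -1)
    (x y z w : F) :
    ((x + i * y) ^ 2 + (i * x + y) ^ 2 + (z + i * w) ^ 2 + (i * z + w) ^ 2) ^ 2 =
        8 * ((x + i * y) ^ 2 * (i * x + y) ^ 2 + (z + i * w) ^ 2 * (i * z + w) ^ 2) ↔
      x ^ 4 + y ^ 4 + z ^ 4 + w ^ 4 = 4 * (x * y * z * w) := by
  have h8 : (8 : F) ≠ 0 := by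
    rw [show (8 : F) = 2 ^ 3 by norm_num]
    exact pow_ne_zero 3 (Ring.two_ne_zero hF)
  have e1 : ∀ x y : F, (x + i * y) ^ 2 + (i * x + y) ^ 2 = 4 * i * (x * y) := fun x y => by
    linear_combination (x ^ 2 + y ^ 2) * hi
  have e2 : ∀ x y : F, (x + i * y) * (i * x + y) = i * (x ^ 2 + y ^ 2) := fun x y => by
    linear_combination x * y * hi
  rw [e1, add_assoc, e1, ← mul_pow, ← mul_pow, e2, e2,
    ← mul_right_inj' h8 (b := x ^ 4 + y ^ 4 + z ^ 4 + w ^ 4)]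
  constructor <;> intro h
  · linear_combination h + (8 * (x ^ 2 + y ^ 2) ^ 2 + 8 * (z ^ 2 + w ^ 2) ^ 2 -
      16 * (x * y + z * w) ^ 2) * hi
  · linear_combination h - (8 * (x ^ 2 + y ^ 2) ^ 2 + 8 * (z ^ 2 + w ^ 2) ^ 2 -
      16 * (x * y + z * w) ^ 2) * hi

variable {F : Type*} [Field F] [Fintype F]

local notation "φ" => quadraticChar F
local notation "𝐪" => (Fintype.card F : ℤ)

/-- The affine cone over the Dwork K3 surface. -/
def IsDworkZero (lam : F) (v : Fin 4 → F) : Prop :=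
  v 0 ^ 4 + v 1 ^ 4 + v 2 ^ 4 + v 3 ^ 4 = 4 * lam * (v 0 * v 1 * v 2 * v 3)

theorem card_isDworkZero_eq (lam : F) :
    Nat.card {v : Fin 4 → F // IsDworkZero lam v} =
      dworkK3Count F lam * (Fintype.card F - 1) + 1 := by
  classical
  have h1 := card_nonzero_eq_card_projectivization_mul (K := F) (IsDworkZero lam) fun a v => by
    have ha : (a : F) ^ 4 ≠ 0 := pow_ne_zero 4 a.ne_zero
    simp only [IsDworkZero, Pi.smul_apply, Units.smul_def, smul_eq_mul]
    rw [← mul_right_inj' ha (b := v 0 ^ 4 + v 1 ^ 4 + v 2 ^ 4 + v 3 ^ 4)]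
    constructor <;> intro h <;> linear_combination h
  rw [Nat.card_units, Nat.card_eq_fintype_card (α := F)] at h1
  have h2 : dworkK3Count F lam =
      Nat.card {P : Projectivization F (Fin 4 → F) // IsDworkZero lam P.rep} := rfl
  rw [h2, ← h1, Nat.card_eq_fintype_card, Nat.card_eq_fintype_card, Fintype.card_subtype,
    Fintype.card_subtype, ← card_insert_of_notMem (a := 0) (by simp)]
  congr 1
  ext v
  simp only [mem_filter, mem_univ, true_and, mem_insert]
  by_cases hv : v = 0
  · simp [hv, IsDworkZero]
  · simp [hv]

variable [DecidableEq F]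

theorem card_isDworkZero_eq_sum_coneIndicator (hF : ringChar F ≠ 2) {i : F} (hi : i ^ 2 = -1)
    {lam : F} (hlam : lam ^ 4 = 1) :
    (Nat.card {v : Fin 4 → F // IsDworkZero lam v} : ℤ) =
      ∑ a : F, ∑ b : F, ∑ c : F, ∑ d : F, coneIndicator (a ^ 2) (b ^ 2) (c ^ 2) (d ^ 2) := by
  have h2 : (2 : F) ≠ 0 := Ring.two_ne_zero hF
  have hl : lam ≠ 0 := by
    rintro rfl
    simp at hlam
  have key : ∀ v : Fin 4 → F, IsDworkZero lam v ↔
      ((lam * v 0 + i * v 1) ^ 2 + (i * (lam * v 0) + v 1) ^ 2 + (v 2 + i * v 3) ^ 2 +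
        (i * v 2 + v 3) ^ 2) ^ 2 =
      8 * ((lam * v 0 + i * v 1) ^ 2 * (i * (lam * v 0) + v 1) ^ 2 +
        (v 2 + i * v 3) ^ 2 * (i * v 2 + v 3) ^ 2) := fun v => by
    rw [sum_pow_four_eq_iff hF hi, IsDworkZero]
    constructor <;> intro h
    · linear_combination h + v 0 ^ 4 * hlam
    · linear_combination h - v 0 ^ 4 * hlam
  have e1 : ∀ x y : F, (x + i * y - i * (i * x + y)) / 2 = x := fun x y => by
    field_simp
    linear_combination -x * hi
  have e2 : ∀ x y : F, (i * x + y - i * (x + i * y)) / 2 = y := fun x y => by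
    field_simp
    linear_combination -y * hi
  have e3 : ∀ x y : F, (x - i * y) / 2 + i * ((y - i * x) / 2) = x := fun x y => by
    field_simp
    linear_combination -x * hi
  have e4 : ∀ x y : F, i * ((x - i * y) / 2) + (y - i * x) / 2 = y := fun x y => by
    field_simp
    linear_combination -y * hi
  classical
  simp only [← sum_product', coneIndicator]
  rw [Nat.card_eq_fintype_card, Fintype.card_subtype, sum_boole]
  norm_cast
  have hright : ∀ x : F × F × F × F, ∀ v : Fin 4 → F,
      v = ![lam⁻¹ * ((x.1 - i * x.2.1) / 2), (x.2.1 - i * x.1) / 2,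
        (x.2.2.1 - i * x.2.2.2) / 2, (x.2.2.2 - i * x.2.2.1) / 2] →
      (lam * v 0 + i * v 1, i * (lam * v 0) + v 1, v 2 + i * v 3, i * v 2 + v 3) = x := by
    rintro ⟨a, b, c, d⟩ v rfl
    simp [mul_inv_cancel_left₀ hl, e3, e4]
  refine card_bij' (fun v _ => (lam * v 0 + i * v 1, i * (lam * v 0) + v 1, v 2 + i * v 3,
      i * v 2 + v 3))
    (fun x _ => ![lam⁻¹ * ((x.1 - i * x.2.1) / 2), (x.2.1 - i * x.1) / 2,
      (x.2.2.1 - i * x.2.2.2) / 2, (x.2.2.2 - i * x.2.2.1) / 2]) ?_ ?_ ?_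
    fun x _ => hright x _ rfl
  · intro v hv
    simp only [mem_filter, mem_univ, true_and, univ_product_univ] at hv ⊢
    exact (key v).1 hv
  · intro x hx
    simp only [mem_filter, mem_univ, true_and, univ_product_univ] at hx ⊢
    rw [← hright x _ rfl] at hx
    exact (key _).2 hx
  · intro v hv
    ext j
    fin_cases j <;> simp [e1, e2, inv_mul_cancel_left₀ hl]

theorem dworkK3Count_mul_card_sub_one (hF : ringChar F ≠ 2) {i : F} (hi : i ^ 2 = -1)
    {lam : F} (hlam : lam ^ 4 = 1) :
    (dworkK3Count F lam : ℤ) * (𝐪 - 1) =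
      𝐪 ^ 3 - 1 + (𝐪 - 1) * (3 * 𝐪 * φ 2 + φ 2 * ellipticFamilySum F) := by
  have h1 := card_isDworkZero_eq_sum_coneIndicator hF hi hlam
  rw [sum_coneIndicator_sq hF, coneSum_one_add_quadraticChar hF hi, card_isDworkZero_eq] at h1
  push_cast [Nat.cast_sub Fintype.card_pos] at h1
  linear_combination h1

end PointCount

section MultiplicativeCharacters

open Finset

/-- Orthogonality of multiplicative characters of a finite field. -/
theorem MulChar.sum_apply {F : Type*} [Field F] [Fintype F] [Fintype (MulChar F ℂ)]
    [DecidableEq F] (w : F) :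
    ∑ χ : MulChar F ℂ, χ w = if w = 1 then (Fintype.card F : ℂ) - 1 else 0 := by
  split_ifs with hw
  · have h := MulChar.card_eq_card_units_of_hasEnoughRootsOfUnity F ℂ
    rw [Nat.card_eq_fintype_card, Nat.card_units, Nat.card_eq_fintype_card] at h
    simp only [hw, map_one, sum_const, card_univ, nsmul_eq_mul, mul_one, h]
    rw [Nat.cast_sub Fintype.card_pos, Nat.cast_one]
  · obtain ⟨χ, hχ⟩ := MulChar.exists_apply_ne_one_of_hasEnoughRootsOfUnity F ℂ hw
    refine eq_zero_of_mul_eq_self_left hχ ?_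
    simp only [mul_sum, ← MulChar.mul_apply]
    exact Fintype.sum_bijective _ (Group.mulLeft_bijective χ) _ _ fun χ' => rfl

variable {F : Type*} [Field F] [Fintype F]

theorem card_mul_jacB (A χ : MulChar F ℂ) :
    (Fintype.card F : ℂ) * jacB (A * χ) χ = ∑ x, A x * χ (-(x * (1 - x)⁻¹)) := by
  have hq : (Fintype.card F : ℂ) ≠ 0 := Nat.cast_ne_zero.2 Fintype.card_ne_zero
  rw [jacB, ← mul_assoc, mul_div_cancel₀ _ hq, mul_sum]
  refine sum_congr rfl fun x _ => ?_
  rw [MulChar.inv_apply', MulChar.mul_apply, neg_eq_neg_one_mul (x * _), map_mul, map_mul]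
  ring

variable [DecidableEq F]

theorem card_sq_mul_greene3F2 (A B C : MulChar F ℂ) :
    (Fintype.card F : ℂ) ^ 2 * greene3F2 A B C 1 1 (1 : F) =
      ∑ x, ∑ z, A x * C z * ∑ y, B y *
        if -(x * (1 - x)⁻¹) * -(z * (1 - z)⁻¹) * -(y * (1 - y)⁻¹) = 1 then 1 else 0 := by
  have : Fintype (MulChar F ℂ) := Fintype.ofFinite _
  have hq : (Fintype.card F : ℂ) ≠ 0 := Nat.cast_ne_zero.2 Fintype.card_ne_zero
  have hq1 : (Fintype.card F : ℂ) - 1 ≠ 0 :=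
    sub_ne_zero.2 (Nat.cast_ne_one.2 Fintype.one_lt_card.ne')
  have h1 : (Fintype.card F : ℂ) ^ 2 * greene3F2 A B C 1 1 (1 : F) =
      ((Fintype.card F : ℂ) - 1)⁻¹ * ∑ χ : MulChar F ℂ, (Fintype.card F * jacB (A * χ) χ) *
        (Fintype.card F * jacB (C * χ) χ) * (Fintype.card F * jacB (B * χ) χ) := by
    rw [greene3F2, finsum_eq_sum_of_fintype, mul_sum, mul_sum, mul_sum]
    refine sum_congr rfl fun χ _ => ?_
    rw [one_mul, map_one]
    field_simp
  rw [h1, inv_mul_eq_iff_eq_mul₀ hq1]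
  have h2 : ∀ f g h : F → ℂ, (∑ x, f x) * (∑ z, g z) * (∑ y, h y) =
      ∑ x, ∑ z, ∑ y, f x * g z * h y := fun f g h => by
    rw [sum_mul_sum, sum_mul]
    refine sum_congr rfl fun x _ => ?_
    rw [sum_mul]
    exact sum_congr rfl fun z _ => mul_sum _ _ _
  have h3 : ∀ (x z y : F) (χ : MulChar F ℂ), A x * χ (-(x * (1 - x)⁻¹)) *
      (C z * χ (-(z * (1 - z)⁻¹))) * (B y * χ (-(y * (1 - y)⁻¹))) = A x * C z * B y *
        χ (-(x * (1 - x)⁻¹) * -(z * (1 - z)⁻¹) * -(y * (1 - y)⁻¹)) := fun x z y χ => by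
    rw [map_mul, map_mul]
    ring
  simp only [card_mul_jacB, h2, h3]
  simp only [mul_sum]
  rw [sum_comm]
  refine sum_congr rfl fun x _ => ?_
  rw [sum_comm]
  refine sum_congr rfl fun z _ => ?_
  rw [sum_comm]
  refine sum_congr rfl fun y _ => ?_
  rw [← mul_sum, MulChar.sum_apply]
  split_ifs <;> ring

local notation "φ" => quadraticChar F

theorem sum_quadraticChar_mul_ite {k : F} (hk : k ≠ 0) :
    ∑ y, (φ y : ℂ) * (if k * -(y * (1 - y)⁻¹) = 1 then 1 else 0) = φ (1 - k) := by
  have h : ∀ y : F, k * -(y * (1 - y)⁻¹) = 1 ↔ y * (1 - k) = 1 := fun y => by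
    by_cases hy : y = 1
    · simp [hy, hk]
    · have hy' : 1 - y ≠ 0 := sub_ne_zero.2 (Ne.symm hy)
      field_simp
      constructor <;> intro h <;> linear_combination h
  simp only [h]
  by_cases hk1 : 1 - k = 0
  · simp [hk1]
  · have h2 : ∀ y : F, y * (1 - k) = 1 ↔ y = (1 - k)⁻¹ := fun y => by
      rw [← one_div, eq_div_iff hk1]
    simp only [h2, mul_ite, mul_one, mul_zero, sum_ite_eq', mem_univ, if_true, quadraticChar_inv]

theorem card_sq_mul_greene3F2_of_quadratic {η : MulChar F ℂ} (hη : ∀ x, η x = φ x)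
    (A C : MulChar F ℂ) :
    (Fintype.card F : ℂ) ^ 2 * greene3F2 A η C 1 1 (1 : F) =
      ∑ x, ∑ z, A x * C z * (φ ((1 - x) * (1 - z) * (1 - x - z)) : ℂ) := by
  rw [card_sq_mul_greene3F2]
  refine sum_congr rfl fun x _ => sum_congr rfl fun z _ => ?_
  simp only [hη]
  by_cases hx0 : x = 0
  · simp [hx0, MulChar.map_zero]
  by_cases hz0 : z = 0
  · simp [hz0, MulChar.map_zero]
  by_cases hx : 1 - x = 0
  · simp [hx]
  by_cases hz : 1 - z = 0
  · simp [hz]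
  rw [sum_quadraticChar_mul_ite (mul_ne_zero (neg_ne_zero.2 (mul_ne_zero hx0 (inv_ne_zero hx)))
    (neg_ne_zero.2 (mul_ne_zero hz0 (inv_ne_zero hz)))),
    ← quadraticChar_sq_mul (mul_ne_zero hx hz) (1 - _)]
  congr 3
  field_simp
  ring

/-- A double character sum with a quartic character, as a sum of quadratic characters. -/
theorem sum_quartic_mul_inv (hF : ringChar F ≠ 2) (hm : φ (-1) = 1) {ψ : MulChar F ℂ}
    (hψ : ∀ x, ψ x * ψ x = φ x) :
    ∑ x, ∑ z, ψ x * ψ⁻¹ z * (φ ((1 - x) * (1 - z) * (1 - x - z)) : ℂ) =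
      φ 2 * ellipticFamilySum F := by
  have hinv : ∀ x, ψ⁻¹ x = ψ x * φ x := fun x => by
    by_cases hx : x = 0
    · simp [hx, MulChar.map_zero]
    have e : ψ x * ψ⁻¹ x = 1 := by
      rw [← MulChar.mul_apply, mul_inv_cancel, MulChar.one_apply (Ne.isUnit hx)]
    have e2 : (φ x : ℂ) * φ x = 1 := by
      exact_mod_cast congrArg (Int.cast : ℤ → ℂ) (quadraticChar_mul_self_of_ne_zero hx)
    linear_combination -ψ⁻¹ x * e2 - ψ⁻¹ x * φ x * hψ x + ψ x * φ x * e
  have hswap : ∑ x, ∑ z, ψ x * ψ⁻¹ z * (φ ((1 - x) * (1 - z) * (1 - x - z)) : ℂ) =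
      ∑ x, ∑ z, ψ⁻¹ x * ψ z * (φ ((1 - x) * (1 - z) * (1 - x - z)) : ℂ) := by
    rw [sum_comm]
    refine sum_congr rfl fun x _ => sum_congr rfl fun z _ => ?_
    rw [mul_comm (ψ z), mul_comm (1 - z), sub_right_comm]
  have hfib : ∀ x, ∑ z, (ψ x * ψ⁻¹ z + ψ⁻¹ x * ψ z) *
        (φ ((1 - x) * (1 - z) * (1 - x - z)) : ℂ) =
      ∑ w, if x = 0 then 0 else (1 + (φ w : ℂ)) * (ψ w *
        φ ((1 - w * x) * (1 - x) * (1 - x - w * x))) := fun x => by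
    by_cases hx : x = 0
    · simp [hx, MulChar.map_zero]
    rw [← sum_comp_mul_left hx]
    refine sum_congr rfl fun w _ => ?_
    have e : ψ x * ψ⁻¹ x = 1 := by
      rw [← MulChar.mul_apply, mul_inv_cancel, MulChar.one_apply (Ne.isUnit hx)]
    rw [if_neg hx, map_mul, map_mul, mul_comm x w, mul_comm (1 - x)]
    linear_combination ((ψ⁻¹ w + ψ w) * e + hinv w) *
      (φ ((1 - w * x) * (1 - x) * (1 - x - w * x)) : ℂ)
  have hpart := congrArg (Int.cast : ℤ → ℂ) (sum_quadraticChar_mul_legendre_fibre hF hm)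
  have h2 := sum_comp_sq hF fun w : F => ψ w *
    ∑ x : F, if x = 0 then 0 else (φ ((1 - w * x) * (1 - x) * (1 - x - w * x)) : ℂ)
  have hdouble : 2 * ∑ x, ∑ z, ψ x * ψ⁻¹ z * (φ ((1 - x) * (1 - z) * (1 - x - z)) : ℂ) =
      2 * (φ 2 * ellipticFamilySum F) := by
    rw [two_mul]
    nth_rw 2 [hswap]
    simp only [← sum_add_distrib, ← add_mul, hfib]
    rw [sum_comm]
    push_cast at hpart
    rw [← hpart]
    have h3 : ∀ y : F, ψ (y ^ 2) = φ y := fun y => by rw [sq, map_mul, hψ]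
    simp only [h3] at h2
    rw [h2]
    simp only [mul_sum, mul_ite, mul_zero]
  exact mul_left_cancel₀ two_ne_zero hdouble

end MultiplicativeCharacters

section CharacterGroup

variable {F : Type*} [Field F] [Fintype F]

theorem MulChar.orderOf_eq_card_sub_one {T : MulChar F ℂ}
    (hT : ∀ χ : MulChar F ℂ, χ ∈ Subgroup.zpowers T) : orderOf T = Fintype.card F - 1 := by
  rw [orderOf_eq_card_of_forall_mem_zpowers hT,
    MulChar.card_eq_card_units_of_hasEnoughRootsOfUnity F ℂ, Nat.card_units,
    Nat.card_eq_fintype_card]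

variable [DecidableEq F]

local notation "φ" => quadraticChar F

theorem MulChar.apply_eq_quadraticChar {η : MulChar F ℂ} (h1 : η ≠ 1) (h2 : η ^ 2 = 1) (x : F) :
    η x = φ x := by
  have hsq : ∀ y : F, y ≠ 0 → IsSquare y → η y = 1 := by
    rintro _ hy ⟨y, rfl⟩
    have hy' : y ≠ 0 := left_ne_zero_of_mul hy
    rw [map_mul, ← MulChar.mul_apply, ← sq, h2, MulChar.one_apply (Ne.isUnit hy')]
  by_cases hx : x = 0
  · simp [hx]
  by_cases hs : IsSquare x
  · rw [hsq x hx hs, (quadraticChar_one_iff_isSquare hx).2 hs, Int.cast_one]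
  obtain ⟨u, hu⟩ := MulChar.ne_one_iff.1 h1
  have hu0 := u.ne_zero
  have hnu : ¬IsSquare (u : F) := fun h => hu (hsq u hu0 h)
  have e1 := quadraticChar_neg_one_iff_not_isSquare.2 hs
  have e2 := quadraticChar_neg_one_iff_not_isSquare.2 hnu
  have e3 : η (x * u) = 1 := hsq _ (mul_ne_zero hx hu0)
    ((quadraticChar_one_iff_isSquare (mul_ne_zero hx hu0)).1 (by rw [map_mul, e1, e2]; norm_num))
  have e4 : η u * η u = 1 := by
    rw [← MulChar.mul_apply, ← sq, h2, MulChar.one_apply u.isUnit]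
  have e5 : η u = -1 := (mul_self_eq_one_iff.1 e4).resolve_left hu
  rw [map_mul, e5] at e3
  rw [e1]
  push_cast
  linear_combination -e3

theorem quartic_neg_one_eq_quadraticChar_two (hF : ringChar F ≠ 2) {i : F} (hi : i ^ 2 = -1)
    {ψ : MulChar F ℂ} (hψ : ∀ x, ψ x * ψ x = φ x) (hψ4 : ψ ^ 4 = 1) : ψ (-1) = φ 2 := by
  have h2 : (2 : F) ≠ 0 := Ring.two_ne_zero hF
  have e1 : (1 + i) ^ 4 = 2 * 2 * -1 := by
    linear_combination (i ^ 2 + 4 * i + 5) * hi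
  have hi1 : 1 + i ≠ 0 := fun h => by
    rw [h] at e1
    refine h2 (pow_eq_zero_iff two_ne_zero |>.1 ?_)
    linear_combination e1
  have e2 : ψ ((1 + i) ^ 4) = 1 := by
    rw [map_pow, ← MulChar.pow_apply' ψ four_ne_zero, hψ4, MulChar.one_apply (Ne.isUnit hi1)]
  have e3 : (φ 2 : ℂ) * φ 2 = 1 := by
    exact_mod_cast congrArg (Int.cast : ℤ → ℂ) (quadraticChar_mul_self_of_ne_zero h2)
  rw [e1, map_mul, map_mul, hψ] at e2
  linear_combination φ 2 * e2 - ψ (-1) * e3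

end CharacterGroup

/-- Theorem 1.1 (case `λ⁴ = 1`): for `q ≡ 1 (mod 4)`, `t = (q-1)/4`, `T` a generator of the
character group of `F_q^×`, and `λ⁴ = 1`,
`#X_λ⁴(F_q) = (q³-1)/(q-1) + 3q·T^t(-1) + q²·₃F₂(T^t, T^{2t}, T^{3t}; ε, ε | 1)`. -/
theorem dworkK3_point_count_lambda_pow_four_eq_one
    (F : Type*) [Field F] [Fintype F] (p e q t : ℕ) (hp : p.Prime) (hodd : p ≠ 2)
    (he : 0 < e) (hq : q = p ^ e) (hcard : q = Fintype.card F)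
    (hq4 : q % 4 = 1) (ht : t = (q - 1) / 4)
    (T : MulChar F ℂ) (hT : ∀ χ : MulChar F ℂ, χ ∈ Subgroup.zpowers T)
    (lam : F) (hlam : lam ^ 4 = 1) :
    (dworkK3Count F lam : ℂ) =
      ((q : ℂ) ^ 3 - 1) / ((q : ℂ) - 1) + 3 * (q : ℂ) * (T ^ t) (-1 : F) +
        (q : ℂ) ^ 2 * greene3F2 (T ^ t) (T ^ (2 * t)) (T ^ (3 * t)) 1 1 (1 : F) := by
  classical
  have hq1 : 1 < q := hcard ▸ Fintype.one_lt_card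
  have hF : ringChar F ≠ 2 := fun h => by
    have := FiniteField.even_card_of_char_two h
    omega
  obtain ⟨i, hi'⟩ : IsSquare (-1 : F) := FiniteField.isSquare_neg_one_iff.2 (by omega)
  have hi : i ^ 2 = -1 := by rw [sq, ← hi']
  have hm : quadraticChar F (-1) = 1 :=
    (quadraticChar_one_iff_isSquare (neg_ne_zero.2 one_ne_zero)).2 ⟨i, hi'⟩
  have hord : orderOf T = 4 * t := by
    rw [MulChar.orderOf_eq_card_sub_one hT]
    omega
  have hη : ∀ x, (T ^ (2 * t)) x = (quadraticChar F x : ℂ) := by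
    refine MulChar.apply_eq_quadraticChar (fun h => ?_) ?_
    · have := Nat.le_of_dvd (by omega) (orderOf_dvd_of_pow_eq_one h)
      omega
    · rw [← pow_mul, show 2 * t * 2 = orderOf T by omega, pow_orderOf_eq_one]
  have hψ : ∀ x, (T ^ t) x * (T ^ t) x = (quadraticChar F x : ℂ) := fun x => by
    rw [← MulChar.mul_apply, ← pow_add, ← two_mul, hη]
  have hψ4 : (T ^ t) ^ 4 = 1 := by
    rw [← pow_mul, mul_comm, ← hord, pow_orderOf_eq_one]
  have hinv : T ^ (3 * t) = (T ^ t)⁻¹ := by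
    rw [eq_inv_iff_mul_eq_one, ← hψ4, ← pow_mul, ← pow_add]
    congr 1
    ring
  have hcount := congrArg (Int.cast : ℤ → ℂ) (dworkK3Count_mul_card_sub_one hF hi hlam)
  push_cast at hcount
  rw [quartic_neg_one_eq_quadraticChar_two hF hi hψ hψ4, hinv, hcard,
    card_sq_mul_greene3F2_of_quadratic hη, sum_quartic_mul_inv hF hm hψ]
  have hne : (Fintype.card F : ℂ) - 1 ≠ 0 :=
    sub_ne_zero.2 (Nat.cast_ne_one.2 Fintype.one_lt_card.ne')
  field_simp
  linear_combination hcount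
end

section
/- Let p ≡ 1 (mod 4) be prime and let λ ∈ ℚ be a p-adic unit (v_p(λ) = 0), with reduction λ̄ ∈ F_p^×. Define the trace of Frobenius a(p) := #X_{λ̄}⁴(F_p) − p² − 1. Then in ℤ_p one has the congruence a(p) ≡ Σ_{j=0}^{p−1} ((1/4)_j·(2/4)_j·(3/4)_j)/(j!)³ · λ^{−4j} (mod p); that is, the trace of Frobenius is congruent modulo p to the classical hypergeometric series ₃F₂(1/4, 2/4, 3/4; 1, 1 | 1/λ⁴) truncated at p, which equals the period of the Dwork K3 surface modulo p. -/
/-- The rising factorial (Pochhammer symbol) `(a)ₙ = a(a+1)⋯(a+n-1)` of a rational number. -/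
def risingFac (a : ℚ) (n : ℕ) : ℚ :=
  ∏ i ∈ Finset.range n, (a + i)

/-- `(p-1).choose k ≡ (-1)^k` modulo a prime `p`. -/
lemma choose_prime_sub_one_cast (p : ℕ) [Fact p.Prime] (k : ℕ) (hk : k < p) :
    (((p - 1).choose k : ℕ) : ZMod p) = (-1) ^ k := by
  have hp := Fact.out (p := p.Prime)
  induction k with
  | zero => simp
  | succ k ih =>
    have h := Nat.choose_succ_succ' (p - 1) k
    rw [Nat.sub_add_cancel hp.one_le] at h
    have h0 : ((p.choose (k + 1) : ℕ) : ZMod p) = 0 :=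
      (ZMod.natCast_eq_zero_iff _ _).2 (hp.dvd_choose_self k.succ_ne_zero hk)
    rw [h, Nat.cast_add, ih (by omega)] at h0
    rw [pow_succ]
    linear_combination h0

/-- If the exponents sum to `4(p-1)`, the sum of a monomial over `F_p⁴` vanishes
unless all exponents are `p-1`, and is then `1`. -/
lemma prod_sum_pow_zmod (p : ℕ) [Fact p.Prime] (e : Fin 4 → ℕ) (he : ∑ i, e i = 4 * (p - 1)) :
    ∏ i, ∑ y : ZMod p, y ^ e i = if ∀ i, e i = p - 1 then 1 else 0 := by
  have hp := Fact.out (p := p.Prime)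
  split_ifs with h
  · have hs : ∑ y : ZMod p, y ^ (p - 1) = -1 := by
      have h1 : ∀ y : ZMod p, y ^ (p - 1) = 1 - if y = 0 then 1 else 0 := by
        intro y
        split_ifs with hy
        · simp [hy, Nat.sub_ne_zero_of_lt hp.one_lt]
        · simp [ZMod.pow_card_sub_one_eq_one hy]
      simp [h1]
    simp only [h, hs]
    norm_num
  · have hex : ∃ i, e i < p - 1 := by
      by_contra! hge
      apply h
      simp only [Fin.sum_univ_four] at he
      have h0 := hge 0
      have h1 := hge 1
      have h2 := hge 2
      have h3 := hge 3
      intro i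
      fin_cases i <;> simp <;> omega
    obtain ⟨i, hi⟩ := hex
    exact Finset.prod_eq_zero (Finset.mem_univ i)
      (FiniteField.sum_pow_lt_card_sub_one (ZMod p) _ (by rwa [ZMod.card]))

/-- The central multinomial coefficient `(4j)!/(j!)⁴`. -/
def quarticCoeff (j : ℕ) : ℕ :=
  Nat.multinomial Finset.univ (fun _ : Fin 4 => j)

lemma factorial_pow_mul_quarticCoeff (j : ℕ) :
    j.factorial ^ 4 * quarticCoeff j = (4 * j).factorial := by
  simpa [quarticCoeff] using Nat.multinomial_spec Finset.univ (fun _ : Fin 4 => j)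

lemma quarticCoeff_cast_eq_zero (p : ℕ) [Fact p.Prime] (j : ℕ) (hj : j < p) (h4 : p ≤ 4 * j) :
    (quarticCoeff j : ZMod p) = 0 := by
  have hp := Fact.out (p := p.Prime)
  rw [ZMod.natCast_eq_zero_iff]
  have h : p ∣ j.factorial ^ 4 * quarticCoeff j := by
    rw [factorial_pow_mul_quarticCoeff]
    exact (hp.dvd_factorial).2 h4
  refine (hp.dvd_mul.1 h).resolve_left fun h' => ?_
  exact absurd ((hp.dvd_factorial).1 (hp.dvd_of_dvd_pow h')) (by omega)

/-- The sum over `F_p⁴` of a power of the diagonal quartic times a power of the product of the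
coordinates, of total degree `4(p-1)`. -/
lemma sum_quartic_pow_mul_prod_pow (p : ℕ) [Fact p.Prime] (m : ℕ) (hm : m < p) :
    ∑ x : Fin 4 → ZMod p, (∑ i, x i ^ 4) ^ m * (∏ i, x i) ^ (p - 1 - m) =
      if 4 ∣ m then (quarticCoeff (m / 4) : ZMod p) else 0 := by
  simp_rw [Finset.sum_pow_eq_sum_piAntidiag, Finset.sum_mul]
  rw [Finset.sum_comm]
  have key : ∀ k ∈ Finset.piAntidiag (Finset.univ : Finset (Fin 4)) m,
      ∑ x : Fin 4 → ZMod p, (Nat.multinomial Finset.univ k : ZMod p) *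
        (∏ i, (x i ^ 4) ^ k i) * (∏ i, x i) ^ (p - 1 - m) =
      if ∀ i, 4 * k i = m then (Nat.multinomial Finset.univ k : ZMod p) else 0 := by
    intro k hk
    have hks : ∑ i, k i = m := (Finset.mem_piAntidiag.1 hk).1
    have h1 : ∀ x : Fin 4 → ZMod p, (Nat.multinomial Finset.univ k : ZMod p) *
        (∏ i, (x i ^ 4) ^ k i) * (∏ i, x i) ^ (p - 1 - m) =
        (Nat.multinomial Finset.univ k : ZMod p) * ∏ i, x i ^ (4 * k i + (p - 1 - m)) := by
      intro x
      rw [mul_assoc, ← Finset.prod_pow, ← Finset.prod_mul_distrib]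
      simp_rw [pow_add, pow_mul]
    simp_rw [h1]
    rw [← Finset.mul_sum,
      ← Fintype.prod_sum (fun (i : Fin 4) (y : ZMod p) => y ^ (4 * k i + (p - 1 - m))),
      prod_sum_pow_zmod]
    · have : (∀ i, 4 * k i + (p - 1 - m) = p - 1) ↔ ∀ i, 4 * k i = m :=
        forall_congr' fun i => by omega
      simp [this]
    · rw [Finset.sum_add_distrib, ← Finset.mul_sum, hks]
      simp
      omega
  rw [Finset.sum_congr rfl key]
  split_ifs with h
  · obtain ⟨j, rfl⟩ := h
    rw [Finset.sum_eq_single (fun _ => j)]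
    · simp [quarticCoeff]
    · intro k _ hne
      rw [if_neg]
      intro hk
      exact hne (funext fun i => by have := hk i; omega)
    · intro hn
      exact absurd (Finset.mem_piAntidiag.2 ⟨by simp, by simp⟩) hn
  · refine Finset.sum_eq_zero fun k _ => if_neg fun hk => h ⟨k 0, (hk 0).symm⟩

/-- The Hasse invariant of the Dwork quartic as a truncated hypergeometric sum. -/
lemma sum_dwork_pow (p : ℕ) [Fact p.Prime] (hp4 : p % 4 = 1) (c : ZMod p) (hc : c ≠ 0) :
    ∑ x : Fin 4 → ZMod p, (∑ i, x i ^ 4 - c * ∏ i, x i) ^ (p - 1) =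
      ∑ j ∈ Finset.range p, (quarticCoeff j : ZMod p) * c⁻¹ ^ (4 * j) := by
  have hp := Fact.out (p := p.Prime)
  have h1 : ∀ x : Fin 4 → ZMod p, (∑ i, x i ^ 4 - c * ∏ i, x i) ^ (p - 1) =
      ∑ m ∈ Finset.range p, (((p - 1).choose m : ZMod p) * (-c) ^ (p - 1 - m)) *
        ((∑ i, x i ^ 4) ^ m * (∏ i, x i) ^ (p - 1 - m)) := by
    intro x
    rw [sub_eq_add_neg, add_pow, Nat.sub_add_cancel hp.one_le]
    refine Finset.sum_congr rfl fun m _ => ?_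
    rw [← neg_mul, mul_pow]
    ring
  simp_rw [h1]
  rw [Finset.sum_comm]
  simp_rw [← Finset.mul_sum]
  have h2 : ∀ m ∈ Finset.range p, (((p - 1).choose m : ZMod p) * (-c) ^ (p - 1 - m)) *
      ∑ x : Fin 4 → ZMod p, ((∑ i, x i ^ 4) ^ m * (∏ i, x i) ^ (p - 1 - m)) =
      if 4 ∣ m then (quarticCoeff (m / 4) : ZMod p) * c⁻¹ ^ m else 0 := by
    intro m hm
    rw [Finset.mem_range] at hm
    rw [sum_quartic_pow_mul_prod_pow p m hm, choose_prime_sub_one_cast p m hm]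
    split_ifs with h
    · have e1 : Even m := by
        obtain ⟨j, rfl⟩ := h
        exact ⟨2 * j, by ring⟩
      have e2 : Even (p - 1 - m) := by
        obtain ⟨j, rfl⟩ := h
        exact ⟨(p - 1 - 4 * j) / 2, by omega⟩
      have hpow : c ^ (p - 1 - m) * c ^ m = 1 := by
        rw [← pow_add, Nat.sub_add_cancel (by omega), ZMod.pow_card_sub_one_eq_one hc]
      rw [e1.neg_one_pow, e2.neg_pow, inv_pow, eq_inv_of_mul_eq_one_left hpow]
      ring
    · simp
  rw [Finset.sum_congr rfl h2, ← Finset.sum_filter]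
  symm
  rw [← Finset.sum_subset (Finset.filter_subset (fun j => 4 * j < p) (Finset.range p))]
  · refine Finset.sum_nbij' (fun j => 4 * j) (fun m => m / 4) ?_ ?_ ?_ ?_ ?_
    · intro j hj
      simp at hj ⊢
      omega
    · intro m hm
      simp at hm ⊢
      omega
    · intro j _
      simp
    · intro m hm
      simp at hm
      omega
    · intro j _
      simp
  · intro j hj hj'
    simp at hj hj'
    rw [quarticCoeff_cast_eq_zero p j hj (hj' hj), zero_mul]

/-- The number of nonzero points of the cone over a subset of projective space given by a scaling-invariant predicate. -/
lemma card_cone_projectivization {F V : Type*} [Field F] [Fintype F] [AddCommGroup V] [Module F V]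
    [Finite V] (Q : V → Prop) (hQ : ∀ (u : Fˣ) v, Q (u • v) ↔ Q v) :
    Nat.card {v : V // v ≠ 0 ∧ Q v} =
      Nat.card {P : Projectivization F V // Q P.rep} * (Fintype.card F - 1) := by
  classical
  rw [← Fintype.card_units, ← Nat.card_eq_fintype_card, ← Nat.card_prod]
  symm
  refine Nat.card_eq_of_bijective
    (fun a : {P : Projectivization F V // Q P.rep} × Fˣ =>
      (⟨a.2 • a.1.1.rep, (smul_ne_zero_iff_ne a.2).2 a.1.1.rep_nonzero,
        (hQ _ _).2 a.1.2⟩ : {v : V // v ≠ 0 ∧ Q v})) ⟨?_, ?_⟩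
  · rintro ⟨⟨P, hP⟩, u⟩ ⟨⟨P', hP'⟩, u'⟩ h
    simp only [Subtype.mk.injEq] at h
    have hPP : P = P' := by
      rw [← P.mk_rep, ← P'.mk_rep, Projectivization.mk_eq_mk_iff]
      exact ⟨u⁻¹ * u', by rw [mul_smul, ← h, inv_smul_smul]⟩
    subst hPP
    have hu : (u : F) = u' := smul_left_injective F P.rep_nonzero h
    rw [Units.ext hu]
  · rintro ⟨v, hv, hQv⟩
    obtain ⟨a, ha⟩ := Projectivization.exists_smul_eq_mk_rep F v hv
    refine ⟨⟨⟨Projectivization.mk F v hv, ?_⟩, a⁻¹⟩, ?_⟩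
    · rw [← ha]
      exact (hQ _ _).2 hQv
    · simp [← ha]

/-- The number of points of the Dwork surface modulo `p`, as a power sum. -/
lemma dworkK3Count_cast (p : ℕ) [Fact p.Prime] (lam : ZMod p) :
    (dworkK3Count (ZMod p) lam : ZMod p) =
      1 + ∑ x : Fin 4 → ZMod p, (∑ i, x i ^ 4 - 4 * lam * ∏ i, x i) ^ (p - 1) := by
  classical
  have hp := Fact.out (p := p.Prime)
  have hpz : (p : ZMod p) = 0 := ZMod.natCast_self p
  have hcone := card_cone_projectivization (F := ZMod p) (V := Fin 4 → ZMod p)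
    (fun v => v 0 ^ 4 + v 1 ^ 4 + v 2 ^ 4 + v 3 ^ 4 = 4 * lam * (v 0 * v 1 * v 2 * v 3)) (by
      intro u v
      have hu : (u : ZMod p) ^ 4 ≠ 0 := pow_ne_zero _ u.ne_zero
      simp only [Pi.smul_apply, Units.smul_def, smul_eq_mul]
      rw [← mul_right_inj' hu (b := v 0 ^ 4 + v 1 ^ 4 + v 2 ^ 4 + v 3 ^ 4)]
      ring_nf)
  have hcone' := congrArg (Nat.cast : ℕ → ZMod p) hcone
  rw [Nat.cast_mul, ZMod.card, Nat.cast_sub hp.one_le, hpz, Nat.cast_one] at hcone'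
  have hpow : ∀ x : Fin 4 → ZMod p, (∑ i, x i ^ 4 - 4 * lam * ∏ i, x i) ^ (p - 1) =
      1 - if x 0 ^ 4 + x 1 ^ 4 + x 2 ^ 4 + x 3 ^ 4 = 4 * lam * (x 0 * x 1 * x 2 * x 3)
        then 1 else 0 := by
    intro x
    rw [Fin.sum_univ_four, Fin.prod_univ_four]
    split_ifs with h
    · simp [h, Nat.sub_ne_zero_of_lt hp.one_lt]
    · simp [ZMod.pow_card_sub_one_eq_one (sub_ne_zero.2 h)]
  have hcard : Nat.card {v : Fin 4 → ZMod p // v ≠ 0 ∧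
      v 0 ^ 4 + v 1 ^ 4 + v 2 ^ 4 + v 3 ^ 4 = 4 * lam * (v 0 * v 1 * v 2 * v 3)} + 1 =
      (Finset.univ.filter fun v : Fin 4 → ZMod p =>
        v 0 ^ 4 + v 1 ^ 4 + v 2 ^ 4 + v 3 ^ 4 = 4 * lam * (v 0 * v 1 * v 2 * v 3)).card := by
    rw [Nat.card_eq_fintype_card, Fintype.card_subtype,
      ← Finset.card_erase_add_one (s := Finset.univ.filter fun v : Fin 4 → ZMod p =>
        v 0 ^ 4 + v 1 ^ 4 + v 2 ^ 4 + v 3 ^ 4 = 4 * lam * (v 0 * v 1 * v 2 * v 3))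
        (a := 0) (by simp)]
    congr 2
    ext v
    simp
  have hcard' := congrArg (Nat.cast : ℕ → ZMod p) hcard
  rw [Nat.cast_add, Nat.cast_one] at hcard'
  simp_rw [hpow]
  rw [Finset.sum_sub_distrib, Finset.sum_boole, ← hcard', hcone']
  simp [dworkK3Count]

lemma risingFac_succ (a : ℚ) (n : ℕ) : risingFac a (n + 1) = risingFac a n * (a + n) :=
  Finset.prod_range_succ _ _

lemma risingFac_quarters_mul (j : ℕ) :
    risingFac (1/4) j * risingFac (2/4) j * risingFac (3/4) j * (256 ^ j * j.factorial) =
      ((4 * j).factorial : ℚ) := by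
  induction j with
  | zero => simp [risingFac]
  | succ j ih =>
    have h : 4 * (j + 1) = 4 * j + 1 + 1 + 1 + 1 := by ring
    rw [h]
    simp only [risingFac_succ, Nat.factorial_succ, Nat.cast_mul, pow_succ, ← ih]
    push_cast
    ring

lemma hypergeometric_term_eq (lam : ℚ) (j : ℕ) :
    risingFac (1/4) j * risingFac (2/4) j * risingFac (3/4) j / ((j.factorial : ℚ)) ^ 3 *
      lam ^ (-(4 * (j : ℤ))) = quarticCoeff j * (4 * lam)⁻¹ ^ (4 * j) := by
  have hj : (j.factorial : ℚ) ≠ 0 := by exact_mod_cast j.factorial_ne_zero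
  have h := risingFac_quarters_mul j
  rw [← factorial_pow_mul_quarticCoeff] at h
  push_cast at h
  have h1 : risingFac (1/4) j * risingFac (2/4) j * risingFac (3/4) j / ((j.factorial : ℚ)) ^ 3 =
      quarticCoeff j * (256 ^ j)⁻¹ := by
    rw [← div_eq_mul_inv, div_eq_div_iff (pow_ne_zero _ hj) (by positivity)]
    apply mul_right_cancel₀ hj
    linear_combination h
  have h2 : lam ^ (-(4 * (j : ℤ))) = (lam ^ (4 * j))⁻¹ := by
    rw [zpow_neg]
    norm_cast
  rw [h1, h2, mul_inv, mul_pow, inv_pow, inv_pow, pow_mul 4 4 j, mul_assoc]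
  norm_num

/-- Reduction modulo `p` of a rational `p`-adic integer is its image in `ZMod p`. -/
lemma PadicInt.toZMod_of_coe_eq_ratCast (p : ℕ) [Fact p.Prime] (r : ℚ) (u : ℤ_[p])
    (hu : (u : ℚ_[p]) = r) (hden : (r.den : ZMod p) ≠ 0) : PadicInt.toZMod u = (r : ZMod p) := by
  have h : u * (r.den : ℤ_[p]) = (r.num : ℤ_[p]) := by
    apply PadicInt.ext
    push_cast
    rw [hu]
    exact_mod_cast r.mul_den_eq_num
  have h' := congrArg PadicInt.toZMod h
  rw [map_mul, map_natCast, map_intCast] at h'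
  rw [Rat.cast_def, eq_div_iff hden, h']

/-- Theorem 1.4: for `p ≡ 1 (mod 4)` and `λ ∈ ℚ` a `p`-adic unit with reduction `λ̄ ∈ F_p`,
the trace of Frobenius `a(p) = #X_λ̄⁴(F_p) - p² - 1` is congruent mod `p` (in `ℤ_p`) to the
truncated classical hypergeometric series `₃F₂(1/4, 2/4, 3/4; 1, 1 | 1/λ⁴)` truncated at `p`,
i.e. the period of the Dwork K3 surface mod `p`. -/
theorem dworkK3_trace_congruent_period
    (p : ℕ) [Fact p.Prime] (hp4 : p % 4 = 1) (lam : ℚ) (hlam : lam ≠ 0)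
    (hval : padicValRat p lam = 0) :
    ‖((dworkK3Count (ZMod p) ((lam : ℚ) : ZMod p) : ℚ_[p]) - (p : ℚ_[p]) ^ 2 - 1) -
        ((∑ j ∈ Finset.range p,
            risingFac (1/4) j * risingFac (2/4) j * risingFac (3/4) j /
              ((j.factorial : ℚ)) ^ 3 * lam ^ (-(4 * (j : ℤ))) : ℚ) : ℚ_[p])‖ ≤ (p : ℝ)⁻¹ := by
  have hp := Fact.out (p := p.Prime)
  have hden : ¬ p ∣ lam.den := by
    intro hd
    have hn : ¬ p ∣ lam.num.natAbs := fun h =>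
      hp.one_lt.ne' (Nat.dvd_one.1 (lam.reduced ▸ Nat.dvd_gcd h hd))
    have hd1 := one_le_padicValNat_of_dvd lam.den_nz hd
    rw [padicValRat_def, padicValInt, padicValNat.eq_zero_of_not_dvd hn] at hval
    omega
  have hnorm : ‖(lam : ℚ_[p])‖ = 1 := by
    rw [Padic.eq_padicNorm, padicNorm.eq_zpow_of_nonzero hlam, hval]
    simp
  have hden' : (lam.den : ZMod p) ≠ 0 := by rwa [Ne, ZMod.natCast_eq_zero_iff]
  obtain ⟨u, hu⟩ : ∃ u : ℤ_[p], (u : ℚ_[p]) = lam := ⟨⟨lam, hnorm.le⟩, rfl⟩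
  have hu1 : ‖u‖ = 1 := by rw [PadicInt.norm_def, hu, hnorm]
  have hured := PadicInt.toZMod_of_coe_eq_ratCast p lam u hu hden'
  have h4 : ¬ p ∣ 4 := fun h => by
    have := Nat.le_of_dvd (by norm_num) h
    have := hp.two_le
    interval_cases p <;> omega
  have h4norm : ‖(4 : ℤ_[p])‖ = 1 := by
    have h := PadicInt.norm_natCast_eq_one_iff (p := p) (n := 4)
    exact_mod_cast h.2 ((Nat.Prime.coprime_iff_not_dvd hp).2 h4)
  have hunit : IsUnit (4 * u) := by
    rw [PadicInt.isUnit_iff, norm_mul, h4norm, hu1, one_mul]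
  obtain ⟨w, hw⟩ := hunit.exists_right_inv
  have hwc : (w : ℚ_[p]) = (4 * (lam : ℚ_[p]))⁻¹ := by
    have h := congrArg (Subtype.val : ℤ_[p] → ℚ_[p]) hw
    push_cast at h
    rw [hu] at h
    exact eq_inv_of_mul_eq_one_right h
  have hwred : PadicInt.toZMod w = (4 * (lam : ZMod p))⁻¹ := by
    have h := congrArg PadicInt.toZMod hw
    rw [map_mul, map_mul, hured, map_one, map_ofNat] at h
    exact eq_inv_of_mul_eq_one_right h
  have hc : 4 * (lam : ZMod p) ≠ 0 := by
    intro h0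
    have h := congrArg PadicInt.toZMod hw
    rw [map_mul, map_mul, hured, map_one, map_ofNat, h0, zero_mul] at h
    exact zero_ne_one h
  set z : ℤ_[p] := (dworkK3Count (ZMod p) (lam : ZMod p) : ℤ_[p]) - (p : ℤ_[p]) ^ 2 - 1 -
    ∑ j ∈ Finset.range p, (quarticCoeff j : ℤ_[p]) * w ^ (4 * j) with hz
  have hzred : PadicInt.toZMod z = 0 := by
    simp only [hz, map_sub, map_sum, map_mul, map_pow, map_natCast, map_one, hwred,
      dworkK3Count_cast, sum_dwork_pow p hp4 _ hc, ZMod.natCast_self]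
    ring
  have hzmem : z ∈ Ideal.span {(p : ℤ_[p]) ^ 1} := by
    rw [pow_one, ← PadicInt.maximalIdeal_eq_span_p, ← PadicInt.ker_toZMod]
    exact hzred
  have hzn := (PadicInt.norm_le_pow_iff_mem_span_pow z 1).2 hzmem
  rw [Nat.cast_one, zpow_neg_one, PadicInt.norm_def] at hzn
  convert hzn using 2
  simp only [hypergeometric_term_eq]
  rw [hz, PadicInt.coe_sub, PadicInt.coe_sub, PadicInt.coe_sub, PadicInt.coe_sum]
  simp only [PadicInt.coe_mul, PadicInt.coe_pow, PadicInt.coe_natCast, PadicInt.coe_one, hwc]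
  push_cast
  rfl
end

section
/- Let q be a prime power with q ≡ 1 (mod 4), set t = (q−1)/4, and let T be a generator of the group of multiplicative characters of F_q^×. Let a and b be nonnegative integer multiples of t with a + b = 2t, and let λ ∈ F_q^×. Then g(T^{2t})·Σ_{j=0}^{q−2} g(T^{j+a})·g(T^{−j+b})·T^j(−1)·T^{4j}(λ) = q(q−1)·T^b(−1)·T^{2t}(1−λ⁴). -/
/-- The standard additive character of a finite field `F` of characteristic `p`,
built from a primitive `p`-th root of unity `ζ` in `ℂ`:  `θ x = ζ ^ tr(x)`. -/
noncomputable def stdAddChar {F : Type*} [Field F] [Fintype F] (p : ℕ) [CharP F p]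
    [Algebra (ZMod p) F] (ζ : ℂ) (x : F) : ℂ :=
  ζ ^ (Algebra.trace (ZMod p) F x).val

/-- The Gauss sum `g(χ) = ∑ₓ χ(x) θ(x)` with respect to the standard additive character. -/
noncomputable def gaussSum' {F : Type*} [Field F] [Fintype F] (p : ℕ) [CharP F p]
    [Algebra (ZMod p) F] (ζ : ℂ) (χ : MulChar F ℂ) : ℂ :=
  ∑ x : F, χ x * stdAddChar p ζ x

open Finset

/-- The trace pullback of a primitive additive character of `ZMod p` is a primitive additive
character, and it computes `gaussSum'`. -/
theorem exists_isPrimitive_gaussSum'_eq {F : Type*} [Field F] [Fintype F] (p : ℕ)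
    [Fact p.Prime] [CharP F p] [Algebra (ZMod p) F] {ζ : ℂ} (hζ : IsPrimitiveRoot ζ p) :
    ∃ ψ : AddChar F ℂ, ψ.IsPrimitive ∧ ∀ χ : MulChar F ℂ, gaussSum' p ζ χ = gaussSum χ ψ := by
  refine ⟨(AddChar.zmodChar p hζ.pow_eq_one).compAddMonoidHom
    (Algebra.trace (ZMod p) F).toAddMonoidHom, .of_ne_one fun h ↦ ?_, fun χ ↦ rfl⟩
  obtain ⟨x, hx⟩ := Algebra.trace_surjective (ZMod p) F 1
  have h₁ := DFunLike.congr_fun h x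
  have hval : (1 : ZMod p).val = 1 := ZMod.val_one p
  simp [AddChar.zmodChar_apply, hx, hval] at h₁
  exact hζ.ne_one (Fact.out : p.Prime).one_lt h₁

/-- A generator of the character group of a finite field takes the value `1` only at `1`. -/
theorem MulChar.eq_one_of_apply_eq_one_of_generator {F : Type*} [Field F] [Finite F]
    {T : MulChar F ℂ} (hT : ∀ χ : MulChar F ℂ, χ ∈ Subgroup.zpowers T) {c : F}
    (hc : T c = 1) : c = 1 := by
  by_contra hne
  obtain ⟨χ, hχ⟩ := MulChar.exists_apply_ne_one_of_hasEnoughRootsOfUnity F ℂ hne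
  obtain ⟨n, rfl⟩ := hT χ
  have hc₀ : c ≠ 0 := by
    rintro rfl
    simp at hc
  have hunit : T.toUnitHom (Units.mk0 c hc₀) = 1 := by
    ext
    simpa [MulChar.coe_toUnitHom] using hc
  refine hχ ?_
  exact (MulChar.zpow_apply_coe T n (Units.mk0 c hc₀)).trans <| by
    rw [← MulChar.coe_toUnitHom, map_zpow, hunit, one_zpow, Units.val_one]

/-- Orthogonality for the powers of a generator of the character group. -/
theorem MulChar.sum_range_apply_pow_of_generator {F : Type*} [Field F] [Fintype F]
    [DecidableEq F] {T : MulChar F ℂ} (hT : ∀ χ : MulChar F ℂ, χ ∈ Subgroup.zpowers T)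
    {c : F} (hc : c ≠ 0) :
    ∑ j ∈ range (Fintype.card F - 1), T c ^ j =
      if c = 1 then (Fintype.card F : ℂ) - 1 else 0 := by
  split_ifs with h
  · simp [h, Nat.cast_sub Fintype.card_pos]
  · have hne : T c ≠ 1 := mt (MulChar.eq_one_of_apply_eq_one_of_generator hT) h
    rw [geom_sum_eq hne, ← map_pow, FiniteField.pow_card_sub_one_eq_one c hc, map_one, sub_self,
      zero_div]

/-- A twisted average of products of two Gauss sums over all powers of a generator of the
character group collapses to a single character sum. -/
theorem sum_gaussSum_mul_gaussSum_of_generator {F : Type*} [Field F] [Fintype F]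
    {T : MulChar F ℂ} (hT : ∀ χ : MulChar F ℂ, χ ∈ Subgroup.zpowers T) (ψ : AddChar F ℂ)
    (A B : MulChar F ℂ) {u : F} (hu : u ≠ 0) :
    ∑ j ∈ range (Fintype.card F - 1),
        gaussSum (T ^ j * A) ψ * gaussSum ((T ^ j)⁻¹ * B) ψ * T u ^ j =
      (Fintype.card F - 1) * B u * ∑ x, (A * B) x * ψ (x * (1 + u)) := by
  classical
  have hterm (j : ℕ) :
      gaussSum (T ^ j * A) ψ * gaussSum ((T ^ j)⁻¹ * B) ψ * T u ^ j =
        ∑ x, ∑ y, A x * B y * ψ (x + y) * T (x * y⁻¹ * u) ^ j := by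
    rw [gaussSum, gaussSum, sum_mul_sum, sum_mul]
    simp only [sum_mul]
    refine sum_congr rfl fun x _ ↦ sum_congr rfl fun y _ ↦ ?_
    rcases eq_or_ne x 0 with rfl | hx
    · simp [MulChar.map_zero]
    rcases eq_or_ne y 0 with rfl | hy
    · simp [MulChar.map_zero]
    have h₁ : (T ^ j) x = T x ^ j := MulChar.pow_apply_coe T j (Units.mk0 x hx)
    have h₂ : (T ^ j) y⁻¹ = T y⁻¹ ^ j :=
      MulChar.pow_apply_coe T j (Units.mk0 y⁻¹ (inv_ne_zero hy))
    simp only [MulChar.mul_apply, MulChar.inv_apply', h₁, h₂, map_mul, mul_pow,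
      AddChar.map_add_eq_mul]
    ring
  simp_rw [hterm]
  rw [sum_comm, mul_sum]
  refine sum_congr rfl fun x _ ↦ ?_
  rw [sum_comm]
  rcases eq_or_ne x 0 with rfl | hx
  · simp [MulChar.map_zero]
  rw [sum_eq_single (x * u)]
  · have hc : x * (x * u)⁻¹ * u = 1 := by field_simp
    rw [← mul_sum, MulChar.sum_range_apply_pow_of_generator hT (by simp [hx, hu]), if_pos hc,
      MulChar.mul_apply, map_mul B, mul_add, mul_one]
    ring
  · intro y _ hy
    rcases eq_or_ne y 0 with rfl | hy₀
    · simp [MulChar.map_zero]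
    rw [← mul_sum, MulChar.sum_range_apply_pow_of_generator hT (by simp [hx, hu, hy₀]), if_neg, mul_zero]
    intro h
    apply hy
    field_simp at h
    exact h.symm
  · simp

/-- For `q ≡ 1 (mod 4)`, `t = (q-1)/4`, `T` a generator of the character group, and `a, b`
multiples of `t` with `a + b = 2t`:
`g(T^{2t}) · ∑_{j=0}^{q-2} g(T^{j+a}) g(T^{-j+b}) T^j(-1) T^{4j}(λ) =
  q(q-1) · T^b(-1) · T^{2t}(1-λ⁴)`. -/
theorem gauss_sum_product_identity
    (F : Type*) [Field F] [Fintype F] (p : ℕ) [Fact p.Prime] [CharP F p] [Algebra (ZMod p) F]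
    (ζ : ℂ) (hζ : IsPrimitiveRoot ζ p)
    (q t : ℕ) (hq : q = Fintype.card F) (hq4 : q % 4 = 1) (ht : t = (q - 1) / 4)
    (T : MulChar F ℂ) (hT : ∀ χ : MulChar F ℂ, χ ∈ Subgroup.zpowers T)
    (a b : ℕ) (ha : t ∣ a) (hb : t ∣ b) (hab : a + b = 2 * t)
    (lam : F) (hlam : lam ≠ 0) :
    gaussSum' p ζ (T ^ (2 * t)) *
      ∑ j ∈ Finset.range (q - 1),
        gaussSum' p ζ (T ^ ((j : ℤ) + (a : ℤ))) * gaussSum' p ζ (T ^ (-(j : ℤ) + (b : ℤ))) *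
          (T ^ j) (-1 : F) * (T ^ (4 * j)) lam =
      (q : ℂ) * ((q : ℂ) - 1) * (T ^ b) (-1 : F) * (T ^ (2 * t)) (1 - lam ^ 4) := by
  obtain ⟨ψ, hψ, hg⟩ := exists_isPrimitive_gaussSum'_eq (F := F) p hζ
  have hq1 : 1 < q := hq ▸ Fintype.one_lt_card
  have h4t : q - 1 = 4 * t := by omega
  have ht0 : 0 < t := by omega
  have hpow (n : ℕ) {x : F} (hx : x ≠ 0) : (T ^ n) x = T x ^ n :=
    MulChar.pow_apply_coe T n (Units.mk0 x hx)
  have hT4 (x : F) (hx : x ≠ 0) : T x ^ (4 * t) = 1 := by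
    rw [← h4t, hq, ← map_pow, FiniteField.pow_card_sub_one_eq_one x hx, map_one]
  have hquad : (T ^ (2 * t)).IsQuadratic := by
    rw [MulChar.isQuadratic_iff_sq_eq_one]
    ext x
    rw [← pow_mul, MulChar.pow_apply_coe, show 2 * t * 2 = 4 * t by ring, hT4 x x.ne_zero,
      MulChar.one_apply_coe]
  have hne : T ^ (2 * t) ≠ 1 := by
    intro h
    have hord : orderOf T = 4 * t := by
      rw [orderOf_eq_card_of_forall_mem_zpowers hT,
        MulChar.card_eq_card_units_of_hasEnoughRootsOfUnity, Nat.card_units,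
        Nat.card_eq_fintype_card, ← hq, h4t]
    have := Nat.le_of_dvd (by omega) (orderOf_dvd_of_pow_eq_one h)
    omega
  have hneg : (T ^ (2 * t)) (-1 : F) = 1 := by
    rw [hpow _ (neg_ne_zero.mpr one_ne_zero), pow_mul, ← map_pow, neg_one_sq, map_one, one_pow]
  have hsq : gaussSum (T ^ (2 * t)) ψ * gaussSum (T ^ (2 * t)) ψ = q := by
    rw [← sq, gaussSum_sq hne hquad hψ, hneg, one_mul, hq]
  have hu : -lam ^ 4 ≠ 0 := neg_ne_zero.mpr (pow_ne_zero 4 hlam)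
  have hBu : (T ^ b) (-lam ^ 4) = (T ^ b) (-1 : F) := by
    obtain ⟨k, rfl⟩ := hb
    rw [neg_eq_neg_one_mul, map_mul, hpow _ (pow_ne_zero 4 hlam), map_pow, ← pow_mul,
      ← mul_assoc, pow_mul (T lam), hT4 lam hlam, one_pow, mul_one]
  have hsum : ∑ x, (T ^ a * T ^ b) x * ψ (x * (1 + -lam ^ 4)) =
      (T ^ (2 * t)) (1 - lam ^ 4) * gaussSum (T ^ (2 * t)) ψ := by
    rw [← pow_add, hab, ← sub_eq_add_neg]
    rcases eq_or_ne (1 - lam ^ 4) 0 with h | h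
    · simp [h, MulChar.map_zero, MulChar.sum_eq_zero_of_ne_one hne]
    · have := gaussSum_mulShift_eq (T ^ (2 * t)) ψ (Units.mk0 _ h)
      rw [hquad.inv] at this
      simpa [gaussSum, AddChar.mulShift_apply, mul_comm] using this
  have hmain := sum_gaussSum_mul_gaussSum_of_generator hT ψ (T ^ a) (T ^ b) hu
  rw [hsum, hBu, ← hq] at hmain
  have hlhs : ∑ j ∈ range (q - 1),
      gaussSum' p ζ (T ^ ((j : ℤ) + (a : ℤ))) * gaussSum' p ζ (T ^ (-(j : ℤ) + (b : ℤ))) *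
        (T ^ j) (-1 : F) * (T ^ (4 * j)) lam =
      ∑ j ∈ range (q - 1),
        gaussSum (T ^ j * T ^ a) ψ * gaussSum ((T ^ j)⁻¹ * T ^ b) ψ * T (-lam ^ 4) ^ j := by
    refine sum_congr rfl fun j _ ↦ ?_
    rw [hg, hg, zpow_add, zpow_add, zpow_neg, zpow_natCast, zpow_natCast, zpow_natCast,
      hpow _ (neg_ne_zero.mpr one_ne_zero), hpow _ hlam, neg_eq_neg_one_mul (lam ^ 4), map_mul,
      map_pow, mul_pow, ← pow_mul, mul_assoc]
  rw [hlhs, hmain, hg]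
  linear_combination ((q : ℂ) - 1) * (T ^ b) (-1 : F) * (T ^ (2 * t)) (1 - lam ^ 4) * hsq
end

section
/- Let q be a prime power with q ≡ 1 (mod 4), set t = (q−1)/4, and let T be a generator of the group of multiplicative characters of F_q^×. Then for every integer j, Π_{i=0}^{3} g(T^{it+j}) = g(T^{4j}) · q · T^{−4j}(4) · T^t(−1) · g(T^{2t}). -/
/-- A quadratic multiplicative character of a finite field of odd characteristic takes the value
`-1` at non-squares. -/
theorem MulChar.apply_eq_neg_one_of_not_isSquare {F : Type*} [Field F] [Fintype F]
    {φ : MulChar F ℂ} (hφ : φ ≠ 1) (hφ2 : φ ^ 2 = 1) {b : F} (hb : ¬ IsSquare b) :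
    φ b = -1 := by
  classical
  have sq (x : F) (hx : x ≠ 0) : φ x * φ x = 1 := by
    have := congrArg (fun χ : MulChar F ℂ ↦ χ x) hφ2
    simpa [pow_two, MulChar.mul_apply, MulChar.one_apply hx.isUnit] using this
  obtain ⟨a, ha⟩ := MulChar.ne_one_iff.mp hφ
  have hb0 : b ≠ 0 := by rintro rfl; exact hb (IsSquare.zero)
  have ha' : ¬ IsSquare (a : F) := by
    rintro ⟨c, hc⟩
    have hc0 : c ≠ 0 := by rintro rfl; exact a.ne_zero (by simp at hc)
    exact ha (by rw [hc, map_mul, sq c hc0])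
  have hF : ringChar F ≠ 2 := fun h ↦ hb (FiniteField.isSquare_of_char_two h b)
  have hab : IsSquare ((a : F) * b) := by
    rw [← quadraticChar_one_iff_isSquare (mul_ne_zero a.ne_zero hb0), map_mul,
      quadraticChar_neg_one_iff_not_isSquare.mpr ha',
      quadraticChar_neg_one_iff_not_isSquare.mpr hb]
    norm_num
  have h1 : φ a = -1 := (mul_self_eq_one_iff.mp (sq a a.ne_zero)).resolve_left ha
  obtain ⟨c, hc⟩ := hab
  have hc0 : c ≠ 0 := by rintro rfl; simp [hb0] at hc
  have h2 : φ a * φ b = 1 := by rw [← map_mul, hc, map_mul, sq c hc0]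
  rw [h1] at h2
  linear_combination -h2

/-- Every nontrivial complex character of order two of a finite field is the quadratic character. -/
theorem MulChar.apply_eq_quadraticChar_s4 {F : Type*} [Field F] [Fintype F] [DecidableEq F]
    {φ : MulChar F ℂ} (hφ : φ ≠ 1) (hφ2 : φ ^ 2 = 1) (u : F) :
    φ u = ((quadraticChar F u : ℤ) : ℂ) := by
  by_cases hu : IsSquare u
  · rcases eq_or_ne u 0 with rfl | hu0
    · simp
    · rw [(quadraticChar_one_iff_isSquare hu0).mpr hu]
      obtain ⟨c, rfl⟩ := hu
      have := congrArg (fun χ : MulChar F ℂ ↦ χ c) hφ2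
      have hc : c ≠ 0 := left_ne_zero_of_mul hu0
      simpa [pow_two, MulChar.mul_apply, MulChar.one_apply hc.isUnit] using this
  · rw [MulChar.apply_eq_neg_one_of_not_isSquare hφ hφ2 hu,
      quadraticChar_neg_one_iff_not_isSquare.mpr hu]
    norm_num

/-- The number of square roots of `u` is `1 + φ u`, for `φ` the quadratic character. -/
theorem MulChar.card_sqrts {F : Type*} [Field F] [Fintype F] [DecidableEq F]
    (hF : ringChar F ≠ 2) {φ : MulChar F ℂ} (hφ : φ ≠ 1) (hφ2 : φ ^ 2 = 1) (u : F) :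
    (({x : F | x ^ 2 = u} : Finset F).card : ℂ) = 1 + φ u := by
  have := quadraticChar_card_sqrts hF u
  rw [MulChar.apply_eq_quadraticChar_s4 hφ hφ2, add_comm, ← Int.cast_one (R := ℂ), ← Int.cast_add,
    ← this]
  simp

/-- `χ(4) J(χ, χ) = J(φ, χ)` for `φ` the quadratic character. -/
theorem apply_four_mul_jacobiSum_self {F : Type*} [Field F] [Fintype F]
    (hF : ringChar F ≠ 2) {φ χ : MulChar F ℂ} (hφ : φ ≠ 1) (hφ2 : φ ^ 2 = 1) (hχ : χ ≠ 1) :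
    χ 4 * jacobiSum χ χ = jacobiSum φ χ := by
  classical
  have h2 : (2 : F) ≠ 0 := Ring.two_ne_zero hF
  have hsum : ∑ u : F, χ (1 - u) = 0 := by
    rw [← MulChar.sum_eq_zero_of_ne_one hχ]
    exact (Equiv.subLeft (1 : F)).sum_comp χ
  calc χ 4 * jacobiSum χ χ = ∑ x : F, χ (1 - (1 - 2 * x) ^ 2) := by
        rw [jacobiSum, Finset.mul_sum]
        refine Finset.sum_congr rfl fun x _ ↦ ?_
        rw [← map_mul, ← map_mul]
        congr 1
        ring
    _ = ∑ y : F, χ (1 - y ^ 2) :=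
        ((Equiv.mulLeft₀ (2 : F) h2).trans (Equiv.subLeft 1)).sum_comp fun y ↦ χ (1 - y ^ 2)
    _ = ∑ u : F, ∑ y ∈ ({x : F | x ^ 2 = u} : Finset F), χ (1 - y ^ 2) :=
        (Finset.sum_fiberwise _ _ _).symm
    _ = ∑ u : F, (1 + φ u) * χ (1 - u) := by
        refine Finset.sum_congr rfl fun u _ ↦ ?_
        rw [← MulChar.card_sqrts hF hφ hφ2, ← nsmul_eq_mul, ← Finset.sum_const]
        refine Finset.sum_congr rfl fun y hy ↦ ?_
        rw [(Finset.mem_filter.mp hy).2]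
    _ = jacobiSum φ χ := by
        simp_rw [add_mul, one_mul, Finset.sum_add_distrib, hsum, zero_add, jacobiSum]

/-- The duplication formula for Gauss sums: the Hasse–Davenport product relation with `m = 2`. -/
theorem gaussSum_mul_gaussSum_mul_quadratic {F : Type*} [Field F] [Fintype F]
    (hF : ringChar F ≠ 2) {φ : MulChar F ℂ} (hφ : φ ≠ 1) (hφ2 : φ ^ 2 = 1)
    {ψ : AddChar F ℂ} (hψ : ψ.IsPrimitive) (χ : MulChar F ℂ) :
    gaussSum χ ψ * gaussSum (χ * φ) ψ = χ⁻¹ 4 * gaussSum (χ ^ 2) ψ * gaussSum φ ψ := by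
  have h2 : (2 : F) ≠ 0 := Ring.two_ne_zero hF
  have h4 : (4 : F) = 2 * 2 := by norm_num
  have h40 : (4 : F) ≠ 0 := h4 ▸ mul_ne_zero h2 h2
  have hcard : (Fintype.card F : ℂ) ≠ 0 := Nat.cast_ne_zero.mpr Fintype.card_ne_zero
  by_cases hχ : χ = 1
  · simp [hχ, MulChar.one_apply h40.isUnit]
  by_cases hχφ : χ * φ = 1
  · have hχ' : χ = φ := mul_right_cancel (hχφ.trans (by rw [← hφ2, pow_two]))
    subst hχ'
    have : χ⁻¹ 4 = 1 := by
      rw [inv_eq_of_mul_eq_one_right hχφ, h4, map_mul, ← MulChar.mul_apply, hχφ,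
        MulChar.one_apply h2.isUnit]
    rw [this, pow_two, one_mul, mul_comm]
  have hχ2 : χ * χ ≠ 1 := by
    intro h
    classical
    refine hχφ ?_
    have hχ' : χ = φ := MulChar.ext' fun u ↦ by
      rw [MulChar.apply_eq_quadraticChar_s4 hχ (by rw [pow_two, h]),
        MulChar.apply_eq_quadraticChar_s4 hφ hφ2]
    rw [← hχ', h]
  have e1 := jacobiSum_mul_nontrivial hχ2 ψ
  have e2 := jacobiSum_mul_nontrivial hχφ ψ
  rw [jacobiSum_comm, ← apply_four_mul_jacobiSum_self hF hφ hφ2 hχ] at e2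
  have e3 : χ⁻¹ 4 * χ 4 = 1 := by
    rw [← MulChar.mul_apply, inv_mul_cancel, MulChar.one_apply h40.isUnit]
  refine mul_left_cancel₀ (gaussSum_ne_zero_of_nontrivial hcard hχ hψ) ?_
  rw [pow_two]
  linear_combination (-gaussSum (χ * φ) ψ) * e1 + χ⁻¹ 4 * gaussSum (χ * χ) ψ * e2
    - gaussSum (χ * χ) ψ * gaussSum (χ * φ) ψ * jacobiSum χ χ * e3

/-- The function `stdAddChar p ζ` is a primitive additive character. -/
theorem exists_isPrimitive_addChar_eq_stdAddChar (F : Type*) [Field F] [Fintype F] (p : ℕ)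
    [Fact p.Prime] [CharP F p] [Algebra (ZMod p) F] {ζ : ℂ} (hζ : IsPrimitiveRoot ζ p) :
    ∃ ψ : AddChar F ℂ, ψ.IsPrimitive ∧ ∀ x, ψ x = stdAddChar p ζ x := by
  let ψ : AddChar F ℂ := (AddChar.zmodChar p hζ.pow_eq_one).compAddMonoidHom
    (Algebra.trace (ZMod p) F).toAddMonoidHom
  refine ⟨ψ, AddChar.IsPrimitive.of_ne_one fun h ↦ ?_, fun x ↦ rfl⟩
  obtain ⟨x, hx⟩ := Algebra.trace_surjective (ZMod p) F 1
  have hp := (Fact.out : p.Prime).one_lt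
  have h1 : ψ x = 1 := by rw [h, AddChar.one_apply]
  have h2 : ψ x = ζ := by
    change ζ ^ (Algebra.trace (ZMod p) F x).val = ζ
    rw [hx, ZMod.val_one, pow_one]
  exact hζ.ne_one hp (h2 ▸ h1)

/-- The Hasse–Davenport product relation with `m = 4`, for a character `η` of order four. -/
theorem gaussSum_prod_four {F : Type*} [Field F] [Fintype F] (hF : ringChar F ≠ 2)
    {η : MulChar F ℂ} (hη : η ^ 2 ≠ 1) (hη4 : η ^ 4 = 1)
    {ψ : AddChar F ℂ} (hψ : ψ.IsPrimitive) (χ : MulChar F ℂ) :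
    gaussSum χ ψ * gaussSum (χ * η) ψ * gaussSum (χ * η ^ 2) ψ * gaussSum (χ * η ^ 3) ψ =
      gaussSum (χ ^ 4) ψ * Fintype.card F * (χ ^ 4)⁻¹ 4 * η (-1) * gaussSum (η ^ 2) ψ := by
  have hcard : (Fintype.card F : ℂ) ≠ 0 := Nat.cast_ne_zero.mpr Fintype.card_ne_zero
  have hη1 : η ≠ 1 := by rintro rfl; simp at hη
  have hφ2 : (η ^ 2) ^ 2 = 1 := by rw [← pow_mul, hη4]
  have hφ : (η ^ 2).IsQuadratic := fun x ↦ by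
    classical
    rw [MulChar.apply_eq_quadraticChar_s4 hη hφ2]
    rcases eq_or_ne x 0 with rfl | hx
    · simp
    · rcases quadraticChar_dichotomy hx with h | h <;> simp [h]
  have hneg : (η ^ 2) (-1) = 1 := by
    rw [MulChar.pow_apply' _ two_ne_zero, ← map_pow]
    simp
  have hsq : gaussSum (η ^ 2) ψ ^ 2 = Fintype.card F := by
    rw [gaussSum_sq hη hφ hψ, hneg, one_mul]
  have hinv : gaussSum η ψ * gaussSum (η ^ 3) ψ = η (-1) * Fintype.card F := by
    have h3 : η ^ 3 = η⁻¹ := eq_inv_of_mul_eq_one_left (by rw [← pow_succ, hη4])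
    rw [h3, ← gaussSum_mul_gaussSum_eq_card hη1 hψ, ← mul_gaussSum_inv_eq_gaussSum η⁻¹ ψ,
      MulChar.inv_apply', inv_neg_one]
    ring
  have dup := gaussSum_mul_gaussSum_mul_quadratic hF hη hφ2 hψ
  have hη' : η⁻¹ 4 = η (-1) := by
    have h := dup η
    rw [← pow_succ', hinv, mul_assoc, ← pow_two, hsq] at h
    exact (mul_right_cancel₀ hcard h).symm
  have e1 := dup χ
  have e2 := dup (χ * η)
  have e3 := dup (χ ^ 2)
  have hinv4 : (χ ^ 4)⁻¹ 4 = χ⁻¹ 4 ^ 2 * (χ ^ 2)⁻¹ 4 := by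
    rw [← inv_pow, ← inv_pow, MulChar.pow_apply' _ four_ne_zero, MulChar.pow_apply' _ two_ne_zero,
      ← pow_add]
  rw [mul_assoc, ← pow_succ', mul_pow, mul_inv, MulChar.mul_apply, hη'] at e2
  rw [← pow_mul] at e3
  rw [hinv4]
  calc _ = (gaussSum χ ψ * gaussSum (χ * η ^ 2) ψ) *
        (gaussSum (χ * η) ψ * gaussSum (χ * η ^ 3) ψ) := by ring
    _ = χ⁻¹ 4 ^ 2 * η (-1) * gaussSum (η ^ 2) ψ ^ 2 *
        (gaussSum (χ ^ 2) ψ * gaussSum (χ ^ 2 * η ^ 2) ψ) := by rw [e1, e2]; ring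
    _ = _ := by rw [e3, hsq]; ring

/-- Hasse–Davenport specialization: for `q ≡ 1 (mod 4)`, `t = (q-1)/4` and `T` a generator of
the character group of `F_q`, `∏_{i=0}^{3} g(T^{it+j}) = g(T^{4j})·q·T^{-4j}(4)·T^t(-1)·g(T^{2t})`. -/
theorem gauss_product_hasse_davenport_four
    (F : Type*) [Field F] [Fintype F] (p : ℕ) [Fact p.Prime] [CharP F p] [Algebra (ZMod p) F]
    (ζ : ℂ) (hζ : IsPrimitiveRoot ζ p)
    (q t : ℕ) (hq : q = Fintype.card F) (hq4 : q % 4 = 1) (ht : t = (q - 1) / 4)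
    (T : MulChar F ℂ) (hT : ∀ χ : MulChar F ℂ, χ ∈ Subgroup.zpowers T) (j : ℤ) :
    ∏ i ∈ Finset.range 4, gaussSum' p ζ (T ^ ((i : ℤ) * (t : ℤ) + j)) =
      gaussSum' p ζ (T ^ (4 * j)) * (q : ℂ) * (T ^ (-(4 * j))) (4 : F) * (T ^ t) (-1 : F) *
        gaussSum' p ζ (T ^ (2 * t)) := by
  obtain ⟨ψ, hψ, hψθ⟩ := exists_isPrimitive_addChar_eq_stdAddChar F p hζ
  have hg (χ : MulChar F ℂ) : gaussSum' p ζ χ = gaussSum χ ψ := by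
    simp only [gaussSum', gaussSum, hψθ]
  have hF : ringChar F ≠ 2 := fun h ↦ by
    have := FiniteField.even_card_of_char_two h
    omega
  have hq1 : 1 < q := hq ▸ Fintype.one_lt_card
  have hT4 : orderOf T = 4 * t := by
    rw [orderOf_eq_card_of_forall_mem_zpowers hT,
      MulChar.card_eq_card_units_of_hasEnoughRootsOfUnity F ℂ, Nat.card_units,
      Nat.card_eq_fintype_card]
    omega
  have hη : (T ^ t) ^ 2 ≠ 1 := by
    rw [← pow_mul]
    exact pow_ne_one_of_lt_orderOf (by omega) (by omega)
  have hη4 : (T ^ t) ^ 4 = 1 := by rw [← pow_mul, mul_comm, ← hT4, pow_orderOf_eq_one]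
  have hpow (i : ℕ) : T ^ ((i : ℤ) * (t : ℤ) + j) = T ^ j * (T ^ t) ^ i := by
    rw [zpow_add, mul_comm, ← pow_mul, mul_comm t, ← Nat.cast_mul, zpow_natCast]
  have h4 : T ^ (4 * j) = (T ^ j) ^ 4 := by
    rw [mul_comm, zpow_mul]
    rfl
  simp only [hg, hpow, Finset.prod_range_succ, Finset.prod_range_zero, pow_zero, pow_one, mul_one,
    one_mul, zpow_neg, h4, hq, mul_comm 2 t, pow_mul T t 2]
  exact gaussSum_prod_four hF hη hη4 hψ (T ^ j)
end
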